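/- Energy tail estimate: for every Λ₀ > 0 there exist σ₀ > 0, C(Λ₀) > 0 and 𝔭₀(Λ₀) > 0 such that, if u satisfies the quasi-minimizer hypotheses with momentum 𝔭 ≥ 𝔭₀(Λ₀) and speed c, and if m ∈ ℝ² denotes the midpoint of the two zeros of u, then for every R ≥ 1: ∫_{{x ∈ ℝ² : |x − m| ≥ R𝔭}} (|∇u|² + (1/2)(1 − |u|²)²) dx ≤ C(Λ₀)/R^{σ₀}. -/

import Mathlib

open MeasureTheory Filter Metric

noncomputable section

/-- First partial derivative (direction `x₁`), identifying `ℝ²` with `ℂ`. -/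
def pd1 (u : ℂ → ℂ) (z : ℂ) : ℂ := fderiv ℝ u z 1

/-- Second partial derivative (direction `x₂`). -/
def pd2 (u : ℂ → ℂ) (z : ℂ) : ℂ := fderiv ℝ u z Complex.I

/-- Laplacian `Δu`. -/
def lap (u : ℂ → ℂ) (z : ℂ) : ℂ := fderiv ℝ (pd1 u) z 1 + fderiv ℝ (pd2 u) z Complex.I

/-- `|∇u|²`. -/
def gradSq (u : ℂ → ℂ) (z : ℂ) : ℝ := ‖pd1 u z‖ ^ 2 + ‖pd2 u z‖ ^ 2

/-- Ginzburg–Landau energy density. -/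
def energyDensity (u : ℂ → ℂ) (z : ℂ) : ℝ :=
  (1 / 2) * gradSq u z + (1 / 4) * (1 - ‖u z‖ ^ 2) ^ 2

/-- Ginzburg–Landau energy, valued in `[0,∞]`. -/
def energy (u : ℂ → ℂ) : ENNReal := ∫⁻ z : ℂ, ENNReal.ofReal (energyDensity u z)

/-- `E(u)`, real valued. -/
def Efun (u : ℂ → ℂ) : ℝ := (energy u).toReal

/-- The energy space `ℰ`: (smooth) maps with finite Ginzburg–Landau energy. -/
def memE (u : ℂ → ℂ) : Prop := ContDiff ℝ (⊤ : ℕ∞) u ∧ energy u < ⊤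

/-- Momentum density `Re(i ∂₂u (conj u − 1))`. -/
def momDensity (u : ℂ → ℂ) (z : ℂ) : ℝ :=
  (Complex.I * pd2 u z * ((starRingEnd ℂ) (u z) - 1)).re

/-- Integrability of the momentum density. -/
def momInt (u : ℂ → ℂ) : Prop := Integrable (momDensity u)

/-- The momentum `P₂(u)`. -/
def P2 (u : ℂ → ℂ) : ℝ := (1 / 2) * ∫ z : ℂ, momDensity u z

/-- `(TW_c)(u) = 0`: the travelling wave equation `−ic∂₂u − Δu − (1−|u|²)u = 0`. -/
def TW (c : ℝ) (u : ℂ → ℂ) : Prop :=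
  ∀ z : ℂ, -(Complex.I * (c : ℂ) * pd2 u z) - lap u z - ((1 - ‖u z‖ ^ 2 : ℝ) : ℂ) * u z = 0

/-- `E_min(p)`. -/
def Emin (p : ℝ) : ℝ := sInf (Efun '' {u : ℂ → ℂ | memE u ∧ P2 u = p})

/-- Evenness in `x₁`: `u(−x₁, x₂) = u(x₁, x₂)`. -/
def evenX1 (u : ℂ → ℂ) : Prop := ∀ z : ℂ, u (-((starRingEnd ℂ) z)) = u z

/-- Quasi-minimizer hypotheses (with symmetry), momentum `p` and speed `c`. -/
def QuasiMin (Λ₀ : ℝ) (u : ℂ → ℂ) (p c : ℝ) : Prop :=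
  memE u ∧ evenX1 u ∧ 0 < c ∧ TW c u ∧ momInt u ∧ P2 u = p ∧
  Efun u ≤ 2 * Real.pi * Real.log p + Λ₀

/-- `V1` is the degree-one vortex with (increasing) modulus profile `ρ`. -/
def IsVortex (V1 : ℂ → ℂ) (ρ : ℝ → ℝ) : Prop :=
  ContDiff ℝ (⊤ : ℕ∞) V1 ∧
  (∀ z : ℂ, lap V1 z + V1 z * ((1 - ‖V1 z‖ ^ 2 : ℝ) : ℂ) = 0) ∧
  V1 0 = 0 ∧
  (∀ z : ℂ, z ≠ 0 → V1 z = ((ρ ‖z‖ : ℝ) : ℂ) * (z / (‖z‖ : ℂ))) ∧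
  ρ 0 = 0 ∧ StrictMonoOn ρ (Set.Ici 0) ∧
  (∀ r : ℝ, 0 ≤ r → 0 ≤ ρ r ∧ ρ r < 1) ∧
  Filter.Tendsto ρ Filter.atTop (nhds 1)

/-- Partial derivative of a real function in the direction `1`. -/
def dx (f : ℂ → ℝ) (z : ℂ) : ℝ := fderiv ℝ f z 1

/-- Partial derivative of a real function in the direction `I`. -/
def dy (f : ℂ → ℝ) (z : ℂ) : ℝ := fderiv ℝ f z Complex.I

/-- Smooth real functions on the plane. -/
@[fun_prop]
def Smooth (f : ℂ → ℝ) : Prop := ContDiff ℝ (⊤ : ℕ∞) f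

namespace Smooth
variable {f g : ℂ → ℝ}

theorem contDiff (hf : Smooth f) : ContDiff ℝ (⊤ : ℕ∞) f := hf

@[fun_prop]
theorem differentiable (hf : Smooth f) : Differentiable ℝ f :=
  ContDiff.differentiable hf (by simp)

@[fun_prop]
theorem differentiableAt (hf : Smooth f) {z : ℂ} : DifferentiableAt ℝ f z :=
  hf.differentiable z

@[fun_prop]
theorem continuous (hf : Smooth f) : Continuous f := ContDiff.continuous hf

@[fun_prop]
theorem const (c : ℝ) : Smooth fun _ => c := contDiff_const

@[fun_prop]
theorem re : Smooth fun z => z.re := Complex.reCLM.contDiff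

@[fun_prop]
theorem im : Smooth fun z => z.im := Complex.imCLM.contDiff

@[fun_prop]
theorem add (hf : Smooth f) (hg : Smooth g) : Smooth fun z => f z + g z := ContDiff.add hf hg

@[fun_prop]
theorem sub (hf : Smooth f) (hg : Smooth g) : Smooth fun z => f z - g z := ContDiff.sub hf hg

@[fun_prop]
theorem mul (hf : Smooth f) (hg : Smooth g) : Smooth fun z => f z * g z := ContDiff.mul hf hg

@[fun_prop]
theorem neg (hf : Smooth f) : Smooth fun z => -f z := ContDiff.neg hf

@[fun_prop]
theorem pow (hf : Smooth f) (n : ℕ) : Smooth fun z => f z ^ n := ContDiff.pow hf n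

@[fun_prop]
theorem div_const (hf : Smooth f) (c : ℝ) : Smooth fun z => f z / c := ContDiff.div_const hf c

theorem fderiv_apply (hf : Smooth f) (v : ℂ) : Smooth fun z => fderiv ℝ f z v :=
  (ContDiff.fderiv_right (m := (⊤ : ℕ∞)) hf (by simp)).clm_apply contDiff_const

@[fun_prop]
theorem dx (hf : Smooth f) : Smooth (dx f) := hf.fderiv_apply 1

@[fun_prop]
theorem dy (hf : Smooth f) : Smooth (dy f) := hf.fderiv_apply Complex.I

end Smooth

section Rules
variable {f g : ℂ → ℝ} {z : ℂ}

theorem fderiv_apply_eq (f : ℂ → ℝ) (z v : ℂ) :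
    fderiv ℝ f z v = v.re * dx f z + v.im * dy f z := by
  have : v = v.re • (1 : ℂ) + v.im • Complex.I := by
    apply Complex.ext <;> simp
  conv_lhs => rw [this]
  rw [map_add, map_smul, map_smul]; rfl

theorem dx_const (c : ℝ) : dx (fun _ => c) z = 0 := by simp [dx]
theorem dy_const (c : ℝ) : dy (fun _ => c) z = 0 := by simp [dy]

theorem dx_re : dx (fun z => z.re) z = 1 := by
  have : fderiv ℝ (fun z : ℂ => z.re) z = Complex.reCLM := Complex.reCLM.fderiv
  simp [dx, this]
theorem dy_re : dy (fun z => z.re) z = 0 := by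
  have : fderiv ℝ (fun z : ℂ => z.re) z = Complex.reCLM := Complex.reCLM.fderiv
  simp [dy, this]
theorem dx_im : dx (fun z => z.im) z = 0 := by
  have : fderiv ℝ (fun z : ℂ => z.im) z = Complex.imCLM := Complex.imCLM.fderiv
  simp [dx, this]
theorem dy_im : dy (fun z => z.im) z = 1 := by
  have : fderiv ℝ (fun z : ℂ => z.im) z = Complex.imCLM := Complex.imCLM.fderiv
  simp [dy, this]

theorem dx_add (hf : DifferentiableAt ℝ f z) (hg : DifferentiableAt ℝ g z) :
    dx (fun z => f z + g z) z = dx f z + dx g z := by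
  simp [dx, fderiv_fun_add hf hg]
theorem dy_add (hf : DifferentiableAt ℝ f z) (hg : DifferentiableAt ℝ g z) :
    dy (fun z => f z + g z) z = dy f z + dy g z := by
  simp [dy, fderiv_fun_add hf hg]
theorem dx_sub (hf : DifferentiableAt ℝ f z) (hg : DifferentiableAt ℝ g z) :
    dx (fun z => f z - g z) z = dx f z - dx g z := by
  simp [dx, fderiv_fun_sub hf hg]
theorem dy_sub (hf : DifferentiableAt ℝ f z) (hg : DifferentiableAt ℝ g z) :
    dy (fun z => f z - g z) z = dy f z - dy g z := by
  simp [dy, fderiv_fun_sub hf hg]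
theorem dx_mul (hf : DifferentiableAt ℝ f z) (hg : DifferentiableAt ℝ g z) :
    dx (fun z => f z * g z) z = dx f z * g z + f z * dx g z := by
  simp [dx, fderiv_fun_mul hf hg]; ring
theorem dy_mul (hf : DifferentiableAt ℝ f z) (hg : DifferentiableAt ℝ g z) :
    dy (fun z => f z * g z) z = dy f z * g z + f z * dy g z := by
  simp [dy, fderiv_fun_mul hf hg]; ring
theorem dy_neg : dy (fun z => -f z) z = -dy f z := by
  simp [dy, fderiv_fun_neg]
theorem dx_pow (hf : DifferentiableAt ℝ f z) (n : ℕ) :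
    dx (fun z => f z ^ n) z = n * f z ^ (n - 1) * dx f z := by
  simp [dx, fderiv_fun_pow n hf]
theorem dy_pow (hf : DifferentiableAt ℝ f z) (n : ℕ) :
    dy (fun z => f z ^ n) z = n * f z ^ (n - 1) * dy f z := by
  simp [dy, fderiv_fun_pow n hf]
theorem dx_div_const (c : ℝ) (hf : DifferentiableAt ℝ f z) :
    dx (fun z => f z / c) z = dx f z / c := by
  simp only [div_eq_mul_inv]
  simp [dx, fderiv_mul_const hf]; ring
theorem dy_div_const (c : ℝ) (hf : DifferentiableAt ℝ f z) :
    dy (fun z => f z / c) z = dy f z / c := by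
  simp only [div_eq_mul_inv]
  simp [dy, fderiv_mul_const hf]; ring

theorem dx_comp {φ : ℝ → ℝ} (hφ : DifferentiableAt ℝ φ (f z)) (hf : DifferentiableAt ℝ f z) :
    dx (fun z => φ (f z)) z = deriv φ (f z) * dx f z := by
  have h := hφ.hasDerivAt.comp_hasFDerivAt z hf.hasFDerivAt
  have : fderiv ℝ (fun z => φ (f z)) z = deriv φ (f z) • fderiv ℝ f z := h.fderiv
  simp [dx, this]
theorem dy_comp {φ : ℝ → ℝ} (hφ : DifferentiableAt ℝ φ (f z)) (hf : DifferentiableAt ℝ f z) :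
    dy (fun z => φ (f z)) z = deriv φ (f z) * dy f z := by
  have h := hφ.hasDerivAt.comp_hasFDerivAt z hf.hasFDerivAt
  have : fderiv ℝ (fun z => φ (f z)) z = deriv φ (f z) • fderiv ℝ f z := h.fderiv
  simp [dy, this]

/-- Mixed partial derivatives commute. -/
theorem dx_dy_comm (hf : Smooth f) (z : ℂ) : dx (dy f) z = dy (dx f) z := by
  have h2 : ContDiffAt ℝ 2 f z := (hf.contDiff.of_le (by norm_cast)).contDiffAt
  have hs := h2.isSymmSndFDerivAt (by simp)
  have hd : DifferentiableAt ℝ (fderiv ℝ f) z :=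
    (ContDiff.fderiv_right (m := (⊤ : ℕ∞)) hf.contDiff (by simp)).differentiable (by simp) z
  have key : ∀ v w : ℂ, fderiv ℝ (fun y => fderiv ℝ f y v) z w = fderiv ℝ (fderiv ℝ f) z w v := by
    intro v w
    rw [fderiv_clm_apply hd (differentiableAt_const v)]
    simp
  change fderiv ℝ (fun y => fderiv ℝ f y Complex.I) z 1
    = fderiv ℝ (fun y => fderiv ℝ f y 1) z Complex.I
  rw [key, key]
  exact hs 1 Complex.I

theorem dx_eq_zero_of_notMem (h : z ∉ tsupport f) : dx f z = 0 := by
  have := image_eq_zero_of_notMem_tsupport (fun h' => h (tsupport_fderiv_subset ℝ h'))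
  simp [dx, this]
theorem dy_eq_zero_of_notMem (h : z ∉ tsupport f) : dy f z = 0 := by
  have := image_eq_zero_of_notMem_tsupport (fun h' => h (tsupport_fderiv_subset ℝ h'))
  simp [dy, this]

theorem HasCompactSupport.dx (hf : HasCompactSupport f) : HasCompactSupport (dx f) :=
  HasCompactSupport.fderiv_apply ℝ hf 1
theorem HasCompactSupport.dy (hf : HasCompactSupport f) : HasCompactSupport (dy f) :=
  HasCompactSupport.fderiv_apply ℝ hf Complex.I

theorem integral_fderiv_apply_eq_zero (hf : Smooth f) (h : HasCompactSupport f) (v : ℂ) :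
    ∫ z, fderiv ℝ f z v = 0 := by
  have h1 : Integrable (fun z => fderiv ℝ f z v) :=
    (hf.fderiv_apply v).continuous.integrable_of_hasCompactSupport (h.fderiv_apply ℝ v)
  have h2 : Integrable f := hf.continuous.integrable_of_hasCompactSupport h
  have := integral_mul_fderiv_eq_neg_fderiv_mul_of_integrable (μ := (volume : Measure ℂ))
    (f := fun _ => (1 : ℝ)) (g := f) (v := v) (by simp) (by simpa using h1) (by simpa using h2)
    (fun x _ => differentiableAt_const _) (fun x _ => hf.differentiable x)
  simpa using this

theorem integral_dx_eq_zero (hf : Smooth f) (h : HasCompactSupport f) : ∫ z, dx f z = 0 :=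
  integral_fderiv_apply_eq_zero hf h 1

theorem integral_dy_eq_zero (hf : Smooth f) (h : HasCompactSupport f) : ∫ z, dy f z = 0 :=
  integral_fderiv_apply_eq_zero hf h Complex.I

end Rules

/-- The travelling wave equation for `u = a + i b`, written as a real system. -/
structure GP (c : ℝ) (a b : ℂ → ℝ) : Prop where
  sa : Smooth a
  sb : Smooth b
  eqa : ∀ z, dx (dx a) z + dy (dy a) z = c * dy b z - (1 - a z ^ 2 - b z ^ 2) * a z
  eqb : ∀ z, dx (dx b) z + dy (dy b) z = -c * dy a z - (1 - a z ^ 2 - b z ^ 2) * b z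

/-- The potential variable `1 - |u|²`. -/
def eta (a b : ℂ → ℝ) (z : ℂ) : ℝ := 1 - a z ^ 2 - b z ^ 2

/-- The squared gradient `|∇u|²`. -/
def gsq (a b : ℂ → ℝ) (z : ℂ) : ℝ := dx a z ^ 2 + dy a z ^ 2 + dx b z ^ 2 + dy b z ^ 2

/-- The energy density. -/
def en (a b : ℂ → ℝ) (z : ℂ) : ℝ := gsq a b z / 2 + eta a b z ^ 2 / 4

/-- The Jacobian type density `⟨i∂₂u, ∂₁u⟩`. -/
def jac (a b : ℂ → ℝ) (z : ℂ) : ℝ := dy a z * dx b z - dx a z * dy b z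

/-- First component of the current `⟨iu, ∇u⟩`. -/
def cur1 (a b : ℂ → ℝ) (z : ℂ) : ℝ := a z * dx b z - b z * dx a z

/-- Second component of the current `⟨iu, ∇u⟩`. -/
def cur2 (a b : ℂ → ℝ) (z : ℂ) : ℝ := a z * dy b z - b z * dy a z

section Densities
variable {a b : ℂ → ℝ}

@[fun_prop] theorem Smooth.eta (ha : Smooth a) (hb : Smooth b) : Smooth (eta a b) := by
  unfold _root_.eta; fun_prop
@[fun_prop] theorem Smooth.gsq (ha : Smooth a) (hb : Smooth b) : Smooth (gsq a b) := by
  unfold _root_.gsq; fun_prop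
@[fun_prop] theorem Smooth.en (ha : Smooth a) (hb : Smooth b) : Smooth (en a b) := by
  unfold _root_.en; fun_prop
@[fun_prop] theorem Smooth.jac (ha : Smooth a) (hb : Smooth b) : Smooth (jac a b) := by
  unfold _root_.jac; fun_prop
@[fun_prop] theorem Smooth.cur1 (ha : Smooth a) (hb : Smooth b) : Smooth (cur1 a b) := by
  unfold _root_.cur1; fun_prop
@[fun_prop] theorem Smooth.cur2 (ha : Smooth a) (hb : Smooth b) : Smooth (cur2 a b) := by
  unfold _root_.cur2; fun_prop

theorem gsq_nonneg (a b : ℂ → ℝ) (z : ℂ) : 0 ≤ gsq a b z := by unfold gsq; positivity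
theorem en_nonneg (a b : ℂ → ℝ) (z : ℂ) : 0 ≤ en a b z := by
  have := gsq_nonneg a b z; unfold en; positivity
theorem gsq_le_en (a b : ℂ → ℝ) (z : ℂ) : gsq a b z ≤ 2 * en a b z := by
  unfold en; nlinarith [sq_nonneg (eta a b z)]
theorem eta_sq_le_en (a b : ℂ → ℝ) (z : ℂ) : eta a b z ^ 2 ≤ 4 * en a b z := by
  unfold en; nlinarith [gsq_nonneg a b z]
theorem abs_jac_le (a b : ℂ → ℝ) (z : ℂ) : |jac a b z| ≤ gsq a b z / 2 := by
  unfold jac gsq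
  rw [abs_le]; constructor <;>
  nlinarith [sq_nonneg (dy a z - dx b z), sq_nonneg (dy a z + dx b z),
    sq_nonneg (dx a z - dy b z), sq_nonneg (dx a z + dy b z)]

theorem integrable_mul_of_hasCompactSupport {f g : ℂ → ℝ} (hf : Continuous f)
    (h : HasCompactSupport f) (hg : Continuous g) : Integrable fun z => f z * g z :=
  (hf.mul hg).integrable_of_hasCompactSupport h.mul_right

end Densities

namespace GP
variable {c : ℝ} {a b : ℂ → ℝ}

/-- The first component of the stress identity. -/
theorem stress_fst (h : GP c a b) {ψ : ℂ → ℝ} (hψ : Smooth ψ) (hc : HasCompactSupport ψ) :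
    c * ∫ z, ψ z * jac a b z =
      ∫ z, (dx ψ z * ((dx a z ^ 2 + dx b z ^ 2 - dy a z ^ 2 - dy b z ^ 2) / 2 - eta a b z ^ 2 / 4)
        + dy ψ z * (dx a z * dy a z + dx b z * dy b z)) := by
  have ha := h.sa
  have hb := h.sb
  set A : ℂ → ℝ := fun z =>
    (dx a z ^ 2 + dx b z ^ 2 - dy a z ^ 2 - dy b z ^ 2) / 2 - eta a b z ^ 2 / 4 with hA
  set S : ℂ → ℝ := fun z => dx a z * dy a z + dx b z * dy b z with hS
  have sA : Smooth A := by fun_prop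
  have sS : Smooth S := by fun_prop
  have e1 := integral_dx_eq_zero (f := fun z => ψ z * A z) (by fun_prop) hc.mul_right
  have e2 := integral_dy_eq_zero (f := fun z => ψ z * S z) (by fun_prop) hc.mul_right
  have i1 : Integrable (dx fun z => ψ z * A z) :=
    (Smooth.continuous (by fun_prop)).integrable_of_hasCompactSupport hc.mul_right.dx
  have i2 : Integrable (dy fun z => ψ z * S z) :=
    (Smooth.continuous (by fun_prop)).integrable_of_hasCompactSupport hc.mul_right.dy
  have i3 : Integrable fun z => c * (ψ z * jac a b z) :=
    (integrable_mul_of_hasCompactSupport hψ.continuous hc (by fun_prop)).const_mul c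
  rw [← integral_const_mul]
  have key : ∀ z, dx ψ z * A z + dy ψ z * S z
      = dx (fun z => ψ z * A z) z + dy (fun z => ψ z * S z) z + c * (ψ z * jac a b z) := by
    intro z
    rw [dx_mul (by fun_prop) (by fun_prop), dy_mul (by fun_prop) (by fun_prop)]
    simp only [hA, hS, eta]
    simp (disch := fun_prop) only [dx_sub, dx_add, dx_div_const, dx_pow, dy_add, dy_mul, dx_const]
    have := h.eqa z
    have := h.eqb z
    rw [← dx_dy_comm ha, ← dx_dy_comm hb]
    unfold jac
    push_cast
    linear_combination -ψ z * dx a z * h.eqa z - ψ z * dx b z * h.eqb z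
  have i12 : Integrable fun z => dx (fun z => ψ z * A z) z + dy (fun z => ψ z * S z) z := i1.add i2
  rw [integral_congr_ae (Eventually.of_forall key), integral_add i12 i3, integral_add i1 i2, e1, e2]
  simp

/-- The second component of the stress identity. -/
theorem stress_snd (h : GP c a b) {ψ : ℂ → ℝ} (hψ : Smooth ψ) (hc : HasCompactSupport ψ) :
    ∫ z, (dy ψ z * ((dy a z ^ 2 + dy b z ^ 2 - dx a z ^ 2 - dx b z ^ 2) / 2 - eta a b z ^ 2 / 4)
        + dx ψ z * (dx a z * dy a z + dx b z * dy b z)) = 0 := by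
  have ha := h.sa
  have hb := h.sb
  set A : ℂ → ℝ := fun z =>
    (dy a z ^ 2 + dy b z ^ 2 - dx a z ^ 2 - dx b z ^ 2) / 2 - eta a b z ^ 2 / 4 with hA
  set S : ℂ → ℝ := fun z => dx a z * dy a z + dx b z * dy b z with hS
  have sA : Smooth A := by fun_prop
  have sS : Smooth S := by fun_prop
  have e1 := integral_dy_eq_zero (f := fun z => ψ z * A z) (by fun_prop) hc.mul_right
  have e2 := integral_dx_eq_zero (f := fun z => ψ z * S z) (by fun_prop) hc.mul_right
  have i1 : Integrable (dy fun z => ψ z * A z) :=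
    (Smooth.continuous (by fun_prop)).integrable_of_hasCompactSupport hc.mul_right.dy
  have i2 : Integrable (dx fun z => ψ z * S z) :=
    (Smooth.continuous (by fun_prop)).integrable_of_hasCompactSupport hc.mul_right.dx
  have key : ∀ z, dy ψ z * A z + dx ψ z * S z
      = dy (fun z => ψ z * A z) z + dx (fun z => ψ z * S z) z := by
    intro z
    rw [dy_mul (by fun_prop) (by fun_prop), dx_mul (by fun_prop) (by fun_prop)]
    simp only [hA, hS, eta]
    simp (disch := fun_prop) only [dy_sub, dy_add, dy_div_const, dy_pow, dx_add, dx_mul, dy_const]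
    rw [dx_dy_comm ha, dx_dy_comm hb]
    push_cast
    linear_combination -ψ z * dy a z * h.eqa z - ψ z * dy b z * h.eqb z
  rw [integral_congr_ae (Eventually.of_forall key), integral_add i1 i2, e1, e2]
  simp

/-- The divergence of the current. -/
theorem div_cur (h : GP c a b) (z : ℂ) :
    dx (cur1 a b) z + dy (cur2 a b) z = c / 2 * dy (eta a b) z := by
  have ha := h.sa
  have hb := h.sb
  unfold cur1 cur2 eta
  simp (disch := fun_prop) only [dy_sub, dx_sub, dx_mul, dy_mul, dy_pow, dy_const]
  push_cast
  linear_combination a z * h.eqb z - b z * h.eqa z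

/-- The equation satisfied by `1 - |u|²`. -/
theorem laplacian_eta (h : GP c a b) (z : ℂ) :
    dx (dx (eta a b)) z + dy (dy (eta a b)) z
      = -2 * gsq a b z + 2 * (1 - eta a b z) * eta a b z - 2 * c * cur2 a b z := by
  have ha := h.sa
  have hb := h.sb
  have e1 : dx (eta a b) = fun z => -2 * (a z * dx a z + b z * dx b z) := by
    funext z; unfold eta
    simp (disch := fun_prop) only [dx_sub, dx_pow, dx_const]
    push_cast; ring
  have e2 : dy (eta a b) = fun z => -2 * (a z * dy a z + b z * dy b z) := by
    funext z; unfold eta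
    simp (disch := fun_prop) only [dy_sub, dy_pow, dy_const]
    push_cast; ring
  rw [e1, e2]
  simp (disch := fun_prop) only [dx_mul, dy_mul, dx_add, dy_add, dy_const, dx_const]
  unfold eta gsq cur2
  linear_combination -2 * a z * h.eqa z - 2 * b z * h.eqb z

end GP

section Curl
variable {a b : ℂ → ℝ}
/-- The curl of the current. -/
theorem curl_cur (ha : Smooth a) (hb : Smooth b) (z : ℂ) :
    dx (cur2 a b) z - dy (cur1 a b) z = -2 * jac a b z := by
  unfold cur1 cur2 jac
  simp (disch := fun_prop) only [dy_sub, dx_sub, dx_mul, dy_mul]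
  rw [dx_dy_comm ha, dx_dy_comm hb]
  ring
end Curl

/-- The parametrised ellipse with centre `w` and half axes `α`, `β`. -/
def ell (w : ℂ) (α β θ : ℝ) : ℂ := ⟨w.re + α * Real.cos θ, w.im + β * Real.sin θ⟩

@[simp] theorem ell_re (w : ℂ) (α β θ : ℝ) : (ell w α β θ).re = w.re + α * Real.cos θ := rfl
@[simp] theorem ell_im (w : ℂ) (α β θ : ℝ) : (ell w α β θ).im = w.im + β * Real.sin θ := rfl

/-- The integral of a function over the angle of an ellipse. -/
def ringInt (f : ℂ → ℝ) (w : ℂ) (α β : ℝ) : ℝ := ∫ θ in (-Real.pi)..Real.pi, f (ell w α β θ)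

theorem continuous_mk_complex {X : Type*} [TopologicalSpace X] {f g : X → ℝ} (hf : Continuous f)
    (hg : Continuous g) : Continuous fun x => (⟨f x, g x⟩ : ℂ) := by
  have : (fun x => (⟨f x, g x⟩ : ℂ)) = fun x => (f x : ℂ) + (g x : ℂ) * Complex.I := by
    funext x; apply Complex.ext <;> simp
  rw [this]; fun_prop

@[fun_prop]
theorem Continuous.ell {X : Type*} [TopologicalSpace X] {w : X → ℂ} {α β θ : X → ℝ}
    (hw : Continuous w) (hα : Continuous α) (hβ : Continuous β) (hθ : Continuous θ) :
    Continuous fun x => ell (w x) (α x) (β x) (θ x) := by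
  unfold _root_.ell
  exact continuous_mk_complex (by fun_prop) (by fun_prop)

theorem ringInt_nonneg {f : ℂ → ℝ} (hf : ∀ z, 0 ≤ f z) (w : ℂ) (α β : ℝ) : 0 ≤ ringInt f w α β :=
  intervalIntegral.integral_nonneg (by linarith [Real.pi_pos]) fun _ _ => hf _

theorem continuous_ringInt {f : ℂ → ℝ} (hf : Continuous f) {X : Type*} [TopologicalSpace X]
    {w : X → ℂ} {α β : X → ℝ} (hw : Continuous w) (hα : Continuous α) (hβ : Continuous β) :
    Continuous fun x => ringInt f (w x) (α x) (β x) := by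
  unfold ringInt
  exact intervalIntegral.continuous_parametric_intervalIntegral_of_continuous' (by fun_prop) _ _

theorem map_scale_volume (w : ℂ) {T M : ℝ} (hT : 0 < T) (hM : 0 < M) :
    Measure.map (fun z : ℂ => (⟨w.re + T * z.re, w.im + M * z.im⟩ : ℂ)) volume
      = ENNReal.ofReal (T * M)⁻¹ • volume := by
  set L : ℂ →ₗ[ℝ] ℂ := Matrix.toLin Complex.basisOneI Complex.basisOneI !![T, 0; 0, M] with hL
  have hdet : LinearMap.det L = T * M := by
    rw [hL, LinearMap.det_toLin, Matrix.det_fin_two_of]; ring_nf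
  have happ : ∀ z, L z = ⟨T * z.re, M * z.im⟩ := by
    intro z
    rw [hL, Matrix.toLin_apply]
    apply Complex.ext <;> simp [Matrix.mulVec, dotProduct]
  have hmap : Measure.map L volume = ENNReal.ofReal (T * M)⁻¹ • volume := by
    rw [Measure.map_linearMap_addHaar_eq_smul_addHaar volume (by rw [hdet]; positivity), hdet,
      abs_of_pos (by positivity)]
  have : (fun z : ℂ => (⟨w.re + T * z.re, w.im + M * z.im⟩ : ℂ)) = (fun z => w + z) ∘ L := by
    funext z; rw [Function.comp_apply, happ]; apply Complex.ext <;> simp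
  rw [this, ← Measure.map_map (measurable_const_add w)
    (LinearMap.continuous_of_finiteDimensional L).measurable, hmap, Measure.map_smul,
    map_add_left_eq_self]

theorem lintegral_ell (w : ℂ) {T M : ℝ} (hT : 0 < T) (hM : 0 < M) {f : ℂ → ENNReal}
    (hf : Measurable f) :
    ∫⁻ q in polarCoord.target, ENNReal.ofReal (T * M * q.1) * f (ell w (T * q.1) (M * q.1) q.2)
      = ∫⁻ z, f z := by
  have hc : Continuous (fun z : ℂ => (⟨w.re + T * z.re, w.im + M * z.im⟩ : ℂ)) :=
    continuous_mk_complex (by fun_prop) (by fun_prop)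
  have h1 := Complex.lintegral_comp_polarCoord_symm
    (fun z : ℂ => f (⟨w.re + T * z.re, w.im + M * z.im⟩ : ℂ))
  rw [← lintegral_map hf hc.measurable, map_scale_volume w hT hM, lintegral_smul_measure] at h1
  have h2 : ∫⁻ z, f z = ENNReal.ofReal (T * M) * (ENNReal.ofReal (T * M)⁻¹ • ∫⁻ z, f z) := by
    rw [smul_eq_mul, ← mul_assoc, ← ENNReal.ofReal_mul (by positivity),
      mul_inv_cancel₀ (by positivity)]
    simp
  rw [h2, ← h1, ← lintegral_const_mul']
  · refine setLIntegral_congr_fun polarCoord.open_target.measurableSet fun q _ => ?_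
    simp only [smul_eq_mul]
    rw [ENNReal.ofReal_mul (by positivity), mul_assoc]
    congr 3
    apply Complex.ext <;> simp [Complex.cos_ofReal_re, Complex.sin_ofReal_re] <;> ring_nf
  · exact ENNReal.ofReal_ne_top

theorem integral_ell (w : ℂ) {T M : ℝ} (hT : 0 < T) (hM : 0 < M) {f : ℂ → ℝ}
    (hf : Measurable f) :
    ∫ q in polarCoord.target, T * M * q.1 * f (ell w (T * q.1) (M * q.1) q.2)
      = ∫ z, f z := by
  have hc : Continuous (fun z : ℂ => (⟨w.re + T * z.re, w.im + M * z.im⟩ : ℂ)) :=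
    continuous_mk_complex (by fun_prop) (by fun_prop)
  have h1 := Complex.integral_comp_polarCoord_symm
    (fun z : ℂ => f (⟨w.re + T * z.re, w.im + M * z.im⟩ : ℂ))
  rw [← integral_map hc.measurable.aemeasurable hf.aestronglyMeasurable, map_scale_volume w hT hM,
    integral_smul_measure, ENNReal.toReal_ofReal (by positivity)] at h1
  have h2 : ∫ z, f z = (T * M) * ((T * M)⁻¹ • ∫ z, f z) := by
    rw [smul_eq_mul, ← mul_assoc, mul_inv_cancel₀ (by positivity), one_mul]
  rw [h2, ← h1, ← integral_const_mul]
  refine setIntegral_congr_fun polarCoord.open_target.measurableSet fun q _ => ?_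
  simp only [smul_eq_mul]
  rw [mul_assoc]
  congr 3
  apply Complex.ext <;> simp [Complex.cos_ofReal_re, Complex.sin_ofReal_re] <;> ring_nf

theorem integrableOn_ell (w : ℂ) {T M : ℝ} (hT : 0 < T) (hM : 0 < M) {f : ℂ → ℝ}
    (hf : Measurable f) (hi : Integrable f) :
    IntegrableOn (fun q : ℝ × ℝ => T * M * q.1 * f (ell w (T * q.1) (M * q.1) q.2))
      polarCoord.target := by
  have hc : Continuous (fun q : ℝ × ℝ => ell w (T * q.1) (M * q.1) q.2) := by fun_prop
  refine ⟨Measurable.aestronglyMeasurable (by fun_prop), ?_⟩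
  have := lintegral_ell w hT hM (f := fun z => ‖f z‖ₑ) (by fun_prop)
  have h3 := hi.2
  rw [HasFiniteIntegral] at h3 ⊢
  rw [← this] at h3
  refine lt_of_le_of_lt (le_of_eq ?_) h3
  refine setLIntegral_congr_fun polarCoord.open_target.measurableSet fun q hq => ?_
  have hq1 : 0 < q.1 := hq.1
  simp only [enorm_mul]
  congr 1
  rw [← enorm_mul, ← enorm_mul, Real.enorm_eq_ofReal (by positivity)]

theorem integrableOn_ringInt (w : ℂ) {T M : ℝ} (hT : 0 < T) (hM : 0 < M) {f : ℂ → ℝ}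
    (hf : Measurable f) (hi : Integrable f) :
    IntegrableOn (fun t => T * M * t * ringInt f w (T * t) (M * t)) (Set.Ioi 0) := by
  have h := integrableOn_ell w hT hM hf hi
  rw [IntegrableOn, polarCoord_target, Measure.volume_eq_prod, ← Measure.prod_restrict] at h
  have h2 := h.integral_prod_left
  refine h2.congr (Eventually.of_forall fun t => ?_)
  simp only [ringInt]
  rw [integral_const_mul, intervalIntegral.integral_of_le (by linarith [Real.pi_pos]),
    integral_Ioc_eq_integral_Ioo]

theorem integral_ringInt (w : ℂ) {T M : ℝ} (hT : 0 < T) (hM : 0 < M) {f : ℂ → ℝ}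
    (hf : Measurable f) (hi : Integrable f) :
    ∫ t in Set.Ioi 0, T * M * t * ringInt f w (T * t) (M * t) = ∫ z, f z := by
  have h := integrableOn_ell w hT hM hf hi
  rw [← integral_ell w hT hM hf, polarCoord_target, Measure.volume_eq_prod,
    setIntegral_prod _ (by rwa [polarCoord_target, Measure.volume_eq_prod] at h)]
  refine integral_congr_ae (Eventually.of_forall fun t => ?_)
  simp only [ringInt]
  rw [integral_const_mul, intervalIntegral.integral_of_le (by linarith [Real.pi_pos]),
    integral_Ioc_eq_integral_Ioo]

/-- A `C¹` loop `A + i B` over `[-π, π]` in the punctured plane, with its derivative. -/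
structure PuncturedLoop (A B A' B' : ℝ → ℝ) : Prop where
  derivA : ∀ t, HasDerivAt A (A' t) t
  derivB : ∀ t, HasDerivAt B (B' t) t
  contA : Continuous A'
  contB : Continuous B'
  closedA : A (-Real.pi) = A Real.pi
  closedB : B (-Real.pi) = B Real.pi
  pos : ∀ t, 0 < A t ^ 2 + B t ^ 2

/-- The total variation of the argument along a loop. -/
def argVar (A B A' B' : ℝ → ℝ) : ℝ :=
  ∫ t in (-Real.pi)..Real.pi, (A t * B' t - B t * A' t) / (A t ^ 2 + B t ^ 2)

/-- The rescaled Ginzburg-Landau energy of a loop. -/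
def loopEnergy (l : ℝ) (A B A' B' : ℝ → ℝ) : ℝ :=
  ∫ t in (-Real.pi)..Real.pi,
    ((A' t ^ 2 + B' t ^ 2) / (2 * l) + l / 4 * (1 - A t ^ 2 - B t ^ 2) ^ 2)

namespace PuncturedLoop
variable {A B A' B' : ℝ → ℝ}

theorem continuousA (h : PuncturedLoop A B A' B') : Continuous A :=
  continuous_iff_continuousAt.2 fun t => (h.derivA t).continuousAt

theorem continuousB (h : PuncturedLoop A B A' B') : Continuous B :=
  continuous_iff_continuousAt.2 fun t => (h.derivB t).continuousAt

theorem continuous_argDensity (h : PuncturedLoop A B A' B') :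
    Continuous fun t => (A t * B' t - B t * A' t) / (A t ^ 2 + B t ^ 2) := by
  have := h.continuousA
  have := h.continuousB
  have := h.contA
  have := h.contB
  exact Continuous.div (by fun_prop) (by fun_prop) fun t => (h.pos t).ne'

/-- The variation of the argument along a loop is a multiple of `2π`. -/
theorem exists_argVar_eq (h : PuncturedLoop A B A' B') :
    ∃ n : ℤ, argVar A B A' B' = 2 * Real.pi * n := by
  have cA := h.continuousA
  have cB := h.continuousB
  have cA' := h.contA
  have cB' := h.contB
  set z : ℝ → ℂ := fun t => (A t : ℂ) + (B t : ℂ) * Complex.I with hz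
  set z' : ℝ → ℂ := fun t => (A' t : ℂ) + (B' t : ℂ) * Complex.I with hz'
  have hne : ∀ t, z t ≠ 0 := by
    intro t h0
    have h1 : A t = 0 := by simpa [hz] using congrArg Complex.re h0
    have h2 : B t = 0 := by simpa [hz] using congrArg Complex.im h0
    have := h.pos t
    rw [h1, h2] at this; simp at this
  have dz : ∀ t, HasDerivAt z (z' t) t := fun t =>
    (h.derivA t).ofReal_comp.add ((h.derivB t).ofReal_comp.mul_const Complex.I)
  have cz : Continuous z := by fun_prop
  have cz' : Continuous z' := by fun_prop
  have cq : Continuous fun t => z' t / z t := cz'.div cz hne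
  set Φ : ℝ → ℂ := fun t => ∫ s in (-Real.pi)..t, z' s / z s with hΦ
  have dΦ : ∀ t, HasDerivAt Φ (z' t / z t) t := fun t =>
    intervalIntegral.integral_hasDerivAt_right (cq.intervalIntegrable _ _)
      cq.aestronglyMeasurable.stronglyMeasurableAtFilter cq.continuousAt
  have dG : ∀ t, HasDerivAt (fun t => z t * Complex.exp (-Φ t)) 0 t := by
    intro t
    have := (dz t).mul (dΦ t).neg.cexp
    refine this.congr_deriv ?_
    have e : z t * (z' t / z t) = z' t := mul_div_cancel₀ _ (hne t)
    simp only [Pi.neg_apply]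
    linear_combination -Complex.exp (-Φ t) * e
  have hG := is_const_of_deriv_eq_zero (fun t => (dG t).differentiableAt) (fun t => (dG t).deriv)
    Real.pi (-Real.pi)
  have hclosed : z (-Real.pi) = z Real.pi := by simp only [hz, h.closedA, h.closedB]
  have hΦ0 : Φ (-Real.pi) = 0 := by simp [hΦ]
  simp only [hclosed, hΦ0] at hG
  have h1 : Complex.exp (-Φ Real.pi) = 1 := by
    have := mul_left_cancel₀ (hne Real.pi) hG
    simpa using this
  rw [Complex.exp_neg, inv_eq_one, Complex.exp_eq_one_iff] at h1
  obtain ⟨n, hn⟩ := h1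
  refine ⟨n, ?_⟩
  have him : (Φ Real.pi).im = argVar A B A' B' := by
    have h2 : Φ Real.pi = ∫ s in (-Real.pi)..Real.pi, z' s / z s := rfl
    have h3 := (Complex.imCLM.intervalIntegral_comp_comm
      (cq.intervalIntegrable (μ := volume) (-Real.pi) Real.pi))
    rw [h2]
    simp only [Complex.imCLM_apply] at h3
    rw [← h3, argVar]
    congr 1
    funext t
    have hn : Complex.normSq (z t) = A t ^ 2 + B t ^ 2 := by simp [hz, Complex.normSq_apply]; ring
    rw [Complex.div_im, hn]
    simp [hz, hz']
    ring
  rw [← him, hn]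
  simp; ring

/-- A mean value bound for the modulus of a loop. -/
theorem sq_one_sub_le (h : PuncturedLoop A B A' B') {l : ℝ} (hl : 1 ≤ l) (t : ℝ)
    (ht : t ∈ Set.Icc (-Real.pi) Real.pi) :
    (1 - √(A t ^ 2 + B t ^ 2)) ^ 2 ≤ 5 * ∫ t in (-Real.pi)..Real.pi,
      ((A t * A' t + B t * B' t) ^ 2 / (A t ^ 2 + B t ^ 2) / (2 * l)
        + l / 4 * (1 - A t ^ 2 - B t ^ 2) ^ 2) := by
  have cA := h.continuousA
  have cB := h.continuousB
  have cA' := h.contA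
  have cB' := h.contB
  have hpi := Real.pi_pos
  set ρ : ℝ → ℝ := fun t => √(A t ^ 2 + B t ^ 2) with hρ
  have hρpos : ∀ t, 0 < ρ t := fun t => Real.sqrt_pos.2 (h.pos t)
  have hρsq : ∀ t, ρ t ^ 2 = A t ^ 2 + B t ^ 2 := fun t => Real.sq_sqrt (h.pos t).le
  set ρ' : ℝ → ℝ := fun t => (A t * A' t + B t * B' t) / ρ t with hρ'
  have cρ : Continuous ρ := by fun_prop
  have cρ' : Continuous ρ' := Continuous.div (by fun_prop) cρ fun t => (hρpos t).ne'
  have dρ : ∀ t, HasDerivAt ρ (ρ' t) t := by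
    intro t
    have h2 : HasDerivAt (fun t => A t ^ 2 + B t ^ 2) (2 * A t * A' t + 2 * B t * B' t) t := by
      simpa using! ((h.derivA t).pow 2).add ((h.derivB t).pow 2)
    refine (h2.sqrt (h.pos t).ne').congr_deriv ?_
    simp only [hρ', hρ]
    have : √(A t ^ 2 + B t ^ 2) ≠ 0 := (hρpos t).ne'
    field_simp
  set f : ℝ → ℝ := fun t => (1 - ρ t) ^ 2 with hf
  set f' : ℝ → ℝ := fun t => -2 * (1 - ρ t) * ρ' t with hf'
  have df : ∀ t, HasDerivAt f (f' t) t := by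
    intro t
    refine (((dρ t).const_sub 1).pow 2).congr_deriv ?_
    simp only [hf']; push_cast; ring
  have cf' : Continuous f' := by fun_prop
  have cf : Continuous f := by fun_prop
  set d : ℝ → ℝ := fun t => (A t * A' t + B t * B' t) ^ 2 / (A t ^ 2 + B t ^ 2) / (2 * l)
        + l / 4 * (1 - A t ^ 2 - B t ^ 2) ^ 2 with hd
  have hdeq : ∀ t, d t = ρ' t ^ 2 / (2 * l) + l / 4 * (1 - ρ t ^ 2) ^ 2 := by
    intro t
    simp only [hd, hρ', div_pow, hρsq]; ring
  have cd : Continuous d := by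
    have : d = fun t => ρ' t ^ 2 / (2 * l) + l / 4 * (1 - ρ t ^ 2) ^ 2 := funext hdeq
    rw [this]; fun_prop
  have l0 : 0 < l := by linarith
  have hfη : ∀ t, f t ≤ (1 - ρ t ^ 2) ^ 2 := by
    intro t
    have : (1 - ρ t ^ 2) ^ 2 = (1 - ρ t) ^ 2 * (1 + ρ t) ^ 2 := by ring
    rw [this]
    have h1 : 1 ≤ (1 + ρ t) ^ 2 := by nlinarith [hρpos t]
    simp only [hf]
    nlinarith [sq_nonneg (1 - ρ t)]
  have hfd : ∀ t, f t ≤ 4 * d t := by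
    intro t
    have h1 := hfη t
    rw [hdeq]
    have : 0 ≤ ρ' t ^ 2 / (2 * l) := by positivity
    nlinarith [sq_nonneg (1 - ρ t ^ 2)]
  have hf'd : ∀ t, |f' t| ≤ 3 * d t := by
    intro t
    rw [hdeq]
    have h1 : |f' t| = 2 * (|1 - ρ t| * |ρ' t|) := by
      simp only [hf', abs_mul]; norm_num; ring
    have h2 : |1 - ρ t| ≤ |1 - ρ t ^ 2| := by
      have := hfη t
      exact sq_le_sq.1 this
    rw [h1]
    have h3 : |1 - ρ t| * |ρ' t| ≤ |1 - ρ t ^ 2| * |ρ' t| := by gcongr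
    have h4 : 2 * (|1 - ρ t ^ 2| * |ρ' t|) ≤
        3 * (|ρ' t| ^ 2 / (2 * l) + l / 4 * |1 - ρ t ^ 2| ^ 2) := by
      have e : 3 * (|ρ' t| ^ 2 / (2 * l) + l / 4 * |1 - ρ t ^ 2| ^ 2) - 2 * (|1 - ρ t ^ 2| * |ρ' t|)
        = (|ρ' t| - 2 / 3 * l * |1 - ρ t ^ 2|) ^ 2 * (3 / (2 * l))
          + l / 12 * |1 - ρ t ^ 2| ^ 2 := by
        field_simp; ring
      have : 0 ≤ (|ρ' t| - 2 / 3 * l * |1 - ρ t ^ 2|) ^ 2 * (3 / (2 * l))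
          + l / 12 * |1 - ρ t ^ 2| ^ 2 := by positivity
      linarith
    rw [sq_abs, sq_abs] at h4
    linarith
  have hd0 : ∀ t, 0 ≤ d t := by
    intro t; rw [hdeq]; positivity
  set D := ∫ t in (-Real.pi)..Real.pi, d t with hD
  obtain ⟨s, hs, hmin⟩ := isCompact_Icc.exists_isMinOn (s := Set.Icc (-Real.pi) Real.pi)
    ⟨t, ht⟩ cf.continuousOn
  have hmean : 2 * Real.pi * f s ≤ 4 * D := by
    have h1 : ∫ _ in (-Real.pi)..Real.pi, f s ≤ ∫ t in (-Real.pi)..Real.pi, 4 * d t := by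
      refine intervalIntegral.integral_mono_on (by linarith) (by simp)
        ((cd.const_mul 4).intervalIntegrable _ _) fun x hx => ?_
      exact (hmin hx).trans (hfd x)
    rw [intervalIntegral.integral_const, intervalIntegral.integral_const_mul] at h1
    simp only [smul_eq_mul] at h1
    linarith
  have hvar : f t - f s ≤ 3 * D := by
    have h1 : ∫ x in s..t, f' x = f t - f s :=
      intervalIntegral.integral_eq_sub_of_hasDerivAt (fun x _ => df x) (cf'.intervalIntegrable _ _)
    have h2 : |∫ x in s..t, f' x| ≤ ∫ x in (-Real.pi)..Real.pi, |f' x| := by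
      refine (intervalIntegral.norm_integral_le_integral_norm_uIoc (f := f')).trans ?_
      rw [intervalIntegral.integral_of_le (by linarith)]
      refine setIntegral_mono_set ((cf'.abs).integrableOn_Ioc)
        (Eventually.of_forall fun x => abs_nonneg _) (LE.le.eventuallyLE ?_)
      intro x hx
      rw [Set.mem_uIoc] at hx
      rcases hx with hx | hx <;>
        exact ⟨by linarith [hx.1, hs.1, ht.1], by linarith [hx.2, hs.2, ht.2]⟩
    have h3 : ∫ x in (-Real.pi)..Real.pi, |f' x| ≤ ∫ x in (-Real.pi)..Real.pi, 3 * d x :=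
      intervalIntegral.integral_mono_on (by linarith) (cf'.abs.intervalIntegrable _ _)
        ((cd.const_mul 3).intervalIntegrable _ _) fun x _ => hf'd x
    rw [intervalIntegral.integral_const_mul] at h3
    have := le_abs_self (∫ x in s..t, f' x)
    linarith
  have hD0 : 0 ≤ D := intervalIntegral.integral_nonneg (by linarith) fun x _ => hd0 x
  have hfs : f s ≤ 2 * D := by
    have h3 := Real.pi_gt_three
    by_contra hcon
    push Not at hcon
    nlinarith
  change f t ≤ 5 * D
  linarith

theorem energy_split (h : PuncturedLoop A B A' B') (l : ℝ) :
    loopEnergy l A B A' B' = (∫ t in (-Real.pi)..Real.pi,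
      ((A t * A' t + B t * B' t) ^ 2 / (A t ^ 2 + B t ^ 2) / (2 * l)
        + l / 4 * (1 - A t ^ 2 - B t ^ 2) ^ 2))
      + ∫ t in (-Real.pi)..Real.pi,
        (A t * B' t - B t * A' t) ^ 2 / (A t ^ 2 + B t ^ 2) / (2 * l) := by
  have cA := h.continuousA
  have cB := h.continuousB
  have cA' := h.contA
  have cB' := h.contB
  have hne : ∀ t, A t ^ 2 + B t ^ 2 ≠ 0 := fun t => (h.pos t).ne'
  rw [← intervalIntegral.integral_add, loopEnergy]
  · congr 1
    funext t
    have := hne t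
    have e : (A' t ^ 2 + B' t ^ 2) = (A t * A' t + B t * B' t) ^ 2 / (A t ^ 2 + B t ^ 2)
      + (A t * B' t - B t * A' t) ^ 2 / (A t ^ 2 + B t ^ 2) := by
      field_simp; ring
    rw [e]; ring
  · refine Continuous.intervalIntegrable (Continuous.add (Continuous.div_const
      (Continuous.div (by fun_prop) (by fun_prop) hne) _) (by fun_prop)) _ _
  · exact Continuous.intervalIntegrable (Continuous.div_const
      (Continuous.div (by fun_prop) (by fun_prop) hne) _) _ _

end PuncturedLoop

namespace PuncturedLoop
variable {A B A' B' : ℝ → ℝ}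

theorem phaseEnergy_nonneg {l : ℝ} (hl : 1 ≤ l) :
    0 ≤ ∫ t in (-Real.pi)..Real.pi,
      (A t * B' t - B t * A' t) ^ 2 / (A t ^ 2 + B t ^ 2) / (2 * l) :=
  intervalIntegral.integral_nonneg (by linarith [Real.pi_pos]) fun _ _ => by positivity

theorem loopEnergy_nonneg {l : ℝ} (hl : 1 ≤ l) : 0 ≤ loopEnergy l A B A' B' :=
  intervalIntegral.integral_nonneg (by linarith [Real.pi_pos]) fun _ _ => by positivity

/-- On a loop of small energy the circulation is close to the variation of the argument. -/
theorem abs_circulation_sub_argVar_le (h : PuncturedLoop A B A' B') {l : ℝ} (hl : 1 ≤ l)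
    (hε : loopEnergy l A B A' B' ≤ 1 / 20) :
    |(∫ t in (-Real.pi)..Real.pi, (A t * B' t - B t * A' t)) - argVar A B A' B'|
      ≤ 8 * loopEnergy l A B A' B' := by
  have cA := h.continuousA
  have cB := h.continuousB
  have cA' := h.contA
  have cB' := h.contB
  have hpi := Real.pi_pos
  have hl0 : 0 < l := by linarith
  have cq := h.continuous_argDensity
  rw [argVar, ← intervalIntegral.integral_sub (Continuous.intervalIntegrable (by fun_prop) _ _)
    (cq.intervalIntegrable _ _)]
  refine (intervalIntegral.abs_integral_le_integral_abs (by linarith)).trans ?_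
  rw [loopEnergy, ← intervalIntegral.integral_const_mul]
  refine intervalIntegral.integral_mono_on (by linarith)
    (Continuous.intervalIntegrable (by fun_prop) _ _)
    (Continuous.intervalIntegrable (by fun_prop) _ _) fun t ht => ?_
  have hmod := h.sq_one_sub_le hl t ht
  have hle := phaseEnergy_nonneg (A := A) (B := B) (A' := A') (B' := B') hl
  have hsplit := h.energy_split l
  set ρ := √(A t ^ 2 + B t ^ 2) with hρ
  have hρ0 : 0 < ρ := Real.sqrt_pos.2 (h.pos t)
  have hρsq : ρ ^ 2 = A t ^ 2 + B t ^ 2 := Real.sq_sqrt (h.pos t).le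
  have hhalf : 1 / 2 ≤ ρ := by
    have : (1 - ρ) ^ 2 ≤ 1 / 4 := by linarith
    nlinarith
  have hquarter : 1 / 4 ≤ A t ^ 2 + B t ^ 2 := by rw [← hρsq]; nlinarith
  set P := A t * B' t - B t * A' t with hP
  set r := A t ^ 2 + B t ^ 2 with hr
  have e1 : P - P / r = (r - 1) * (P / r) := by
    have : r ≠ 0 := (h.pos t).ne'
    field_simp
  have hPle : P ^ 2 ≤ r * (A' t ^ 2 + B' t ^ 2) := by
    rw [hP, hr]; nlinarith [sq_nonneg (A t * A' t + B t * B' t)]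
  have e2 : (P / r) ^ 2 ≤ 4 * (A' t ^ 2 + B' t ^ 2) := by
    have hr0 : 0 < r := h.pos t
    rw [div_pow, div_le_iff₀ (by positivity)]
    have hs : 0 ≤ A' t ^ 2 + B' t ^ 2 := by positivity
    nlinarith [mul_nonneg hr0.le hs]
  rw [e1, abs_mul]
  have e3 : (1 - A t ^ 2 - B t ^ 2) ^ 2 = |r - 1| ^ 2 := by rw [sq_abs, hr]; ring
  rw [e3]
  have e4 : |P / r| ^ 2 ≤ 4 * (A' t ^ 2 + B' t ^ 2) := by rwa [sq_abs]
  have e5 : (A' t ^ 2 + B' t ^ 2) / (2 * l) ≥ |P / r| ^ 2 / (8 * l) := by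
    rw [ge_iff_le, div_le_div_iff₀ (by positivity) (by positivity)]
    nlinarith
  have e6 : 8 * (|P / r| ^ 2 / (8 * l) + l / 4 * |r - 1| ^ 2) - |r - 1| * |P / r|
      = (|P / r| - l / 2 * |r - 1|) ^ 2 / l + 7 / 4 * l * |r - 1| ^ 2 := by
    field_simp; ring
  have e7 : 0 ≤ (|P / r| - l / 2 * |r - 1|) ^ 2 / l + 7 / 4 * l * |r - 1| ^ 2 := by positivity
  linarith

/-- Lower bound for the energy of a loop with nonzero winding. -/
theorem le_loopEnergy (h : PuncturedLoop A B A' B') {l D : ℝ} (hl : 1 ≤ l) (hD : 0 ≤ D)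
    (hW : 2 * Real.pi * D ≤ |argVar A B A' B'|) :
    Real.pi * D ^ 2 / (l + 5 * Real.pi * D ^ 2) ≤ loopEnergy l A B A' B' := by
  have cA := h.continuousA
  have cB := h.continuousB
  have cA' := h.contA
  have cB' := h.contB
  have hpi := Real.pi_pos
  have hl0 : 0 < l := by linarith
  have cq := h.continuous_argDensity
  have cρ : Continuous fun t => √(A t ^ 2 + B t ^ 2) := by fun_prop
  obtain ⟨s, hs, hmin⟩ := isCompact_Icc.exists_isMinOn (s := Set.Icc (-Real.pi) Real.pi)
    ⟨0, by constructor <;> linarith⟩ cρ.continuousOn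
  set m := √(A s ^ 2 + B s ^ 2) with hm
  have hm0 : 0 < m := Real.sqrt_pos.2 (h.pos s)
  have hmod := h.sq_one_sub_le hl s hs
  have hsplit := h.energy_split l
  set q : ℝ → ℝ := fun t => (A t * B' t - B t * A' t) / (A t ^ 2 + B t ^ 2) with hq
  have cq : Continuous q := cq
  -- lower bound for the phase part
  have hphase : m ^ 2 / (2 * l) * ∫ t in (-Real.pi)..Real.pi, q t ^ 2 ≤
      ∫ t in (-Real.pi)..Real.pi,
        (A t * B' t - B t * A' t) ^ 2 / (A t ^ 2 + B t ^ 2) / (2 * l) := by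
    rw [← intervalIntegral.integral_const_mul]
    refine intervalIntegral.integral_mono_on (by linarith)
      (Continuous.intervalIntegrable (by fun_prop) _ _)
      (Continuous.intervalIntegrable (Continuous.div_const
        (Continuous.div (by fun_prop) (by fun_prop) fun t => (h.pos t).ne') _) _ _) fun t ht => ?_
    have h1 : m ^ 2 ≤ A t ^ 2 + B t ^ 2 := by
      rw [← Real.sq_sqrt (h.pos t).le]
      exact pow_le_pow_left₀ hm0.le (hmin ht) 2
    have h2 : (A t * B' t - B t * A' t) ^ 2 / (A t ^ 2 + B t ^ 2)
        = (A t ^ 2 + B t ^ 2) * q t ^ 2 := by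
      have := (h.pos t).ne'
      simp only [hq]; field_simp
    rw [h2, div_mul_eq_mul_div]
    gcongr
  have hcs : (argVar A B A' B') ^ 2 ≤ 2 * Real.pi * ∫ t in (-Real.pi)..Real.pi, q t ^ 2 := by
    set W := argVar A B A' B' with hWdef
    have h0 : 0 ≤ ∫ t in (-Real.pi)..Real.pi, (q t - W / (2 * Real.pi)) ^ 2 :=
      intervalIntegral.integral_nonneg (by linarith) fun _ _ => by positivity
    have h1 : ∫ t in (-Real.pi)..Real.pi, (q t - W / (2 * Real.pi)) ^ 2
        = (∫ t in (-Real.pi)..Real.pi, q t ^ 2) - W / Real.pi * W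
          + (W / (2 * Real.pi)) ^ 2 * (2 * Real.pi) := by
      have e : ∀ t, (q t - W / (2 * Real.pi)) ^ 2
        = (q t ^ 2 - W / Real.pi * q t) + (W / (2 * Real.pi)) ^ 2 := by intro t; field_simp; ring
      simp_rw [e]
      rw [intervalIntegral.integral_add (Continuous.intervalIntegrable (by fun_prop) _ _) (by simp),
        intervalIntegral.integral_sub (Continuous.intervalIntegrable (by fun_prop) _ _)
          (Continuous.intervalIntegrable (by fun_prop) _ _),
        intervalIntegral.integral_const_mul, intervalIntegral.integral_const]
      simp only [smul_eq_mul]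
      rw [hWdef, argVar]; ring
    rw [h1] at h0
    have h2 : W / Real.pi * W - (W / (2 * Real.pi)) ^ 2 * (2 * Real.pi) =
        W ^ 2 / (2 * Real.pi) := by
      field_simp; ring
    have h3 : W ^ 2 / (2 * Real.pi) ≤ ∫ t in (-Real.pi)..Real.pi, q t ^ 2 := by linarith
    rwa [div_le_iff₀' (by positivity)] at h3
  have hW2 : 2 * Real.pi * D ^ 2 ≤ ∫ t in (-Real.pi)..Real.pi, q t ^ 2 := by
    have h1 : (2 * Real.pi * D) ^ 2 ≤ (argVar A B A' B') ^ 2 := by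
      rw [← sq_abs (argVar A B A' B')]
      exact pow_le_pow_left₀ (by positivity) hW 2
    have h2 : 2 * Real.pi * (2 * Real.pi * D ^ 2)
        ≤ 2 * Real.pi * ∫ t in (-Real.pi)..Real.pi, q t ^ 2 := by
      calc _ = (2 * Real.pi * D) ^ 2 := by ring
        _ ≤ _ := h1.trans hcs
    exact le_of_mul_le_mul_left h2 (by positivity)
  have hph : m ^ 2 * (Real.pi * D ^ 2 / l) ≤ ∫ t in (-Real.pi)..Real.pi,
        (A t * B' t - B t * A' t) ^ 2 / (A t ^ 2 + B t ^ 2) / (2 * l) := by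
    refine le_trans ?_ hphase
    calc m ^ 2 * (Real.pi * D ^ 2 / l) = m ^ 2 / (2 * l) * (2 * Real.pi * D ^ 2) := by
          field_simp
      _ ≤ _ := by gcongr
  have hfin : m ^ 2 * (Real.pi * D ^ 2 / l) + (1 - m) ^ 2 / 5 ≤ loopEnergy l A B A' B' := by
    linarith
  refine le_trans ?_ hfin
  set K := Real.pi * D ^ 2 with hK
  have hK0 : 0 ≤ K := by positivity
  have hK5 : l + 5 * Real.pi * D ^ 2 = l + 5 * K := by rw [hK]; ring
  rw [hK5, div_le_iff₀ (by positivity)]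
  have e : (m ^ 2 * (K / l) + (1 - m) ^ 2 / 5) * (l + 5 * K) - K
      = (5 * K * m - l * (1 - m)) ^ 2 / (5 * l) := by
    field_simp; ring
  have : 0 ≤ (5 * K * m - l * (1 - m)) ^ 2 / (5 * l) := by positivity
  linarith

/-- An unconditional comparison between circulation and variation of the argument. -/
theorem abs_circulation_sub_argVar_le_mul (h : PuncturedLoop A B A' B') {l K : ℝ} (hl : 1 ≤ l)
    (hK : |∫ t in (-Real.pi)..Real.pi, (A t * B' t - B t * A' t)| + |argVar A B A' B'| ≤ K) :
    |(∫ t in (-Real.pi)..Real.pi, (A t * B' t - B t * A' t)) - argVar A B A' B'|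
      ≤ (8 + 20 * K) * loopEnergy l A B A' B' := by
  have h0 := loopEnergy_nonneg (A := A) (B := B) (A' := A') (B' := B') hl
  have hK0 : 0 ≤ K := le_trans (by positivity) hK
  by_cases hε : loopEnergy l A B A' B' ≤ 1 / 20
  · have := h.abs_circulation_sub_argVar_le hl hε
    nlinarith
  · push Not at hε
    have := abs_sub (∫ t in (-Real.pi)..Real.pi, (A t * B' t - B t * A' t)) (argVar A B A' B')
    nlinarith
end PuncturedLoop

/-- The tangential derivative of `f` along an ellipse. -/
def tang (f : ℂ → ℝ) (w : ℂ) (α β θ : ℝ) : ℝ :=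
  -α * Real.sin θ * dx f (ell w α β θ) + β * Real.cos θ * dy f (ell w α β θ)

/-- The circulation of the current of `a + i b` along an ellipse. -/
def circ (a b : ℂ → ℝ) (w : ℂ) (α β : ℝ) : ℝ :=
  ∫ θ in (-Real.pi)..Real.pi, (-α * Real.sin θ * cur1 a b (ell w α β θ)
    + β * Real.cos θ * cur2 a b (ell w α β θ))

/-- The variation of the argument of `a + i b` along an ellipse. -/
def wnd (a b : ℂ → ℝ) (w : ℂ) (α β : ℝ) : ℝ :=
  argVar (fun θ => a (ell w α β θ)) (fun θ => b (ell w α β θ)) (tang a w α β) (tang b w α β)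

section Ellipse
variable {a b f : ℂ → ℝ} {w : ℂ} {α β : ℝ}

theorem hasDerivAt_comp_plane (hf : Smooth f) {x y : ℝ → ℝ} {x' y' t : ℝ} (hx : HasDerivAt x x' t)
    (hy : HasDerivAt y y' t) :
    HasDerivAt (fun s => f ⟨x s, y s⟩) (x' * dx f ⟨x t, y t⟩ + y' * dy f ⟨x t, y t⟩) t := by
  have h1 : HasDerivAt (fun s => (⟨x s, y s⟩ : ℂ)) ((x' : ℂ) + (y' : ℂ) * Complex.I) t := by
    have e : (fun s => (⟨x s, y s⟩ : ℂ)) = fun s => (x s : ℂ) + (y s : ℂ) * Complex.I := by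
      funext s; apply Complex.ext <;> simp
    rw [e]
    exact hx.ofReal_comp.add (hy.ofReal_comp.mul_const _)
  have h2 := (hf.differentiable ⟨x t, y t⟩).hasFDerivAt.comp_hasDerivAt t h1
  refine h2.congr_deriv ?_
  rw [fderiv_apply_eq]; simp

theorem hasDerivAt_ell_angle (hf : Smooth f) (w : ℂ) (α β θ : ℝ) :
    HasDerivAt (fun θ => f (ell w α β θ)) (tang f w α β θ) θ := by
  have := hasDerivAt_comp_plane hf (((Real.hasDerivAt_cos θ).const_mul α).const_add w.re)
    (((Real.hasDerivAt_sin θ).const_mul β).const_add w.im)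
  refine this.congr_deriv ?_
  unfold tang ell; ring

theorem ell_neg_pi (w : ℂ) (α β : ℝ) : ell w α β (-Real.pi) = ell w α β Real.pi := by
  unfold ell; simp

theorem continuous_tang (hf : Smooth f) {X : Type*} [TopologicalSpace X]
    {w : X → ℂ} {α β θ : X → ℝ} (hw : Continuous w) (hα : Continuous α) (hβ : Continuous β)
    (hθ : Continuous θ) : Continuous fun x => tang f (w x) (α x) (β x) (θ x) := by
  have h1 := hf.dx.continuous
  have h2 := hf.dy.continuous
  unfold tang; fun_prop

theorem puncturedLoop_ell (ha : Smooth a) (hb : Smooth b)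
    (h : ∀ θ, 0 < a (ell w α β θ) ^ 2 + b (ell w α β θ) ^ 2) :
    PuncturedLoop (fun θ => a (ell w α β θ)) (fun θ => b (ell w α β θ))
      (tang a w α β) (tang b w α β) where
  derivA t := hasDerivAt_ell_angle ha w α β t
  derivB t := hasDerivAt_ell_angle hb w α β t
  contA := continuous_tang ha continuous_const continuous_const continuous_const continuous_id
  contB := continuous_tang hb continuous_const continuous_const continuous_const continuous_id
  closedA := by rw [ell_neg_pi]
  closedB := by rw [ell_neg_pi]
  pos := h

theorem circ_eq (a b : ℂ → ℝ) (w : ℂ) (α β : ℝ) :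
    circ a b w α β = ∫ θ in (-Real.pi)..Real.pi,
      (a (ell w α β θ) * tang b w α β θ - b (ell w α β θ) * tang a w α β θ) := by
  unfold circ cur1 cur2 tang
  congr 1; funext θ; ring

theorem tang_sq_le {l : ℝ} (hα : |α| ≤ l) (hβ : |β| ≤ l) (θ : ℝ) :
    tang a w α β θ ^ 2 + tang b w α β θ ^ 2 ≤ l ^ 2 * gsq a b (ell w α β θ) := by
  unfold tang gsq
  set z := ell w α β θ
  have hα2 : α ^ 2 ≤ l ^ 2 := by rw [← sq_abs α]; exact pow_le_pow_left₀ (abs_nonneg _) hα 2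
  have hβ2 : β ^ 2 ≤ l ^ 2 := by rw [← sq_abs β]; exact pow_le_pow_left₀ (abs_nonneg _) hβ 2
  have hsc := Real.sin_sq_add_cos_sq θ
  have hs : α ^ 2 * Real.sin θ ^ 2 + β ^ 2 * Real.cos θ ^ 2 ≤ l ^ 2 := by
    nlinarith [mul_le_mul_of_nonneg_right hα2 (sq_nonneg (Real.sin θ)),
      mul_le_mul_of_nonneg_right hβ2 (sq_nonneg (Real.cos θ))]
  have key : ∀ p q : ℝ, (-α * Real.sin θ * p + β * Real.cos θ * q) ^ 2
      ≤ l ^ 2 * (p ^ 2 + q ^ 2) := by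
    intro p q
    have h1 : (-α * Real.sin θ * p + β * Real.cos θ * q) ^ 2
      ≤ (α ^ 2 * Real.sin θ ^ 2 + β ^ 2 * Real.cos θ ^ 2) * (p ^ 2 + q ^ 2) := by
      nlinarith [sq_nonneg (α * Real.sin θ * q + β * Real.cos θ * p)]
    exact h1.trans (by gcongr)
  have h1 := key (dx a z) (dy a z)
  have h2 := key (dx b z) (dy b z)
  linarith

theorem loopEnergy_ell_le (ha : Smooth a) (hb : Smooth b) {l : ℝ} (hl : 1 ≤ l)
    (hα : |α| ≤ l) (hβ : |β| ≤ l) :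
    loopEnergy l (fun θ => a (ell w α β θ)) (fun θ => b (ell w α β θ))
      (tang a w α β) (tang b w α β) ≤ l * ringInt (en a b) w α β := by
  unfold loopEnergy ringInt
  have c1 : Continuous (tang a w α β) :=
    continuous_tang ha continuous_const continuous_const continuous_const continuous_id
  have c2 : Continuous (tang b w α β) :=
    continuous_tang hb continuous_const continuous_const continuous_const continuous_id
  have c3 : Continuous (en a b) := (ha.en hb).continuous
  have c4 := ha.continuous
  have c5 := hb.continuous
  rw [← intervalIntegral.integral_const_mul]
  refine intervalIntegral.integral_mono_on (by linarith [Real.pi_pos])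
    (Continuous.intervalIntegrable (by fun_prop) _ _)
    (Continuous.intervalIntegrable (by fun_prop) _ _) fun θ _ => ?_
  have h1 := tang_sq_le (a := a) (b := b) (w := w) hα hβ θ
  have hl0 : 0 < l := by linarith
  have h2 : (tang a w α β θ ^ 2 + tang b w α β θ ^ 2) / (2 * l)
      ≤ l * (gsq a b (ell w α β θ) / 2) := by
    rw [div_le_iff₀ (by positivity)]; nlinarith
  unfold en eta
  linarith

/-- The variation of the argument does not change along a family of ellipses avoiding zeros. -/
theorem wnd_eq_wnd (ha : Smooth a) (hb : Smooth b) {X : Type*} [TopologicalSpace X]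
    [PreconnectedSpace X] {w : X → ℂ} {α β : X → ℝ} (hw : Continuous w) (hα : Continuous α)
    (hβ : Continuous β)
    (h : ∀ x θ, 0 < a (ell (w x) (α x) (β x) θ) ^ 2 + b (ell (w x) (α x) (β x) θ) ^ 2) (x y : X) :
    wnd a b (w x) (α x) (β x) = wnd a b (w y) (α y) (β y) := by
  choose n hn using fun x => (puncturedLoop_ell ha hb (h x)).exists_argVar_eq
  have hc : Continuous fun x => wnd a b (w x) (α x) (β x) := by
    unfold wnd argVar
    refine intervalIntegral.continuous_parametric_intervalIntegral_of_continuous' ?_ _ _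
    have c1 : Continuous fun p : X × ℝ => tang a (w p.1) (α p.1) (β p.1) p.2 :=
      continuous_tang ha (by fun_prop) (by fun_prop) (by fun_prop) (by fun_prop)
    have c2 : Continuous fun p : X × ℝ => tang b (w p.1) (α p.1) (β p.1) p.2 :=
      continuous_tang hb (by fun_prop) (by fun_prop) (by fun_prop) (by fun_prop)
    have c4 := ha.continuous
    have c5 := hb.continuous
    exact Continuous.div (by fun_prop) (by fun_prop) fun p => (h p.1 p.2).ne'
  have hn' : ∀ x, (n x : ℝ) = wnd a b (w x) (α x) (β x) / (2 * Real.pi) := by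
    intro x
    rw [wnd, hn x]; field_simp
  have hcn : Continuous fun x => (n x : ℝ) := by
    simp_rw [hn']; fun_prop
  have hcn' : Continuous n := Int.isClosedEmbedding_coe_real.isInducing.continuous_iff.2 hcn
  have := PreconnectedSpace.constant ‹_› hcn' (x := x) (y := y)
  unfold wnd
  rw [hn x, hn y, this]

theorem wnd_zero (a b : ℂ → ℝ) (w : ℂ) : wnd a b w 0 0 = 0 := by
  simp [wnd, argVar, tang]

/-- The Green formula on ellipses. -/
theorem green_ell {P R : ℂ → ℝ} (hP : Smooth P) (hR : Smooth R) (w : ℂ) (T M t : ℝ) :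
    ∫ θ in (-Real.pi)..Real.pi, (-(T * t) * Real.sin θ * P (ell w (T * t) (M * t) θ)
      + M * t * Real.cos θ * R (ell w (T * t) (M * t) θ))
    = ∫ s in (0 : ℝ)..t, T * M * s *
        ringInt (fun z => dx R z - dy P z) w (T * s) (M * s) := by
  set N : ℝ → ℝ → ℝ := fun s θ => -(T * s) * Real.sin θ * P (ell w (T * s) (M * s) θ)
      + M * s * Real.cos θ * R (ell w (T * s) (M * s) θ) with hN
  set dN : ℝ → ℝ → ℝ := fun s θ =>
    -T * Real.sin θ * P (ell w (T * s) (M * s) θ) + M * Real.cos θ * R (ell w (T * s) (M * s) θ)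
    + -(T * s) * Real.sin θ * (T * Real.cos θ * dx P (ell w (T * s) (M * s) θ)
        + M * Real.sin θ * dy P (ell w (T * s) (M * s) θ))
    + M * s * Real.cos θ * (T * Real.cos θ * dx R (ell w (T * s) (M * s) θ)
        + M * Real.sin θ * dy R (ell w (T * s) (M * s) θ)) with hdN
  have hrad : ∀ {f : ℂ → ℝ}, Smooth f → ∀ s θ, HasDerivAt (fun s => f (ell w (T * s) (M * s) θ))
      (T * Real.cos θ * dx f (ell w (T * s) (M * s) θ)
        + M * Real.sin θ * dy f (ell w (T * s) (M * s) θ)) s := by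
    intro f hf s θ
    have e1 : HasDerivAt (fun s : ℝ => w.re + T * s * Real.cos θ) (T * Real.cos θ) s := by
      simpa using (((hasDerivAt_id s).const_mul T).mul_const (Real.cos θ)).const_add w.re
    have e2 : HasDerivAt (fun s : ℝ => w.im + M * s * Real.sin θ) (M * Real.sin θ) s := by
      simpa using (((hasDerivAt_id s).const_mul M).mul_const (Real.sin θ)).const_add w.im
    exact hasDerivAt_comp_plane hf e1 e2
  have hdN' : ∀ s θ, HasDerivAt (fun s => N s θ) (dN s θ) s := by
    intro s θ
    have e1 : HasDerivAt (fun s : ℝ => -(T * s) * Real.sin θ) (-T * Real.sin θ) s := by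
      simpa using (((hasDerivAt_id s).const_mul T).neg).mul_const (Real.sin θ)
    have e2 : HasDerivAt (fun s : ℝ => M * s * Real.cos θ) (M * Real.cos θ) s := by
      simpa using ((hasDerivAt_id s).const_mul M).mul_const (Real.cos θ)
    refine ((e1.mul (hrad hP s θ)).add (e2.mul (hrad hR s θ))).congr_deriv ?_
    simp only [hdN]; ring
  have cP := hP.continuous
  have cR := hR.continuous
  have cP1 := hP.dx.continuous
  have cP2 := hP.dy.continuous
  have cR1 := hR.dx.continuous
  have cR2 := hR.dy.continuous
  have cdN : Continuous (Function.uncurry dN) := by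
    simp only [hdN, Function.uncurry_def]; fun_prop
  have hN0 : ∀ θ, N t θ = ∫ s in (0 : ℝ)..t, dN s θ := by
    intro θ
    rw [intervalIntegral.integral_eq_sub_of_hasDerivAt (fun s _ => hdN' s θ)
      ((cdN.comp (by fun_prop : Continuous fun s : ℝ => (s, θ))).intervalIntegrable _ _)]
    simp [hN]
  have hswap : ∫ θ in (-Real.pi)..Real.pi, N t θ
      = ∫ s in (0 : ℝ)..t, ∫ θ in (-Real.pi)..Real.pi, dN s θ := by
    simp_rw [hN0]
    refine intervalIntegral_intervalIntegral_swap (IntegrableOn.mono_set ?_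
      (Set.prod_mono Set.uIoc_subset_uIcc Set.uIoc_subset_uIcc))
    exact (cdN.comp continuous_swap).continuousOn.integrableOn_compact
      (isCompact_uIcc.prod isCompact_uIcc)
  rw [hswap]
  congr 1
  funext s
  unfold ringInt
  rw [← intervalIntegral.integral_const_mul]
  set G : ℝ → ℝ := fun θ => T * Real.cos θ * P (ell w (T * s) (M * s) θ)
    + M * Real.sin θ * R (ell w (T * s) (M * s) θ) with hG
  set G' : ℝ → ℝ := fun θ => -(T * Real.sin θ) * P (ell w (T * s) (M * s) θ)
    + T * Real.cos θ * tang P w (T * s) (M * s) θ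
    + (M * Real.cos θ * R (ell w (T * s) (M * s) θ)
    + M * Real.sin θ * tang R w (T * s) (M * s) θ) with hG'
  have dG : ∀ θ, HasDerivAt G (G' θ) θ := by
    intro θ
    refine ((((Real.hasDerivAt_cos θ).const_mul T).mul (hasDerivAt_ell_angle hP w _ _ θ)).add
      (((Real.hasDerivAt_sin θ).const_mul M).mul (hasDerivAt_ell_angle hR w _ _ θ))).congr_deriv ?_
    simp only [hG']; ring
  have c1 : Continuous (tang P w (T * s) (M * s)) :=
    continuous_tang hP continuous_const continuous_const continuous_const continuous_id
  have c2 : Continuous (tang R w (T * s) (M * s)) :=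
    continuous_tang hR continuous_const continuous_const continuous_const continuous_id
  have cG' : Continuous G' := by fun_prop
  have hG0 : ∫ θ in (-Real.pi)..Real.pi, G' θ = 0 := by
    rw [intervalIntegral.integral_eq_sub_of_hasDerivAt (fun θ _ => dG θ)
      (cG'.intervalIntegrable _ _)]
    simp only [hG]; rw [ell_neg_pi]; simp
  have e : ∀ θ, dN s θ = G' θ + T * M * s * (dx R (ell w (T * s) (M * s) θ)
      - dy P (ell w (T * s) (M * s) θ)) := by
    intro θ
    simp only [hdN, hG', tang]
    linear_combination (T * M * s * (dx R (ell w (T * s) (M * s) θ)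
      - dy P (ell w (T * s) (M * s) θ))) * (Real.sin_sq_add_cos_sq θ)
  simp_rw [e]
  rw [intervalIntegral.integral_add (cG'.intervalIntegrable _ _)
    (Continuous.intervalIntegrable (by fun_prop) _ _), hG0, zero_add]

end Ellipse

/-- Smooth maps `a + i b` whose Ginzburg-Landau energy is at most `E`. -/
structure FiniteEnergy (a b : ℂ → ℝ) (E : ℝ) : Prop where
  sa : Smooth a
  sb : Smooth b
  int : Integrable (en a b)
  le : ∫ z, en a b z ≤ E

theorem intervalIntegral_ringInt_le {f : ℂ → ℝ} (hf : Measurable f) (hi : Integrable f)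
    (h0 : ∀ z, 0 ≤ f z) (w : ℂ) {T M : ℝ} (hT : 0 < T) (hM : 0 < M) {s t : ℝ} (hs : 0 ≤ s)
    (hst : s ≤ t) :
    ∫ r in s..t, T * M * r * ringInt f w (T * r) (M * r) ≤ ∫ z, f z := by
  rw [← integral_ringInt w hT hM hf hi, intervalIntegral.integral_of_le hst]
  refine setIntegral_mono_set (integrableOn_ringInt w hT hM hf hi) ?_
    (LE.le.eventuallyLE fun r hr => lt_of_le_of_lt hs hr.1)
  refine (ae_restrict_iff' measurableSet_Ioi).2 (Eventually.of_forall fun r hr => ?_)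
  have : (0 : ℝ) < r := hr
  have := ringInt_nonneg h0 w (T * r) (M * r)
  simp only [Pi.zero_apply]
  positivity

namespace FiniteEnergy
variable {a b : ℂ → ℝ} {E : ℝ}

theorem nonneg (h : FiniteEnergy a b E) : 0 ≤ E :=
  (integral_nonneg (en_nonneg a b)).trans h.le

theorem integrable_gsq (h : FiniteEnergy a b E) : Integrable (gsq a b) := by
  refine (h.int.const_mul 2).mono' (h.sa.gsq h.sb).continuous.aestronglyMeasurable
    (Eventually.of_forall fun z => ?_)
  rw [Real.norm_of_nonneg (gsq_nonneg a b z)]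
  exact gsq_le_en a b z

theorem integral_gsq_le (h : FiniteEnergy a b E) : ∫ z, gsq a b z ≤ 2 * E := by
  calc ∫ z, gsq a b z ≤ ∫ z, 2 * en a b z :=
        integral_mono h.integrable_gsq (h.int.const_mul 2) fun z => gsq_le_en a b z
    _ ≤ 2 * E := by rw [integral_const_mul]; linarith [h.le]

theorem integral_ringInt_en_le (h : FiniteEnergy a b E) (w : ℂ) {T M : ℝ} (hT : 0 < T)
    (hM : 0 < M) {s t : ℝ} (hs : 0 ≤ s) (hst : s ≤ t) :
    ∫ r in s..t, T * M * r * ringInt (en a b) w (T * r) (M * r) ≤ E :=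
  (intervalIntegral_ringInt_le (h.sa.en h.sb).continuous.measurable h.int (en_nonneg a b) w hT hM
    hs hst).trans h.le

/-- The circulation is bounded by the energy. -/
theorem abs_circ_le (h : FiniteEnergy a b E) (w : ℂ) {T M t : ℝ} (hT : 0 < T) (hM : 0 < M)
    (ht : 0 ≤ t) : |circ a b w (T * t) (M * t)| ≤ 2 * E := by
  have ha := h.sa
  have hb := h.sb
  have hpi := Real.pi_pos
  have hg := green_ell (ha.cur1 hb) (ha.cur2 hb) w T M t
  rw [circ, hg]
  have c1 : Continuous fun z => dx (cur2 a b) z - dy (cur1 a b) z := by fun_prop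
  have c2 : Continuous (gsq a b) := by fun_prop
  have hbound : ∀ s, 0 ≤ s → |T * M * s *
      ringInt (fun z => dx (cur2 a b) z - dy (cur1 a b) z) w (T * s) (M * s)|
      ≤ T * M * s * ringInt (gsq a b) w (T * s) (M * s) := by
    intro s hs
    rw [abs_mul, abs_of_nonneg (by positivity)]
    gcongr
    unfold ringInt
    refine (intervalIntegral.abs_integral_le_integral_abs (by linarith)).trans ?_
    refine intervalIntegral.integral_mono_on (by linarith)
      (Continuous.intervalIntegrable (by fun_prop) _ _)
      (Continuous.intervalIntegrable (by fun_prop) _ _) fun θ _ => ?_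
    change |dx (cur2 a b) _ - dy (cur1 a b) _| ≤ _
    rw [curl_cur ha hb, abs_mul]
    have := abs_jac_le a b (ell w (T * s) (M * s) θ)
    norm_num
    linarith
  have cr1 : Continuous fun s => T * M * s *
      ringInt (fun z => dx (cur2 a b) z - dy (cur1 a b) z) w (T * s) (M * s) := by
    have := continuous_ringInt c1 (X := ℝ) (w := fun _ => w) (α := fun s => T * s)
      (β := fun s => M * s) (by fun_prop) (by fun_prop) (by fun_prop)
    fun_prop
  have cr2 : Continuous fun s => T * M * s * ringInt (gsq a b) w (T * s) (M * s) := by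
    have := continuous_ringInt c2 (X := ℝ) (w := fun _ => w) (α := fun s => T * s)
      (β := fun s => M * s) (by fun_prop) (by fun_prop) (by fun_prop)
    fun_prop
  refine (intervalIntegral.abs_integral_le_integral_abs ht).trans ?_
  refine (intervalIntegral.integral_mono_on ht (cr1.abs.intervalIntegrable _ _)
    (cr2.intervalIntegrable _ _) fun s hs => hbound s hs.1).trans ?_
  exact (intervalIntegral_ringInt_le c2.measurable h.integrable_gsq (gsq_nonneg a b) w hT hM le_rfl
    ht).trans h.integral_gsq_le

theorem continuous_circ (h : FiniteEnergy a b E) (w : ℂ) (T M : ℝ) :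
    Continuous fun t => circ a b w (T * t) (M * t) := by
  have c1 : Continuous (cur1 a b) := (h.sa.cur1 h.sb).continuous
  have c2 : Continuous (cur2 a b) := (h.sa.cur2 h.sb).continuous
  unfold circ
  exact intervalIntegral.continuous_parametric_intervalIntegral_of_continuous' (by fun_prop) _ _

/-- On a family of ellipses with constant winding, the weighted circulation is controlled. -/
theorem abs_slice_le (h : FiniteEnergy a b E) (w : ℂ) {T M s t d K : ℝ} (hT : 1 ≤ T) (hM : T ≤ M)
    (hs : 0 ≤ s) (hst : s ≤ t) (ht : t ≤ 1) (hK : 2 * E + |d| ≤ K)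
    (hne : ∀ r ∈ Set.Ioo s t, ∀ θ,
      0 < a (ell w (T * r) (M * r) θ) ^ 2 + b (ell w (T * r) (M * r) θ) ^ 2)
    (hd : ∀ r ∈ Set.Ioo s t, wnd a b w (T * r) (M * r) = d)
    {κ : ℝ → ℝ} (hκ : Continuous κ) (hκ0 : ∀ r, 0 ≤ κ r) (hκ1 : ∀ r, κ r ≤ 1) :
    |T * (∫ r in s..t, κ r * (r * circ a b w (T * r) (M * r))) - d * (T * ∫ r in s..t, κ r * r)|
      ≤ (8 + 20 * K) * E + K := by
  have hE := h.nonneg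
  have hK0 : 0 ≤ K := le_trans (by positivity) hK
  have hT0 : 0 < T := by linarith
  have hM0 : 0 < M := by linarith
  have cQ := h.continuous_circ w T M
  have e : T * (∫ r in s..t, κ r * (r * circ a b w (T * r) (M * r)))
      - d * (T * ∫ r in s..t, κ r * r)
      = ∫ r in s..t, T * (κ r * (r * (circ a b w (T * r) (M * r) - d))) := by
    rw [intervalIntegral.integral_const_mul]
    have : ∀ r, κ r * (r * (circ a b w (T * r) (M * r) - d))
      = κ r * (r * circ a b w (T * r) (M * r)) - d * (κ r * r) := by intro r; ring
    simp_rw [this]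
    rw [intervalIntegral.integral_sub (Continuous.intervalIntegrable (by fun_prop) _ _)
      (Continuous.intervalIntegrable (by fun_prop) _ _), intervalIntegral.integral_const_mul]
    ring
  rw [e]
  set F : ℝ → ℝ := fun r => T * M * r * ringInt (en a b) w (T * r) (M * r) with hF
  have cF : Continuous F := by
    have := continuous_ringInt (h.sa.en h.sb).continuous (X := ℝ) (w := fun _ => w)
      (α := fun s => T * s) (β := fun s => M * s) (by fun_prop) (by fun_prop) (by fun_prop)
    fun_prop
  have hpt : ∀ r ∈ Set.Ioo s t, ‖T * (κ r * (r * (circ a b w (T * r) (M * r) - d)))‖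
      ≤ (8 + 20 * K) * F r + K := by
    intro r hr
    have hr0 : 0 < r := lt_of_le_of_lt hs hr.1
    have hr1 : r ≤ 1 := hr.2.le.trans ht
    have hR := ringInt_nonneg (en_nonneg a b) w (T * r) (M * r)
    have hQ := h.abs_circ_le w hT0 hM0 hr0.le
    have hFr : 0 ≤ F r := by simp only [hF]; positivity
    rw [Real.norm_eq_abs, abs_mul, abs_mul, abs_mul, abs_of_pos hT0, abs_of_nonneg (hκ0 r),
      abs_of_pos hr0]
    have hX : T * (κ r * (r * |circ a b w (T * r) (M * r) - d|))
        ≤ T * r * |circ a b w (T * r) (M * r) - d| := by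
      have : κ r * (r * |circ a b w (T * r) (M * r) - d|)
        ≤ 1 * (r * |circ a b w (T * r) (M * r) - d|) :=
        mul_le_mul_of_nonneg_right (hκ1 r) (by positivity)
      nlinarith
    refine hX.trans ?_
    by_cases hl : 1 ≤ M * r
    · have hloop := puncturedLoop_ell h.sa h.sb (hne r hr)
      have h1 := hloop.abs_circulation_sub_argVar_le_mul hl (K := K) (by
        rw [← circ_eq]
        change |circ a b w (T * r) (M * r)| + |wnd a b w (T * r) (M * r)| ≤ K
        rw [hd r hr]; linarith)
      rw [← circ_eq] at h1
      change |circ a b w (T * r) (M * r) - wnd a b w (T * r) (M * r)| ≤ _ at h1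
      rw [hd r hr] at h1
      have h2 := loopEnergy_ell_le (w := w) h.sa h.sb hl (α := T * r) (β := M * r)
        (by rw [abs_of_pos (by positivity)]; gcongr) (by rw [abs_of_pos (by positivity)])
      have h3 : |circ a b w (T * r) (M * r) - d|
          ≤ (8 + 20 * K) * (M * r * ringInt (en a b) w (T * r) (M * r)) :=
        h1.trans (by gcongr)
      calc T * r * |circ a b w (T * r) (M * r) - d|
          ≤ T * r * ((8 + 20 * K) * (M * r * ringInt (en a b) w (T * r) (M * r))) := by gcongr
        _ = ((8 + 20 * K) * F r) * r := by simp only [hF]; ring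
        _ ≤ ((8 + 20 * K) * F r) * 1 := by gcongr
        _ ≤ (8 + 20 * K) * F r + K := by linarith
    · push Not at hl
      have h1 : |circ a b w (T * r) (M * r) - d| ≤ K := (abs_sub _ _).trans (by linarith)
      have h2 : T * r ≤ 1 := by nlinarith
      calc T * r * |circ a b w (T * r) (M * r) - d| ≤ 1 * K := by gcongr
        _ ≤ (8 + 20 * K) * F r + K := by
          have : 0 ≤ (8 + 20 * K) * F r := by positivity
          linarith
  have hbd := intervalIntegral.norm_integral_le_of_norm_le (a := s) (b := t)
    (f := fun r => T * (κ r * (r * (circ a b w (T * r) (M * r) - d))))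
    (g := fun r => (8 + 20 * K) * F r + K) (μ := volume) hst ?_
    (Continuous.intervalIntegrable (by fun_prop) _ _)
  · rw [Real.norm_eq_abs] at hbd
    refine hbd.trans ?_
    rw [intervalIntegral.integral_add (Continuous.intervalIntegrable (by fun_prop) _ _) (by simp),
      intervalIntegral.integral_const_mul, intervalIntegral.integral_const, smul_eq_mul]
    have h1 := h.integral_ringInt_en_le w hT0 hM0 hs hst
    have h2 : (8 + 20 * K) * ∫ r in s..t, F r ≤ (8 + 20 * K) * E := by gcongr
    have h3 : (t - s) * K ≤ 1 * K := by gcongr; linarith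
    linarith
  · filter_upwards [compl_mem_ae_iff.2 (measure_singleton t)] with r hr hrs
    exact hpt r ⟨hrs.1, lt_of_le_of_ne hrs.2 hr⟩

end FiniteEnergy

/-- A smooth profile, equal to one up to `1 - 2 / n ^ 2` and vanishing after `1`. -/
def profile (n σ : ℝ) : ℝ := Real.smoothTransition (n ^ 2 * (1 - σ) - 1)

theorem contDiff_profile (n : ℝ) : ContDiff ℝ (⊤ : ℕ∞) (profile n) :=
  Real.smoothTransition.contDiff.comp (by fun_prop)

@[fun_prop]
theorem continuous_profile (n : ℝ) : Continuous (profile n) := (contDiff_profile n).continuous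

theorem profile_nonneg (n σ : ℝ) : 0 ≤ profile n σ := Real.smoothTransition.nonneg _

theorem profile_le_one (n σ : ℝ) : profile n σ ≤ 1 := Real.smoothTransition.le_one _

theorem profile_eq_zero (n : ℝ) {σ : ℝ} (h : 1 ≤ σ) : profile n σ = 0 :=
  Real.smoothTransition.zero_of_nonpos (by nlinarith [sq_nonneg n])

theorem profile_eq_one {n σ : ℝ} (h : 2 ≤ n ^ 2 * (1 - σ)) : profile n σ = 1 :=
  Real.smoothTransition.one_of_one_le (by linarith)

/-- The primitive of minus the profile vanishing after `1`. -/
def profilePrim (n σ : ℝ) : ℝ := ∫ s in σ..1, profile n s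

theorem hasDerivAt_profilePrim (n σ : ℝ) : HasDerivAt (profilePrim n) (-profile n σ) σ := by
  have h := intervalIntegral.integral_hasDerivAt_right (a := 1) (b := σ)
    ((continuous_profile n).intervalIntegrable _ _)
    (continuous_profile n).stronglyMeasurable.stronglyMeasurableAtFilter
    (continuous_profile n).continuousAt
  have e : profilePrim n = fun σ => -∫ s in (1 : ℝ)..σ, profile n s := by
    funext σ; rw [profilePrim, intervalIntegral.integral_symm]
  rw [e]; exact h.neg

theorem contDiff_profilePrim (n : ℝ) : ContDiff ℝ (⊤ : ℕ∞) (profilePrim n) := by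
  rw [contDiff_infty_iff_deriv]
  refine ⟨fun σ => (hasDerivAt_profilePrim n σ).differentiableAt, ?_⟩
  have : deriv (profilePrim n) = fun σ => -profile n σ :=
    funext fun σ => (hasDerivAt_profilePrim n σ).deriv
  rw [this]; exact (contDiff_profile n).neg

theorem profilePrim_eq_zero (n : ℝ) {σ : ℝ} (h : 1 ≤ σ) : profilePrim n σ = 0 := by
  rw [profilePrim, intervalIntegral.integral_symm, neg_eq_zero]
  refine intervalIntegral.integral_zero_ae (Eventually.of_forall fun s hs => ?_)
  rw [Set.uIoc_of_le h] at hs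
  exact profile_eq_zero n hs.1.le

/-- The squared elliptic radius. -/
def ellSq (w : ℂ) (T M : ℝ) (z : ℂ) : ℝ := ((z.re - w.re) / T) ^ 2 + ((z.im - w.im) / M) ^ 2

@[fun_prop] theorem Smooth.ellSq (w : ℂ) (T M : ℝ) : Smooth (ellSq w T M) := by
  unfold _root_.ellSq; fun_prop

theorem ellSq_ell (w : ℂ) {T M : ℝ} (hT : 0 < T) (hM : 0 < M) (t θ : ℝ) :
    ellSq w T M (ell w (T * t) (M * t) θ) = t ^ 2 := by
  simp only [ellSq, ell_re, ell_im, add_sub_cancel_left]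
  field_simp
  rw [Real.cos_sq_add_sin_sq, mul_one]

/-- The elliptic test function. -/
def bump (n : ℝ) (w : ℂ) (T M : ℝ) (z : ℂ) : ℝ := T / 2 * profilePrim n (ellSq w T M z)

section Bump
variable (n : ℝ) (w : ℂ) {T M : ℝ}

theorem Smooth.bump (T M : ℝ) : Smooth (bump n w T M) :=
  contDiff_const.mul ((contDiff_profilePrim n).comp (Smooth.ellSq w T M).contDiff)

theorem fderiv_bump (T M : ℝ) (z v : ℂ) : fderiv ℝ (bump n w T M) z v =
    -(T / 2 * profile n (ellSq w T M z)) * fderiv ℝ (ellSq w T M) z v := by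
  have h1 := (Smooth.ellSq w T M).differentiableAt (z := z) |>.hasFDerivAt
  have h2 := ((hasDerivAt_profilePrim n (ellSq w T M z)).comp_hasFDerivAt z h1).const_mul (T / 2)
  have : fderiv ℝ (bump n w T M) z = _ := h2.fderiv
  rw [this]
  simp; ring

theorem dx_ellSq (T M : ℝ) (z : ℂ) : dx (ellSq w T M) z = 2 * (z.re - w.re) / T ^ 2 := by
  unfold ellSq
  simp (disch := fun_prop) only [dx_add, dx_pow, dx_div_const, dx_sub, dx_re, dx_im, dx_const]
  push_cast; ring

theorem dy_ellSq (T M : ℝ) (z : ℂ) : dy (ellSq w T M) z = 2 * (z.im - w.im) / M ^ 2 := by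
  unfold ellSq
  simp (disch := fun_prop) only [dy_add, dy_pow, dy_div_const, dy_sub, dy_re, dy_im, dy_const]
  push_cast; ring

theorem dx_bump (hT : 0 < T) (z : ℂ) :
    dx (bump n w T M) z = -profile n (ellSq w T M z) * ((z.re - w.re) / T) := by
  have := fderiv_bump n w T M z 1
  have h2 := dx_ellSq w T M z
  unfold dx at *
  rw [this, h2]; field_simp

theorem dy_bump (z : ℂ) :
    dy (bump n w T M) z = -profile n (ellSq w T M z) * (T * (z.im - w.im) / M ^ 2) := by
  have := fderiv_bump n w T M z Complex.I
  have h2 := dy_ellSq w T M z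
  unfold dy at *
  rw [this, h2]; ring

theorem one_le_ellSq_of_notMem (hT : 0 < T) (hM : 0 < M) {z : ℂ} (hz : z ∉ closedBall w (T + M)) :
    1 ≤ ellSq w T M z := by
  rw [mem_closedBall, not_le, dist_eq_norm] at hz
  have h1 := Complex.norm_le_abs_re_add_abs_im (z - w)
  simp only [Complex.sub_re, Complex.sub_im] at h1
  by_contra! hlt
  unfold ellSq at hlt
  have h2 : |(z.re - w.re) / T| < 1 := by
    rw [← sq_lt_one_iff_abs_lt_one]; nlinarith [sq_nonneg ((z.im - w.im) / M)]
  have h3 : |(z.im - w.im) / M| < 1 := by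
    rw [← sq_lt_one_iff_abs_lt_one]; nlinarith [sq_nonneg ((z.re - w.re) / T)]
  rw [abs_div, abs_of_pos hT, div_lt_one hT] at h2
  rw [abs_div, abs_of_pos hM, div_lt_one hM] at h3
  linarith

theorem hasCompactSupport_bump (hT : 0 < T) (hM : 0 < M) : HasCompactSupport (bump n w T M) :=
  HasCompactSupport.intro (isCompact_closedBall w (T + M)) fun z hz => by
    rw [bump, profilePrim_eq_zero n (one_le_ellSq_of_notMem w hT hM hz), mul_zero]

theorem abs_dx_bump_le (hT : 0 < T) (z : ℂ) : |dx (bump n w T M) z| ≤ 1 := by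
  rw [dx_bump n w hT, abs_mul, abs_neg, abs_of_nonneg (profile_nonneg _ _)]
  by_cases h : 1 ≤ ellSq w T M z
  · rw [profile_eq_zero n h]; simp
  · push Not at h
    have h2 : |(z.re - w.re) / T| ≤ 1 := by
      rw [← sq_le_one_iff_abs_le_one]; unfold ellSq at h; nlinarith [sq_nonneg ((z.im - w.im) / M)]
    exact mul_le_one₀ (profile_le_one _ _) (abs_nonneg _) h2

theorem abs_dy_bump_le (hT : 0 < T) (hM : 0 < M) (z : ℂ) : |dy (bump n w T M) z| ≤ T / M := by
  rw [dy_bump n w, abs_mul, abs_neg, abs_of_nonneg (profile_nonneg _ _)]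
  by_cases h : 1 ≤ ellSq w T M z
  · rw [profile_eq_zero n h]; simp; positivity
  · push Not at h
    have h2 : |(z.im - w.im) / M| ≤ 1 := by
      rw [← sq_le_one_iff_abs_le_one]; unfold ellSq at h; nlinarith [sq_nonneg ((z.re - w.re) / T)]
    have e : T * (z.im - w.im) / M ^ 2 = T / M * ((z.im - w.im) / M) := by field_simp
    rw [e, abs_mul, abs_of_pos (by positivity : 0 < T / M)]
    have h3 : T / M * |(z.im - w.im) / M| ≤ T / M * 1 := by gcongr
    have h4 := mul_le_mul (profile_le_one n (ellSq w T M z)) h3 (by positivity) zero_le_one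
    linarith

/-- The flux against the elliptic test function is an average of line integrals. -/
theorem integral_bump_flux (hT : 0 < T) (hM : 0 < M) {P R : ℂ → ℝ} (hP : Continuous P)
    (hR : Continuous R) :
    ∫ z, (dx (bump n w T M) z * R z - dy (bump n w T M) z * P z)
      = -(T * ∫ t in (0 : ℝ)..1, profile n (t ^ 2) * (t * ∫ θ in (-Real.pi)..Real.pi,
        (-(T * t) * Real.sin θ * P (ell w (T * t) (M * t) θ)
          + M * t * Real.cos θ * R (ell w (T * t) (M * t) θ)))) := by
  have hψ := Smooth.bump n w T M
  have hc := hasCompactSupport_bump n w hT hM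
  have c1 : Continuous fun z => dx (bump n w T M) z * R z - dy (bump n w T M) z * P z := by
    fun_prop
  have i1 : Integrable fun z => dx (bump n w T M) z * R z - dy (bump n w T M) z * P z :=
    (integrable_mul_of_hasCompactSupport hψ.dx.continuous hc.dx hR).sub
      (integrable_mul_of_hasCompactSupport hψ.dy.continuous hc.dy hP)
  rw [← integral_ringInt w hT hM c1.measurable i1]
  have e : ∀ t, T * M * t * ringInt (fun z => dx (bump n w T M) z * R z
      - dy (bump n w T M) z * P z) w (T * t) (M * t)
      = -T * (profile n (t ^ 2) * (t * ∫ θ in (-Real.pi)..Real.pi,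
        (-(T * t) * Real.sin θ * P (ell w (T * t) (M * t) θ)
          + M * t * Real.cos θ * R (ell w (T * t) (M * t) θ)))) := by
    intro t
    unfold ringInt
    simp_rw [← intervalIntegral.integral_const_mul]
    congr 1; funext θ
    rw [dx_bump n w hT, dy_bump n w, ellSq_ell w hT hM]
    simp only [ell_re, ell_im, add_sub_cancel_left]
    field_simp
    ring
  simp_rw [e]
  rw [integral_const_mul, neg_mul, intervalIntegral.integral_of_le zero_le_one]
  congr 2
  refine setIntegral_eq_of_subset_of_forall_sdiff_eq_zero measurableSet_Ioi
    (fun t ht => ht.1) fun t ht => ?_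
  have : 1 < t := by
    by_contra! h; exact ht.2 ⟨ht.1, h⟩
  rw [profile_eq_zero n (by nlinarith), zero_mul]

end Bump

/-- The momentum density. -/
def mom (a b : ℂ → ℝ) (z : ℂ) : ℝ := dy a z * b z - dy b z * (a z - 1)

@[fun_prop] theorem Smooth.mom {a b : ℂ → ℝ} (ha : Smooth a) (hb : Smooth b) :
    Smooth (mom a b) := by
  unfold _root_.mom; fun_prop

theorem ae_re_ne_zero : ∀ᵐ z : ℂ, z.re ≠ 0 := by
  have h5 := (Measure.quasiMeasurePreserving_fst (μ := (volume : Measure ℝ))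
    (ν := (volume : Measure ℝ))).ae (p := fun x : ℝ => x ≠ 0)
    (compl_mem_ae_iff.2 (measure_singleton 0))
  exact Complex.volume_preserving_equiv_real_prod.quasiMeasurePreserving.ae h5

/-- The reflection in the second coordinate axis. -/
def mirror : ℂ ≃ₗᵢ[ℝ] ℂ := Complex.conjLIE.trans (LinearIsometryEquiv.neg ℝ)

@[simp] theorem mirror_apply (z : ℂ) : mirror z = -(starRingEnd ℂ) z := rfl

theorem measurePreserving_mirror : MeasurePreserving (mirror : ℂ → ℂ) volume volume :=
  mirror.measurePreserving

/-- Functions which are even in the first coordinate. -/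
def Even1 (f : ℂ → ℝ) : Prop := ∀ z, f (mirror z) = f z

namespace Even1
variable {f : ℂ → ℝ}

theorem fderiv_apply (h : Even1 f) (hf : Smooth f) (z v : ℂ) :
    fderiv ℝ f (mirror z) (mirror v) = fderiv ℝ f z v := by
  have h1 := (hf.differentiableAt (z := mirror z)).hasFDerivAt
  have h2 := h1.comp z mirror.toContinuousLinearEquiv.hasFDerivAt
  have e : f ∘ (mirror : ℂ → ℂ) = f := funext h
  rw [e] at h2
  rw [h2.fderiv]; rfl

theorem dx (h : Even1 f) (hf : Smooth f) (z : ℂ) : _root_.dx f (mirror z) = -_root_.dx f z := by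
  have := h.fderiv_apply hf z 1
  unfold _root_.dx
  simp only [mirror_apply, map_one, map_neg] at this ⊢
  linarith

theorem dy (h : Even1 f) (hf : Smooth f) (z : ℂ) : _root_.dy f (mirror z) = _root_.dy f z := by
  have := h.fderiv_apply hf z Complex.I
  unfold _root_.dy
  simpa using this

theorem setIntegral_eq (h : Even1 f) (s : Set ℂ) :
    ∫ z in mirror ⁻¹' s, f z = ∫ z in s, f z := by
  have := measurePreserving_mirror.setIntegral_preimage_emb
    mirror.toHomeomorph.measurableEmbedding f s
  rw [← this]
  exact integral_congr_ae (Eventually.of_forall fun z => (h z).symm)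

theorem integral_re_pos (h : Even1 f) (hi : Integrable f) :
    ∫ z in {z : ℂ | 0 < z.re}, f z = 1 / 2 * ∫ z, f z := by
  have hm : MeasurableSet {z : ℂ | 0 < z.re} :=
    measurableSet_lt measurable_const Complex.measurable_re
  have h1 : (∫ z in {z : ℂ | 0 < z.re}, f z) + ∫ z in {z : ℂ | 0 < z.re}ᶜ, f z = ∫ z, f z :=
    integral_add_compl hm hi
  have h2 := h.setIntegral_eq {z : ℂ | 0 < z.re}
  have h3 : (mirror ⁻¹' {z : ℂ | 0 < z.re} : Set ℂ) =ᵐ[volume] ({z : ℂ | 0 < z.re}ᶜ : Set ℂ) := by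
    filter_upwards [ae_re_ne_zero] with z hz
    apply propext
    change 0 < (mirror z).re ↔ ¬ 0 < z.re
    simp only [mirror_apply, Complex.neg_re, Complex.conj_re]
    constructor
    · intro h; linarith
    · intro h; have := lt_of_le_of_ne (not_lt.1 h) hz; linarith
  rw [setIntegral_congr_set h3] at h2
  rw [h2] at h1
  rw [← h1]; ring

end Even1

section Limit
variable {a b : ℂ → ℝ} {E : ℝ}

theorem integral_sq_dy_bump_le (n : ℝ) (w : ℂ) {T M : ℝ} (hT : 0 < T) (hM : 0 < M) :
    ∫ z, dy (bump n w T M) z ^ 2 ≤ 2 * Real.pi * T ^ 3 / M := by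
  have hψ := Smooth.bump n w T M
  have hc := hasCompactSupport_bump n w hT hM
  have hpi := Real.pi_pos
  have i1 : Integrable fun z => dy (bump n w T M) z ^ 2 := by
    simp_rw [sq]
    exact integrable_mul_of_hasCompactSupport hψ.dy.continuous hc.dy hψ.dy.continuous
  rw [← integral_ringInt w hT hM (hψ.dy.pow 2).continuous.measurable i1]
  have hle : ∀ t, 0 ≤ t → |T * M * t * ringInt (fun z => dy (bump n w T M) z ^ 2) w (T * t) (M * t)|
      ≤ T * M * t * (2 * Real.pi * (T / M) ^ 2) := by
    intro t ht
    rw [abs_mul, abs_of_nonneg (by positivity : 0 ≤ T * M * t)]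
    gcongr
    unfold ringInt
    have := intervalIntegral.norm_integral_le_of_norm_le_const (a := -Real.pi) (b := Real.pi)
      (f := fun θ => dy (bump n w T M) (ell w (T * t) (M * t) θ) ^ 2) (C := (T / M) ^ 2)
      (fun θ _ => by
        rw [Real.norm_eq_abs, abs_pow]
        exact pow_le_pow_left₀ (abs_nonneg _) (abs_dy_bump_le n w hT hM _) 2)
    rw [Real.norm_eq_abs, abs_of_pos (by linarith : 0 < Real.pi - -Real.pi)] at this
    linarith
  rw [show ∫ t in Set.Ioi 0,
      T * M * t * ringInt (fun z => dy (bump n w T M) z ^ 2) w (T * t) (M * t)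
    = ∫ t in (0 : ℝ)..1, T * M * t * ringInt (fun z => dy (bump n w T M) z ^ 2) w (T * t) (M * t) by
      rw [intervalIntegral.integral_of_le zero_le_one]
      refine setIntegral_eq_of_subset_of_forall_sdiff_eq_zero measurableSet_Ioi
        (fun t ht => ht.1) fun t ht => ?_
      have : 1 < t := by
        by_contra! h; exact ht.2 ⟨ht.1, h⟩
      unfold ringInt
      simp_rw [dy_bump n w, ellSq_ell w hT hM, profile_eq_zero n (show 1 ≤ t ^ 2 by nlinarith)]
      simp]
  have := intervalIntegral.norm_integral_le_of_norm_le_const (a := 0) (b := 1)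
      (f := fun t => T * M * t * ringInt (fun z => dy (bump n w T M) z ^ 2) w (T * t) (M * t))
      (C := T * M * 1 * (2 * Real.pi * (T / M) ^ 2)) (fun t ht => by
        rw [Set.uIoc_of_le zero_le_one] at ht
        refine (hle t ht.1.le).trans ?_
        have := ht.2
        gcongr)
  refine (le_abs_self _).trans (this.trans (le_of_eq ?_))
  rw [sub_zero, abs_one]
  field_simp

/-- Cauchy-Schwarz bound for the error term in the momentum formula. -/
theorem FiniteEnergy.abs_integral_dy_bump_le (h : FiniteEnergy a b E) (n : ℝ) (w : ℂ) {T M δ : ℝ}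
    (hT : 0 < T) (hM : 0 < M) (hδ : 0 < δ) :
    |∫ z, dy (bump n w T M) z * ((a z - 1) * dx b z - b z * dx a z)|
      ≤ δ * E + (5 * (2 * Real.pi * T ^ 3 / M) + (T / M) ^ 2 * (4 * E)) / (2 * δ) := by
  have hψ := Smooth.bump n w T M
  have hc := hasCompactSupport_bump n w hT hM
  have ha := h.sa
  have hb := h.sb
  have i1 : Integrable fun z => dy (bump n w T M) z ^ 2 := by
    simp_rw [sq]
    exact integrable_mul_of_hasCompactSupport hψ.dy.continuous hc.dy hψ.dy.continuous
  have i2 := h.integrable_gsq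
  have i3 := h.int
  refine (abs_integral_le_integral_abs).trans ?_
  have hpt : ∀ z, |dy (bump n w T M) z * ((a z - 1) * dx b z - b z * dx a z)|
      ≤ δ / 2 * gsq a b z + 5 / (2 * δ) * dy (bump n w T M) z ^ 2
        + 4 * (T / M) ^ 2 / (2 * δ) * en a b z := by
    intro z
    have h1 := abs_dy_bump_le n w hT hM z
    set q := dy (bump n w T M) z
    have h2 : q ^ 2 ≤ (T / M) ^ 2 := by
      rw [← sq_abs]; exact pow_le_pow_left₀ (abs_nonneg _) h1 2
    have h3 := eta_sq_le_en a b z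
    have h4 : ((a z - 1) * dx b z - b z * dx a z) ^ 2 ≤ (5 + eta a b z ^ 2) * gsq a b z := by
      have e1 : ((a z - 1) * dx b z - b z * dx a z) ^ 2
        ≤ ((a z - 1) ^ 2 + b z ^ 2) * (dx a z ^ 2 + dx b z ^ 2) := by
        nlinarith [sq_nonneg ((a z - 1) * dx a z + b z * dx b z)]
      have e2 : (a z - 1) ^ 2 + b z ^ 2 ≤ 5 + eta a b z ^ 2 := by
        unfold eta
        nlinarith [sq_nonneg (1 - a z ^ 2 - b z ^ 2 + 1), sq_nonneg (a z + 1), sq_nonneg (b z)]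
      have e3 : dx a z ^ 2 + dx b z ^ 2 ≤ gsq a b z := by
        unfold gsq; nlinarith [sq_nonneg (dy a z), sq_nonneg (dy b z)]
      calc _ ≤ _ := e1
        _ ≤ _ := by gcongr
    set y := (a z - 1) * dx b z - b z * dx a z
    have hg := gsq_nonneg a b z
    have h5 : |q * y| ≤ δ / 2 * gsq a b z + (5 + eta a b z ^ 2) * q ^ 2 / (2 * δ) := by
      refine abs_le_of_sq_le_sq ?_ (by positivity)
      have h6 : (q * y) ^ 2 ≤ q ^ 2 * ((5 + eta a b z ^ 2) * gsq a b z) := by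
        rw [mul_pow]; gcongr
      refine h6.trans ?_
      have h7 : δ / 2 * gsq a b z * ((5 + eta a b z ^ 2) * q ^ 2 / (2 * δ)) * 4
        = q ^ 2 * ((5 + eta a b z ^ 2) * gsq a b z) := by field_simp; ring
      nlinarith [sq_nonneg (δ / 2 * gsq a b z - (5 + eta a b z ^ 2) * q ^ 2 / (2 * δ))]
    have he := en_nonneg a b z
    have h8 : eta a b z ^ 2 * q ^ 2 ≤ (4 * en a b z) * (T / M) ^ 2 := by
      gcongr
    have h9 : (5 + eta a b z ^ 2) * q ^ 2 / (2 * δ)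
        ≤ (5 * q ^ 2 + (4 * en a b z) * (T / M) ^ 2) / (2 * δ) := by
      gcongr; linarith
    calc _ ≤ _ := h5
      _ ≤ δ / 2 * gsq a b z + (5 * q ^ 2 + (4 * en a b z) * (T / M) ^ 2) / (2 * δ) := by gcongr
      _ = _ := by ring
  refine (integral_mono (Integrable.abs (integrable_mul_of_hasCompactSupport hψ.dy.continuous hc.dy
    (by fun_prop))) (((i2.const_mul _).add (i1.const_mul _)).add (i3.const_mul _)) hpt).trans ?_
  rw [integral_add' ((i2.const_mul _).add (i1.const_mul _)) (i3.const_mul _),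
    integral_add' (i2.const_mul _) (i1.const_mul _), integral_const_mul, integral_const_mul,
    integral_const_mul]
  have h1 := h.integral_gsq_le
  have h2 := integral_sq_dy_bump_le n w hT hM
  have h3 := h.le
  calc _ ≤ δ / 2 * (2 * E) + 5 / (2 * δ) * (2 * Real.pi * T ^ 3 / M)
        + 4 * (T / M) ^ 2 / (2 * δ) * E := by gcongr
    _ = _ := by ring

/-- Weighted circulations represent the truncated momentum. -/
theorem FiniteEnergy.average_circ_eq (h : FiniteEnergy a b E) (n : ℝ) (w : ℂ) {T M : ℝ}
    (hT : 0 < T) (hM : 0 < M) :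
    T * ∫ t in (0 : ℝ)..1, profile n (t ^ 2) * (t * circ a b w (T * t) (M * t))
      = (∫ z, dx (bump n w T M) z * mom a b z)
        + ∫ z, dy (bump n w T M) z * ((a z - 1) * dx b z - b z * dx a z) := by
  have hψ := Smooth.bump n w T M
  have hc := hasCompactSupport_bump n w hT hM
  have ha := h.sa
  have hb := h.sb
  have h1 := integral_bump_flux n w hT hM (ha.cur1 hb).continuous (ha.cur2 hb).continuous
  unfold circ
  set S := T * ∫ t in (0 : ℝ)..1, profile n (t ^ 2) * (t * ∫ θ in (-Real.pi)..Real.pi,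
        (-(T * t) * Real.sin θ * cur1 a b (ell w (T * t) (M * t) θ)
          + M * t * Real.cos θ * cur2 a b (ell w (T * t) (M * t) θ)))
  have i1 := integrable_mul_of_hasCompactSupport hψ.dx.continuous hc.dx (ha.mom hb).continuous
  have i2 := integrable_mul_of_hasCompactSupport (g := fun z => (a z - 1) * dx b z - b z * dx a z)
    hψ.dy.continuous hc.dy (by fun_prop)
  have z1 : ∫ z, dx (fun z => bump n w T M z * dy b z) z = 0 :=
    integral_dx_eq_zero (by fun_prop) hc.mul_right
  have z2 : ∫ z, dy (fun z => bump n w T M z * dx b z) z = 0 :=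
    integral_dy_eq_zero (by fun_prop) hc.mul_right
  have i3 : Integrable (dx (fun z => bump n w T M z * dy b z)) :=
    (hψ.mul hb.dy).dx.continuous.integrable_of_hasCompactSupport
      (HasCompactSupport.dx hc.mul_right)
  have i4 : Integrable (dy (fun z => bump n w T M z * dx b z)) :=
    (hψ.mul hb.dx).dy.continuous.integrable_of_hasCompactSupport
      (HasCompactSupport.dy hc.mul_right)
  have e : ∀ z, dx (bump n w T M) z * cur2 a b z - dy (bump n w T M) z * cur1 a b z
      = (dx (fun z => bump n w T M z * dy b z) z - dy (fun z => bump n w T M z * dx b z) z)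
        - (dx (bump n w T M) z * mom a b z
          + dy (bump n w T M) z * ((a z - 1) * dx b z - b z * dx a z)) := by
    intro z
    simp (disch := fun_prop) only [dx_mul, dy_mul]
    rw [dx_dy_comm hb]
    unfold cur1 cur2 mom
    ring
  have i5 : Integrable fun z => dx (fun z => bump n w T M z * dy b z) z
      - dy (fun z => bump n w T M z * dx b z) z := i3.sub i4
  have i6 : Integrable fun z => dx (bump n w T M) z * mom a b z
      + dy (bump n w T M) z * ((a z - 1) * dx b z - b z * dx a z) := i1.add i2
  simp_rw [e] at h1
  rw [integral_sub i5 i6, integral_sub i3 i4, z1, z2, integral_add i1 i2] at h1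
  linarith

theorem tendsto_dx_bump (y : ℝ) {z : ℂ} (hz : z.re ≠ 0) :
    Tendsto (fun n : ℕ => dx (bump n ⟨n, y⟩ n ((n : ℝ) ^ 5)) z) atTop
      (nhds ({z : ℂ | 0 < z.re}.indicator (fun _ => 1) z)) := by
  rcases lt_or_gt_of_ne hz with h | h
  · rw [Set.indicator_of_notMem (by simp; linarith)]
    refine tendsto_const_nhds.congr' ?_
    filter_upwards [eventually_gt_atTop 0] with n hn
    have hn' : (0 : ℝ) < n := by exact_mod_cast hn
    rw [dx_bump _ _ hn', profile_eq_zero]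
    · simp
    · unfold ellSq
      have : 1 ≤ ((z.re - n) / n) ^ 2 := by
        rw [div_pow, one_le_div (by positivity)]; nlinarith
      have h2 := sq_nonneg ((z.im - y) / (n : ℝ) ^ 5)
      simp only
      linarith
  · rw [Set.indicator_of_mem (by simpa using h)]
    have h1 : ∀ᶠ n : ℕ in atTop, (3 + z.re ^ 2 + (z.im - y) ^ 2) / (2 * z.re) ≤ n ∧ 1 ≤ n :=
      ((tendsto_natCast_atTop_atTop (R := ℝ)).eventually_ge_atTop _).and (eventually_ge_atTop 1)
    have h3 : Tendsto (fun n : ℕ => 1 - z.re / (n : ℝ)) atTop (nhds (1 - 0)) :=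
      tendsto_const_nhds.sub (tendsto_const_div_atTop_nhds_zero_nat _)
    rw [sub_zero] at h3
    refine h3.congr' ?_
    filter_upwards [h1] with n hn
    have hn' : (1 : ℝ) ≤ n := by exact_mod_cast hn.2
    rw [dx_bump _ _ (by linarith), profile_eq_one]
    · field_simp; ring
    · have h4 := (div_le_iff₀ (by linarith)).1 hn.1
      unfold ellSq
      simp only
      have h5 : (n : ℝ) ^ 2 * (1 - (((z.re - n) / n) ^ 2 + ((z.im - y) / (n : ℝ) ^ 5) ^ 2))
        = 2 * z.re * n - z.re ^ 2 - (z.im - y) ^ 2 / (n : ℝ) ^ 8 := by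
        field_simp; ring
      have h6 : (z.im - y) ^ 2 / (n : ℝ) ^ 8 ≤ (z.im - y) ^ 2 :=
        div_le_self (by positivity) (one_le_pow₀ hn')
      rw [h5]; linarith

/-- The weighted circulations converge to the momentum. -/
theorem FiniteEnergy.tendsto_average_circ (h : FiniteEnergy a b E) (ea : Even1 a) (eb : Even1 b)
    (hi : Integrable (mom a b)) (y : ℝ) :
    Tendsto (fun n : ℕ => (n : ℝ) * ∫ t in (0 : ℝ)..1, profile n (t ^ 2) *
      (t * circ a b ⟨n, y⟩ (n * t) ((n : ℝ) ^ 5 * t))) atTop (nhds (1 / 2 * ∫ z, mom a b z)) := by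
  have hE := h.nonneg
  have em : Even1 (mom a b) := fun z => by
    change dy a (mirror z) * b (mirror z) - dy b (mirror z) * (a (mirror z) - 1) = _
    rw [ea, eb, ea.dy h.sa, eb.dy h.sb]; rfl
  have hm : MeasurableSet {z : ℂ | 0 < z.re} :=
    measurableSet_lt measurable_const Complex.measurable_re
  have t1 : Tendsto (fun n : ℕ => ∫ z, dx (bump n ⟨n, y⟩ n ((n : ℝ) ^ 5)) z * mom a b z) atTop
      (nhds (∫ z, {z : ℂ | 0 < z.re}.indicator (fun _ => (1 : ℝ)) z * mom a b z)) := by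
    refine tendsto_integral_filter_of_dominated_convergence (fun z => |mom a b z|) ?_ ?_ hi.abs ?_
    · exact Eventually.of_forall fun n =>
        ((Smooth.bump _ _ _ _).dx.continuous.mul (h.sa.mom h.sb).continuous).aestronglyMeasurable
    · filter_upwards [eventually_gt_atTop 0] with n hn
      refine Eventually.of_forall fun z => ?_
      have hn' : (0 : ℝ) < n := by exact_mod_cast hn
      rw [Real.norm_eq_abs, abs_mul]
      have := mul_le_mul_of_nonneg_right (abs_dx_bump_le n ⟨n, y⟩ (M := (n : ℝ) ^ 5) hn' z)
        (abs_nonneg (mom a b z))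
      linarith
    · filter_upwards [ae_re_ne_zero] with z hz
      exact (tendsto_dx_bump y hz).mul_const _
  have e1 : ∫ z, {z : ℂ | 0 < z.re}.indicator (fun _ => (1 : ℝ)) z * mom a b z
      = 1 / 2 * ∫ z, mom a b z := by
    rw [← em.integral_re_pos hi, ← integral_indicator hm]
    congr 1; funext z
    by_cases hz : z ∈ {z : ℂ | 0 < z.re}
    · rw [Set.indicator_of_mem hz, Set.indicator_of_mem hz, one_mul]
    · rw [Set.indicator_of_notMem hz, Set.indicator_of_notMem hz, zero_mul]
  rw [e1] at t1
  have t2 : Tendsto (fun n : ℕ => ∫ z, dy (bump n ⟨n, y⟩ n ((n : ℝ) ^ 5)) z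
      * ((a z - 1) * dx b z - b z * dx a z)) atTop (nhds 0) := by
    refine squeeze_zero_norm' (a := fun n : ℕ => (3 * E + 5 * Real.pi) / (n : ℝ)) ?_
      (tendsto_const_div_atTop_nhds_zero_nat _)
    filter_upwards [eventually_gt_atTop 0] with n hn
    have hn' : (1 : ℝ) ≤ n := by exact_mod_cast hn
    have hn0 : (0 : ℝ) < n := by linarith
    refine (h.abs_integral_dy_bump_le n ⟨n, y⟩ hn0 (by positivity)
      (inv_pos.2 hn0)).trans ?_
    have e : (n : ℝ)⁻¹ * E + (5 * (2 * Real.pi * (n : ℝ) ^ 3 / (n : ℝ) ^ 5)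
        + ((n : ℝ) / (n : ℝ) ^ 5) ^ 2 * (4 * E)) / (2 * (n : ℝ)⁻¹)
        = (E + 5 * Real.pi + 2 * E / (n : ℝ) ^ 6) / n := by
      field_simp; ring
    rw [e]
    refine div_le_div_of_nonneg_right ?_ hn0.le
    have : 2 * E / (n : ℝ) ^ 6 ≤ 2 * E := div_le_self (by positivity) (one_le_pow₀ hn')
    linarith
  have t3 := t1.add t2
  rw [add_zero] at t3
  refine t3.congr' ?_
  filter_upwards [eventually_gt_atTop 0] with n hn
  have hn0 : (0 : ℝ) < n := by exact_mod_cast hn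
  exact (h.average_circ_eq n ⟨n, y⟩ hn0 (by positivity)).symm

end Limit

/-- In the right half plane the only possible zero of `a + i b` is `w`. -/
def HalfZero (a b : ℂ → ℝ) (w : ℂ) : Prop :=
  ∀ z : ℂ, 0 < z.re → z ≠ w → 0 < a z ^ 2 + b z ^ 2

namespace HalfZero
variable {a b : ℂ → ℝ} {w : ℂ}

theorem wnd_eq_zero (h : HalfZero a b w) (ha : Smooth a) (hb : Smooth b) (hw : 0 ≤ w.re) {T M r : ℝ}
    (hT : 0 < T) (hr : 0 ≤ r) (hr2 : T * r < T - w.re) :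
    wnd a b ⟨T, w.im⟩ (T * r) (M * r) = 0 := by
  have : PreconnectedSpace (Set.Icc 0 r) := Subtype.preconnectedSpace isPreconnected_Icc
  have := wnd_eq_wnd ha hb (X := Set.Icc 0 r) (w := fun _ => ⟨T, w.im⟩) (α := fun x => T * x)
    (β := fun x => M * x) (by fun_prop) (by fun_prop) (by fun_prop) (fun x θ => by
      have h1 := x.2.1
      have h2 : T * (x : ℝ) ≤ T * r := by gcongr; exact x.2.2
      have h3 : -(T * (x : ℝ)) ≤ T * x * Real.cos θ := by
        nlinarith [Real.neg_one_le_cos θ, mul_nonneg hT.le h1]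
      have h4 : w.re < (ell ⟨T, w.im⟩ (T * x) (M * x) θ).re := by simp only [ell_re]; linarith
      exact h _ (by linarith) fun e => by rw [e] at h4; exact lt_irrefl _ h4)
    ⟨r, hr, le_rfl⟩ ⟨0, le_rfl, hr⟩
  simpa [wnd_zero] using this

theorem circle_pos (h : HalfZero a b w) {s : ℝ} (hs : 0 < s) (hs2 : s < w.re) (θ : ℝ) :
    0 < a (ell w s s θ) ^ 2 + b (ell w s s θ) ^ 2 := by
  refine h _ ?_ fun e => ?_
  · simp only [ell_re]; nlinarith [Real.neg_one_le_cos θ]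
  · have h1 := congrArg Complex.re e
    have h2 := congrArg Complex.im e
    simp only [ell_re, ell_im, add_eq_left, mul_eq_zero, hs.ne', false_or] at h1 h2
    have := Real.sin_sq_add_cos_sq θ
    rw [h1, h2] at this
    norm_num at this

theorem wnd_circle (h : HalfZero a b w) (ha : Smooth a) (hb : Smooth b) {s t : ℝ} (hs : 0 < s)
    (hs2 : s < w.re) (ht : 0 < t) (ht2 : t < w.re) : wnd a b w s s = wnd a b w t t := by
  have : PreconnectedSpace (Set.Ioo 0 w.re) := Subtype.preconnectedSpace isPreconnected_Ioo
  exact wnd_eq_wnd ha hb (X := Set.Ioo 0 w.re) (w := fun _ => w) (α := fun x => x)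
    (β := fun x => x) (by fun_prop) (by fun_prop) (by fun_prop)
    (fun x θ => h.circle_pos x.2.1 x.2.2 θ) ⟨s, hs, hs2⟩ ⟨t, ht, ht2⟩

theorem homotopy_pos (h : HalfZero a b w) {T M r s μ : ℝ} (hT : w.re < T)
    (hM : 0 < M) (hr : 0 < r) (hr1 : r < 1) (hr2 : T - w.re < T * r) (hs : 0 < s) (hs2 : s < w.re)
    (hμ : 0 ≤ μ) (hμ1 : μ ≤ 1) (θ : ℝ) :
    0 < a (ell ⟨(1 - μ) * T + μ * w.re, w.im⟩ ((1 - μ) * (T * r) + μ * s)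
        ((1 - μ) * (M * r) + μ * s) θ) ^ 2
      + b (ell ⟨(1 - μ) * T + μ * w.re, w.im⟩ ((1 - μ) * (T * r) + μ * s)
        ((1 - μ) * (M * r) + μ * s) θ) ^ 2 := by
  have hw : 0 < w.re := hs.trans hs2
  have hT0 : 0 < T := hw.trans hT
  have hc := Real.neg_one_le_cos θ
  have hTr : 0 < T * r := by positivity
  have key : ∀ A B : ℝ, 0 < A → 0 < B → 0 < (1 - μ) * A + μ * B := by
    intro A B hA hB
    rcases eq_or_lt_of_le hμ with rfl | h0
    · simpa using hA
    · have : 0 ≤ (1 - μ) * A := mul_nonneg (by linarith) hA.le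
      have : 0 < μ * B := by positivity
      linarith
  refine h _ ?_ fun e => ?_
  · simp only [ell_re]
    have := key (T + T * r * Real.cos θ) (w.re + s * Real.cos θ) (by nlinarith) (by nlinarith)
    linarith
  · have h1 := congrArg Complex.re e
    have h2 := congrArg Complex.im e
    simp only [ell_re, ell_im, add_eq_left, mul_eq_zero,
      (key (M * r) s (by positivity) hs).ne', false_or] at h1 h2
    have h3 := Real.sin_sq_add_cos_sq θ
    rw [h2] at h3
    have h4 : (Real.cos θ - 1) * (Real.cos θ + 1) = 0 := by linarith
    rcases mul_eq_zero.1 h4 with h5 | h5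
    · rw [show Real.cos θ = 1 by linarith] at h1
      have := key (T + T * r - w.re) s (by linarith) hs
      linarith
    · rw [show Real.cos θ = -1 by linarith] at h1
      have := key (T * r + w.re - T) s (by linarith) hs
      linarith

theorem wnd_ellipse (h : HalfZero a b w) (ha : Smooth a) (hb : Smooth b) {T M r s : ℝ}
    (hT : w.re < T) (hM : 0 < M) (hr : 0 < r) (hr1 : r < 1) (hr2 : T - w.re < T * r) (hs : 0 < s)
    (hs2 : s < w.re) : wnd a b ⟨T, w.im⟩ (T * r) (M * r) = wnd a b w s s := by
  have : PreconnectedSpace (Set.Icc (0 : ℝ) 1) := Subtype.preconnectedSpace isPreconnected_Icc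
  have := wnd_eq_wnd ha hb (X := Set.Icc (0 : ℝ) 1)
    (w := fun μ => ⟨(1 - μ) * T + μ * w.re, w.im⟩) (α := fun μ => (1 - μ) * (T * r) + μ * s)
    (β := fun μ => (1 - μ) * (M * r) + μ * s) (continuous_mk_complex (by fun_prop) (by fun_prop))
    (by fun_prop) (by fun_prop)
    (fun μ θ => h.homotopy_pos hT hM hr hr1 hr2 hs hs2 μ.2.1 μ.2.2 θ)
    ⟨0, le_rfl, zero_le_one⟩ ⟨1, zero_le_one, le_rfl⟩
  simpa using this

end HalfZero

theorem integral_profile_mul_id_le (n : ℝ) {s : ℝ} (hs : 0 ≤ s) (hs1 : s ≤ 1) :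
    ∫ t in s..1, profile n (t ^ 2) * t ≤ 1 - s := by
  have c : Continuous fun t => profile n (t ^ 2) * t := by fun_prop
  calc ∫ t in s..1, profile n (t ^ 2) * t ≤ ∫ _ in s..1, (1 : ℝ) :=
        intervalIntegral.integral_mono_on hs1 (c.intervalIntegrable _ _) (by simp) fun t ht =>
          mul_le_one₀ (profile_le_one _ _) (hs.trans ht.1) ht.2
    _ = 1 - s := by simp

theorem le_integral_profile_mul_id {n s : ℝ} (hn : 2 ≤ n ^ 2) (hs : 0 ≤ s)
    (hs1 : s ≤ 1 - 2 / n ^ 2) :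
    (1 - 2 / n ^ 2 - s) * s ≤ ∫ t in s..1, profile n (t ^ 2) * t := by
  have hn0 : 0 < n ^ 2 := by linarith
  have h2 : 0 ≤ 2 / n ^ 2 := by positivity
  have c : Continuous fun t => profile n (t ^ 2) * t := by fun_prop
  rw [← intervalIntegral.integral_add_adjacent_intervals (b := 1 - 2 / n ^ 2)
    (c.intervalIntegrable _ _) (c.intervalIntegrable _ _)]
  have h3 : 0 ≤ ∫ t in (1 - 2 / n ^ 2)..1, profile n (t ^ 2) * t :=
    intervalIntegral.integral_nonneg (by linarith) fun t ht =>
      mul_nonneg (profile_nonneg _ _) (by linarith [ht.1])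
  have h4 : (1 - 2 / n ^ 2 - s) * s ≤ ∫ t in s..(1 - 2 / n ^ 2), profile n (t ^ 2) * t := by
    calc (1 - 2 / n ^ 2 - s) * s = ∫ _ in s..(1 - 2 / n ^ 2), s := by simp
      _ ≤ _ := intervalIntegral.integral_mono_on hs1 (by simp) (c.intervalIntegrable _ _) ?_
    intro t ht
    rw [profile_eq_one, one_mul]
    · exact ht.1
    · have ht0 : 0 ≤ t := hs.trans ht.1
      have ht1 : t ≤ 1 := by linarith [ht.2]
      have : 2 / n ^ 2 ≤ 1 - t ^ 2 := by nlinarith [ht.2]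
      rwa [div_le_iff₀' hn0] at this
  linarith

section MomentumBounds
variable {a b : ℂ → ℝ} {E : ℝ} {w : ℂ}

theorem HalfZero.average_circ_bounds (hz : HalfZero a b w) (h : FiniteEnergy a b E)
    (hw : 0 ≤ w.re) {n : ℝ} (hn : w.re < n) (hn1 : 1 ≤ n) :
    |(n * ∫ t in (0 : ℝ)..1, profile n (t ^ 2) * (t * circ a b ⟨n, w.im⟩ (n * t) (n ^ 5 * t)))
      - n * ∫ t in (1 - w.re / n)..1,
          profile n (t ^ 2) * (t * circ a b ⟨n, w.im⟩ (n * t) (n ^ 5 * t))|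
      ≤ (8 + 40 * E) * E + 2 * E := by
  have hn0 : 0 < n := by linarith
  have hM : n ≤ n ^ 5 := le_self_pow₀ hn1 (by norm_num)
  have cQ := h.continuous_circ ⟨n, w.im⟩ n (n ^ 5)
  have c : Continuous fun t => profile n (t ^ 2) *
    (t * circ a b ⟨n, w.im⟩ (n * t) (n ^ 5 * t)) := by fun_prop
  have hs1 : w.re / n ≤ 1 := by rw [div_le_one hn0]; exact hn.le
  have hs0 : 0 ≤ w.re / n := by positivity
  have h1 := h.abs_slice_le ⟨n, w.im⟩ (T := n) (M := n ^ 5) (s := 0) (t := 1 - w.re / n) (d := 0)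
    (K := 2 * E) hn1 hM le_rfl (by linarith) (by linarith) (by simp)
    (fun r hr θ => by
      have h2 : n * r < n - w.re := by
        have := mul_lt_mul_of_pos_left hr.2 hn0
        rwa [mul_sub, mul_one, mul_div_cancel₀ _ hn0.ne'] at this
      have h3 : -(n * r) ≤ n * r * Real.cos θ := by
        nlinarith [Real.neg_one_le_cos θ, mul_pos hn0 hr.1]
      have h4 : w.re < (ell ⟨n, w.im⟩ (n * r) (n ^ 5 * r) θ).re := by simp only [ell_re]; linarith
      exact hz _ (by linarith) fun e => by rw [e] at h4; exact lt_irrefl _ h4)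
    (fun r hr => by
      refine hz.wnd_eq_zero h.sa h.sb hw hn0 hr.1.le ?_
      have := mul_lt_mul_of_pos_left hr.2 hn0
      rwa [mul_sub, mul_one, mul_div_cancel₀ _ hn0.ne'] at this)
    (κ := fun t => profile n (t ^ 2)) (by fun_prop) (fun r => profile_nonneg _ _)
    (fun r => profile_le_one _ _)
  rw [← mul_sub, ← intervalIntegral.integral_add_adjacent_intervals (b := 1 - w.re / n)
    (c.intervalIntegrable _ _) (c.intervalIntegrable _ _), add_sub_cancel_right]
  simp only [zero_mul, sub_zero] at h1
  exact h1.trans (le_of_eq (by ring))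

/-- The momentum is controlled by the distance of the zero to the axis. -/
theorem HalfZero.momentum_le (hz : HalfZero a b w) (h : FiniteEnergy a b E)
    (ea : Even1 a) (eb : Even1 b) (hi : Integrable (mom a b)) (hw : 0 ≤ w.re) :
    1 / 2 * ∫ z, mom a b z ≤ 2 * E * w.re + ((8 + 40 * E) * E + 2 * E) := by
  have hE := h.nonneg
  refine le_of_tendsto (h.tendsto_average_circ ea eb hi w.im) ?_
  filter_upwards [(tendsto_natCast_atTop_atTop (R := ℝ)).eventually_gt_atTop w.re,
    eventually_ge_atTop 1] with n hn hn1
  have hn1' : (1 : ℝ) ≤ n := by exact_mod_cast hn1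
  have hn0 : (0 : ℝ) < n := by linarith
  have h1 := (abs_le.1 (hz.average_circ_bounds h hw hn hn1')).2
  have hs1 : w.re / n ≤ 1 := by rw [div_le_one hn0]; exact hn.le
  have hs0 : 0 ≤ w.re / n := by positivity
  have h2 := intervalIntegral.norm_integral_le_of_norm_le_const (a := 1 - w.re / n) (b := 1)
    (f := fun t => profile n (t ^ 2) * (t * circ a b ⟨n, w.im⟩ (n * t) ((n : ℝ) ^ 5 * t)))
    (C := 2 * E) (fun t ht => by
      rw [Set.uIoc_of_le (by linarith)] at ht
      have ht0 : 0 ≤ t := by linarith [ht.1]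
      have := h.abs_circ_le ⟨n, w.im⟩ hn0 (by positivity : (0 : ℝ) < (n : ℝ) ^ 5) ht0
      rw [Real.norm_eq_abs, abs_mul, abs_mul, abs_of_nonneg (profile_nonneg _ _), abs_of_nonneg ht0]
      calc _ ≤ 1 * (1 * (2 * E)) := by
            gcongr
            · exact profile_le_one _ _
            · exact ht.2
        _ = 2 * E := by ring)
  rw [sub_sub_cancel, abs_of_nonneg hs0, Real.norm_eq_abs] at h2
  have h3 := mul_le_mul_of_nonneg_left ((le_abs_self _).trans h2) hn0.le
  have h4 : (n : ℝ) * (2 * E * (w.re / n)) = 2 * E * w.re := by field_simp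
  linarith

/-- The momentum is the degree times twice pi times the distance of the zero to the axis. -/
theorem HalfZero.abs_momentum_sub_le (hz : HalfZero a b w) (h : FiniteEnergy a b E)
    (ea : Even1 a) (eb : Even1 b) (hi : Integrable (mom a b)) {s d : ℝ} (hs : 0 < s)
    (hs2 : s < w.re) (hd : wnd a b w s s = d) :
    |(1 / 2 * ∫ z, mom a b z) - d * w.re| ≤ ((8 + 40 * E) * E + 2 * E)
      + ((8 + 20 * (2 * E + |d|)) * E + (2 * E + |d|)) := by
  have hw : 0 < w.re := hs.trans hs2
  have t0 : Tendsto (fun n : ℕ => (n : ℝ) * ∫ t in (1 - w.re / n)..1, profile n (t ^ 2) * t) atTop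
      (nhds w.re) := by
    have l1 : Tendsto (fun n : ℕ => (w.re - 2 / (n : ℝ)) * (1 - w.re / n)) atTop
        (nhds ((w.re - 0) * (1 - 0))) :=
      (tendsto_const_nhds.sub (tendsto_const_div_atTop_nhds_zero_nat _)).mul
        (tendsto_const_nhds.sub (tendsto_const_div_atTop_nhds_zero_nat _))
    rw [sub_zero, sub_zero, mul_one] at l1
    refine tendsto_of_tendsto_of_tendsto_of_le_of_le' l1 tendsto_const_nhds ?_ ?_
    · filter_upwards [(tendsto_natCast_atTop_atTop (R := ℝ)).eventually_gt_atTop w.re,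
        (tendsto_natCast_atTop_atTop (R := ℝ)).eventually_ge_atTop (2 / w.re),
        eventually_ge_atTop 2] with n hn hn2 hn1
      have hn1' : (2 : ℝ) ≤ n := by exact_mod_cast hn1
      have hn0 : (0 : ℝ) < n := by linarith
      have hs1 : w.re / n ≤ 1 := by rw [div_le_one hn0]; exact hn.le
      have h5 := (div_le_iff₀ hw).1 hn2
      have := mul_le_mul_of_nonneg_left (le_integral_profile_mul_id (n := n) (s := 1 - w.re / n)
        (by nlinarith) (by linarith) (by
          have : 2 / (n : ℝ) ^ 2 ≤ w.re / n := by
            rw [div_le_div_iff₀ (by positivity) hn0]; nlinarith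
          linarith)) hn0.le
      refine le_trans (le_of_eq ?_) this
      field_simp
      ring
    · filter_upwards [(tendsto_natCast_atTop_atTop (R := ℝ)).eventually_gt_atTop w.re] with n hn
      have hn0 : (0 : ℝ) < n := by linarith
      have hs1 : w.re / n ≤ 1 := by rw [div_le_one hn0]; exact hn.le
      have hs0 : 0 ≤ w.re / n := by positivity
      have := mul_le_mul_of_nonneg_left (integral_profile_mul_id_le n (s := 1 - w.re / n)
        (by linarith) (by linarith)) hn0.le
      rwa [sub_sub_cancel, mul_div_cancel₀ _ hn0.ne'] at this
  have t1 := ((h.tendsto_average_circ ea eb hi w.im).sub (t0.const_mul d)).abs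
  refine le_of_tendsto t1 ?_
  filter_upwards [(tendsto_natCast_atTop_atTop (R := ℝ)).eventually_gt_atTop w.re,
    eventually_ge_atTop 1] with n hn hn1
  have hn1' : (1 : ℝ) ≤ n := by exact_mod_cast hn1
  have hn0 : (0 : ℝ) < n := by linarith
  have h1 := hz.average_circ_bounds h hw.le hn hn1'
  have hs1 : w.re / n ≤ 1 := by rw [div_le_one hn0]; exact hn.le
  have hs0 : 0 ≤ w.re / n := by positivity
  have hM : (n : ℝ) ≤ (n : ℝ) ^ 5 := le_self_pow₀ hn1' (by norm_num)
  have hr' : ∀ r ∈ Set.Ioo (1 - w.re / n) 1, (n : ℝ) - w.re < n * r := fun r hr => by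
    have := mul_lt_mul_of_pos_left hr.1 hn0
    rwa [mul_sub, mul_one, mul_div_cancel₀ _ hn0.ne'] at this
  have h2 := h.abs_slice_le ⟨n, w.im⟩ (T := n) (M := (n : ℝ) ^ 5) (s := 1 - w.re / n) (t := 1)
    (d := d) (K := 2 * E + |d|) hn1' hM (by linarith) (by linarith) le_rfl le_rfl
    (fun r hr θ => by
      have := hz.homotopy_pos (μ := 0) hn (by positivity : (0 : ℝ) < (n : ℝ) ^ 5)
        (by linarith [hr.1]) hr.2 (hr' r hr) hs hs2 le_rfl zero_le_one θ
      simpa using this)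
    (fun r hr => by
      rw [← hd]
      exact hz.wnd_ellipse h.sa h.sb hn (by positivity) (by linarith [hr.1]) hr.2 (hr' r hr) hs hs2)
    (κ := fun t => profile n (t ^ 2)) (by fun_prop) (fun r => profile_nonneg _ _)
    (fun r => profile_le_one _ _)
  exact (abs_sub_le _ _ _).trans (add_le_add h1 h2)

end MomentumBounds

theorem Even1.en {a b : ℂ → ℝ} (ea : Even1 a) (eb : Even1 b) (ha : Smooth a) (hb : Smooth b) :
    Even1 (en a b) := fun z => by
  unfold _root_.en gsq eta
  rw [ea.dx ha, eb.dx hb, ea.dy ha, eb.dy hb, ea z, eb z]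
  ring

section Lower
variable {a b : ℂ → ℝ} {E : ℝ} {w : ℂ}

theorem HalfZero.le_ringInt_en (hz : HalfZero a b w) (ha : Smooth a) (hb : Smooth b) {k d s : ℝ}
    (hk : 0 ≤ k) (hd : 2 * Real.pi * k ≤ |d|) (hwd : wnd a b w s s = d) (hs : 1 ≤ s)
    (hs2 : s < w.re) :
    Real.pi * k ^ 2 / (s + 5 * Real.pi * k ^ 2) ≤ s * ringInt (en a b) w s s := by
  have h1 := (puncturedLoop_ell ha hb (hz.circle_pos (by linarith) hs2)).le_loopEnergy hs hk
    (by change _ ≤ |wnd a b w s s|; rw [hwd]; exact hd)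
  refine h1.trans (loopEnergy_ell_le ha hb hs ?_ ?_) <;> rw [abs_of_nonneg (by linarith)]

theorem setIntegral_ball_ge {f : ℂ → ℝ} (hf : Continuous f) (hi : Integrable f)
    (h0 : ∀ z, 0 ≤ f z) (w : ℂ) {s t : ℝ} (hs : 0 ≤ s) (hst : s ≤ t) :
    ∫ r in s..t, r * ringInt f w r r ≤ ∫ z in ball w t, f z := by
  rw [← integral_indicator measurableSet_ball]
  have hm : Measurable ((ball w t).indicator f) := hf.measurable.indicator measurableSet_ball
  have h1 := intervalIntegral_ringInt_le hm (hi.indicator measurableSet_ball)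
    (Set.indicator_nonneg fun z _ => h0 z) w one_pos one_pos hs hst
  refine le_trans (le_of_eq ?_) h1
  rw [intervalIntegral.integral_of_le hst, intervalIntegral.integral_of_le hst,
    integral_Ioc_eq_integral_Ioo, integral_Ioc_eq_integral_Ioo]
  refine setIntegral_congr_fun measurableSet_Ioo fun r hr => ?_
  simp only [one_mul]
  congr 1
  unfold ringInt
  congr 1; funext θ
  rw [Set.indicator_of_mem]
  have hr0 : 0 ≤ r := hs.trans hr.1.le
  rw [mem_ball, Complex.dist_eq_re_im]
  simp only [ell_re, ell_im, add_sub_cancel_left]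
  rw [mul_pow, mul_pow, ← mul_add, Real.cos_sq_add_sin_sq, mul_one, Real.sqrt_sq hr0]
  exact hr.2

/-- A vortex forces a logarithmic amount of energy. -/
theorem HalfZero.log_le_energy (hz : HalfZero a b w) (h : FiniteEnergy a b E) {k d : ℝ}
    (hk : 0 ≤ k) (hd : 2 * Real.pi * k ≤ |d|) (hw : 1 ≤ w.re)
    (hwd : ∀ s, 0 < s → s < w.re → wnd a b w s s = d) :
    Real.pi * k ^ 2 * (Real.log w.re - Real.log (1 + 5 * Real.pi * k ^ 2))
      ≤ ∫ z in ball w w.re, en a b z := by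
  have hpi := Real.pi_pos
  have cE := (h.sa.en h.sb).continuous
  refine le_trans ?_ (setIntegral_ball_ge cE h.int (en_nonneg a b) w zero_le_one hw)
  set B := 5 * Real.pi * k ^ 2 with hB
  have hB0 : 0 ≤ B := by positivity
  have cR : Continuous fun r => r * ringInt (en a b) w r r := by
    have := continuous_ringInt cE (X := ℝ) (w := fun _ => w) (α := fun s => s)
      (β := fun s => s) (by fun_prop) (by fun_prop) (by fun_prop)
    fun_prop
  have h1 : ∫ s in (1 : ℝ)..w.re, Real.pi * k ^ 2 * (s + B)⁻¹
      = Real.pi * k ^ 2 * (Real.log (w.re + B) - Real.log (1 + B)) := by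
    rw [intervalIntegral.integral_const_mul, intervalIntegral.integral_comp_add_right
      (fun x => x⁻¹), integral_inv_of_pos (by linarith) (by linarith),
      Real.log_div (by linarith) (by linarith)]
  have h2 : Real.log w.re ≤ Real.log (w.re + B) := Real.log_le_log (by linarith) (by linarith)
  calc _ ≤ Real.pi * k ^ 2 * (Real.log (w.re + B) - Real.log (1 + B)) := by gcongr
    _ = _ := h1.symm
    _ ≤ _ := ?_
  have ci : IntervalIntegrable (fun s => Real.pi * k ^ 2 * (s + B)⁻¹) volume 1 w.re := by
    refine ContinuousOn.intervalIntegrable fun s hs => ContinuousAt.continuousWithinAt ?_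
    rw [Set.uIcc_of_le hw] at hs
    have : s + B ≠ 0 := by linarith [hs.1]
    fun_prop (disch := assumption)
  refine intervalIntegral.integral_mono_ae_restrict hw ci (cR.intervalIntegrable _ _) ?_
  refine (ae_restrict_iff' measurableSet_Icc).2 ?_
  filter_upwards [compl_mem_ae_iff.2 (measure_singleton w.re)] with s hs hs2
  have hs3 : s < w.re := lt_of_le_of_ne hs2.2 hs
  have := hz.le_ringInt_en h.sa h.sb hk hd (hwd s (by linarith [hs2.1]) hs3) hs2.1 hs3
  rwa [div_eq_mul_inv] at this

theorem ball_subset_re_pos (w : ℂ) : ball w w.re ⊆ {z : ℂ | 0 < z.re} := fun z hz => by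
  rw [mem_ball, dist_eq_norm] at hz
  have := (abs_le.1 (Complex.abs_re_le_norm (z - w))).1
  simp only [Complex.sub_re] at this
  change 0 < z.re
  linarith

theorem FiniteEnergy.integral_ball_le (h : FiniteEnergy a b E) (ea : Even1 a) (eb : Even1 b)
    (w : ℂ) : ∫ z in ball w w.re, en a b z ≤ E / 2 := by
  have h1 := (ea.en eb h.sa h.sb).integral_re_pos h.int
  have h2 := h.le
  have h3 : ∫ z in ball w w.re, en a b z ≤ ∫ z in {z : ℂ | 0 < z.re}, en a b z :=
    setIntegral_mono_set h.int.integrableOn (Eventually.of_forall (en_nonneg a b))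
      (ball_subset_re_pos w).eventuallyLE
  linarith

/-- The energy outside of the two half balls. -/
theorem FiniteEnergy.integral_far_le (h : FiniteEnergy a b E) (ea : Even1 a) (eb : Even1 b)
    (w : ℂ) {r : ℝ} (hr : 2 * w.re ≤ r) (hw : 0 ≤ w.re) :
    ∫ z in {z : ℂ | r ≤ ‖z - ⟨0, w.im⟩‖}, en a b z ≤ E - 2 * ∫ z in ball w w.re, en a b z := by
  have hS : MeasurableSet {z : ℂ | r ≤ ‖z - ⟨0, w.im⟩‖} :=
    measurableSet_le measurable_const (by fun_prop)
  have hm : MeasurableSet {z : ℂ | 0 < z.re} :=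
    measurableSet_lt measurable_const Complex.measurable_re
  have em := ea.en eb h.sa h.sb
  have eS : Even1 ({z : ℂ | r ≤ ‖z - ⟨0, w.im⟩‖}.indicator (en a b)) := fun z => by
    have : ‖mirror z - ⟨0, w.im⟩‖ = ‖z - ⟨0, w.im⟩‖ := by
      have e : mirror z - ⟨0, w.im⟩ = mirror (z - ⟨0, w.im⟩) := by
        apply Complex.ext <;> simp
        ring
      rw [e, LinearIsometryEquiv.norm_map]
    by_cases hz : z ∈ {z : ℂ | r ≤ ‖z - ⟨0, w.im⟩‖}
    · rw [Set.indicator_of_mem hz, Set.indicator_of_mem, em z]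
      rw [Set.mem_ofPred_eq, this]; exact hz
    · rw [Set.indicator_of_notMem hz, Set.indicator_of_notMem]
      rw [Set.mem_ofPred_eq, this]; exact hz
  have h1 := eS.integral_re_pos (h.int.indicator hS)
  have h2 := em.integral_re_pos h.int
  have h3 := h.le
  rw [← integral_indicator hS]
  have h4 : (∫ z in {z : ℂ | 0 < z.re}, {z : ℂ | r ≤ ‖z - ⟨0, w.im⟩‖}.indicator (en a b) z)
      + ∫ z in {z : ℂ | 0 < z.re}, (ball w w.re).indicator (en a b) z
      ≤ ∫ z in {z : ℂ | 0 < z.re}, en a b z := by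
    rw [← integral_add (h.int.indicator hS).integrableOn
      (h.int.indicator measurableSet_ball).integrableOn]
    refine setIntegral_mono ((h.int.indicator hS).add
      (h.int.indicator measurableSet_ball)).integrableOn h.int.integrableOn fun z => ?_
    simp only
    have h0 := en_nonneg a b z
    by_cases hz : z ∈ {z : ℂ | r ≤ ‖z - ⟨0, w.im⟩‖}
    · have hzb : z ∉ ball w w.re := by
        intro hb
        rw [mem_ball, dist_eq_norm] at hb
        have h5 : ‖w - ⟨0, w.im⟩‖ = w.re := by
          have : w - ⟨0, w.im⟩ = (w.re : ℂ) := by apply Complex.ext <;> simp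
          rw [this, Complex.norm_real, Real.norm_of_nonneg hw]
        have h6 := norm_sub_le_norm_sub_add_norm_sub z w ⟨0, w.im⟩
        have h7 : r ≤ ‖z - ⟨0, w.im⟩‖ := hz
        linarith
      rw [Set.indicator_of_notMem hzb, Set.indicator_of_mem hz, add_zero]
    · rw [Set.indicator_of_notMem hz, zero_add]
      exact Set.indicator_le_self' (fun _ _ => h0) z
  have h8 : ∫ z in {z : ℂ | 0 < z.re}, (ball w w.re).indicator (en a b) z
      = ∫ z in ball w w.re, en a b z := by
    rw [setIntegral_indicator measurableSet_ball, Set.inter_eq_right.2 (ball_subset_re_pos w)]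
  rw [h8] at h4
  linarith

end Lower

section Speed
variable {a b : ℂ → ℝ} {E c : ℝ} {w : ℂ}

theorem integral_bump_cur_eq (ha : Smooth a) (hb : Smooth b) {ψ : ℂ → ℝ} (hψ : Smooth ψ)
    (hc : HasCompactSupport ψ) :
    ∫ z, (dx ψ z * cur2 a b z - dy ψ z * cur1 a b z) = 2 * ∫ z, ψ z * jac a b z := by
  have z1 : ∫ z, dx (fun z => ψ z * cur2 a b z) z = 0 :=
    integral_dx_eq_zero (by fun_prop) hc.mul_right
  have z2 : ∫ z, dy (fun z => ψ z * cur1 a b z) z = 0 :=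
    integral_dy_eq_zero (by fun_prop) hc.mul_right
  have i3 : Integrable (dx (fun z => ψ z * cur2 a b z)) :=
    (hψ.mul (ha.cur2 hb)).dx.continuous.integrable_of_hasCompactSupport
      (HasCompactSupport.dx hc.mul_right)
  have i4 : Integrable (dy (fun z => ψ z * cur1 a b z)) :=
    (hψ.mul (ha.cur1 hb)).dy.continuous.integrable_of_hasCompactSupport
      (HasCompactSupport.dy hc.mul_right)
  have i5 : Integrable fun z => dx (fun z => ψ z * cur2 a b z) z
      - dy (fun z => ψ z * cur1 a b z) z := i3.sub i4
  have i6 : Integrable fun z => 2 * (ψ z * jac a b z) :=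
    (integrable_mul_of_hasCompactSupport hψ.continuous hc (ha.jac hb).continuous).const_mul 2
  have e : ∀ z, dx ψ z * cur2 a b z - dy ψ z * cur1 a b z
      = (dx (fun z => ψ z * cur2 a b z) z - dy (fun z => ψ z * cur1 a b z) z)
        + 2 * (ψ z * jac a b z) := by
    intro z
    have h1 := curl_cur ha hb z
    simp (disch := fun_prop) only [dx_mul, dy_mul]
    linear_combination -(ψ z) * h1
  simp_rw [e]
  rw [integral_add i5 i6, integral_sub i3 i4, z1, z2, integral_const_mul]
  ring

theorem GP.abs_stress_le (h : GP c a b) (hE : FiniteEnergy a b E) {ψ : ℂ → ℝ} (hψ : Smooth ψ)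
    (hc : HasCompactSupport ψ) (h1 : ∀ z, |dx ψ z| ≤ 1) (h2 : ∀ z, |dy ψ z| ≤ 1) :
    |c * ∫ z, ψ z * jac a b z| ≤ 2 * E := by
  have ha := h.sa
  have hb := h.sb
  rw [h.stress_fst hψ hc]
  refine abs_integral_le_integral_abs.trans ?_
  have h3 : ∫ z, 2 * en a b z ≤ 2 * E := by rw [integral_const_mul]; linarith [hE.le]
  refine le_trans (integral_mono_of_nonneg (Eventually.of_forall fun z => abs_nonneg _)
    (hE.int.const_mul 2) (Eventually.of_forall fun z => ?_)) h3
  simp only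
  refine (abs_add_le _ _).trans ?_
  rw [abs_mul, abs_mul]
  have e1 : |(dx a z ^ 2 + dx b z ^ 2 - dy a z ^ 2 - dy b z ^ 2) / 2 - eta a b z ^ 2 / 4|
      ≤ gsq a b z / 2 + eta a b z ^ 2 / 4 := by
    unfold gsq
    rw [abs_le]; constructor <;> nlinarith [sq_nonneg (dx a z), sq_nonneg (dx b z),
      sq_nonneg (dy a z), sq_nonneg (dy b z), sq_nonneg (eta a b z)]
  have e2 : |dx a z * dy a z + dx b z * dy b z| ≤ gsq a b z / 2 := by
    unfold gsq
    rw [abs_le]; constructor <;>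
      nlinarith [sq_nonneg (dx a z + dy a z), sq_nonneg (dx b z + dy b z),
      sq_nonneg (dx a z - dy a z), sq_nonneg (dx b z - dy b z)]
  have e3 := mul_le_mul (h1 z) e1 (abs_nonneg _) zero_le_one
  have e4 := mul_le_mul (h2 z) e2 (abs_nonneg _) zero_le_one
  have e5 := sq_nonneg (eta a b z)
  unfold en
  linarith

/-- The speed is bounded by the energy over the distance of the vortices. -/
theorem GP.speed_mul_le (h : GP c a b) (hE : FiniteEnergy a b E) (hz : HalfZero a b w)
    (hc : 0 ≤ c) (hw : 1 ≤ w.re)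
    (hwd : ∀ s, 0 < s → s < w.re → wnd a b w s s = 2 * Real.pi) :
    c * (Real.pi * w.re / 8 - ((8 + 20 * (2 * E + 2 * Real.pi)) * E + (2 * E + 2 * Real.pi)))
      ≤ 4 * E := by
  have hpi := Real.pi_pos
  have ha := h.sa
  have hb := h.sb
  have hw0 : 0 < w.re := by linarith
  have hψ := Smooth.bump 2 w w.re w.re
  have hcs := hasCompactSupport_bump 2 w hw0 hw0
  have h1 := integral_bump_flux 2 w hw0 hw0 (ha.cur1 hb).continuous (ha.cur2 hb).continuous
  rw [integral_bump_cur_eq ha hb hψ hcs] at h1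
  have h2 := h.abs_stress_le hE hψ hcs (abs_dx_bump_le 2 w hw0) (fun z => by
    have := abs_dy_bump_le 2 w hw0 hw0 z
    rwa [div_self hw0.ne'] at this)
  have hr : ∀ r ∈ Set.Ioo (0 : ℝ) 1, 0 < w.re * r ∧ w.re * r < w.re := fun r hr =>
    ⟨mul_pos hw0 hr.1, by nlinarith [hr.2]⟩
  have h3 := hE.abs_slice_le w (T := w.re) (M := w.re) (s := 0) (t := 1) (d := 2 * Real.pi)
    (K := 2 * E + 2 * Real.pi) hw le_rfl le_rfl zero_le_one le_rfl
    (by rw [abs_of_pos (by positivity)])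
    (fun r hr' θ => hz.circle_pos (hr r hr').1 (hr r hr').2 θ)
    (fun r hr' => hwd _ (hr r hr').1 (hr r hr').2)
    (κ := fun t => profile 2 (t ^ 2)) (by fun_prop) (fun r => profile_nonneg _ _)
    (fun r => profile_le_one _ _)
  unfold circ at h3
  set S := w.re * ∫ t in (0 : ℝ)..1, profile 2 (t ^ 2) * (t * ∫ θ in (-Real.pi)..Real.pi,
        (-(w.re * t) * Real.sin θ * cur1 a b (ell w (w.re * t) (w.re * t) θ)
          + w.re * t * Real.cos θ * cur2 a b (ell w (w.re * t) (w.re * t) θ)))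
  have h4 : 1 / 16 ≤ ∫ t in (0 : ℝ)..1, profile 2 (t ^ 2) * t := by
    have c : Continuous fun t => profile 2 (t ^ 2) * t := by fun_prop
    rw [← intervalIntegral.integral_add_adjacent_intervals (b := 1 / 4)
      (c.intervalIntegrable _ _) (c.intervalIntegrable _ _)]
    have h5 : 0 ≤ ∫ t in (0 : ℝ)..(1 / 4), profile 2 (t ^ 2) * t :=
      intervalIntegral.integral_nonneg (by norm_num) fun t ht =>
        mul_nonneg (profile_nonneg _ _) ht.1
    have h6 := le_integral_profile_mul_id (n := 2) (s := 1 / 4) (by norm_num) (by norm_num)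
      (by norm_num)
    norm_num at h6 ⊢
    linarith
  have h5 := (abs_le.1 h3).1
  have h6 : 2 * Real.pi * (w.re * (1 / 16)) ≤ 2 * Real.pi * (w.re * ∫ t in (0 : ℝ)..1,
    profile 2 (t ^ 2) * t) := by gcongr
  have h7 := (abs_le.1 h2).1
  have h8 : ∫ z, bump 2 w w.re w.re z * jac a b z = -S / 2 := by linarith
  rw [h8] at h7
  have h9 : c * (Real.pi * w.re / 8 - ((8 + 20 * (2 * E + 2 * Real.pi)) * E
    + (2 * E + 2 * Real.pi))) ≤ c * S := by
    refine mul_le_mul_of_nonneg_left ?_ hc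
    linarith
  linarith

end Speed

theorem eventually_sq_log_le (A B : ℝ) {ε : ℝ} (hε : 0 < ε) :
    ∀ᶠ p : ℝ in atTop, (A * Real.log p + B) ^ 2 ≤ ε * p := by
  have h1 := (Real.isLittleO_pow_log_id_atTop (n := 2)).bound
    (show 0 < ε / (4 * A ^ 2 + 1) by positivity)
  filter_upwards [h1, eventually_ge_atTop (4 * B ^ 2 / ε), eventually_gt_atTop 0] with p h2 h3 h4
  rw [Real.norm_of_nonneg (sq_nonneg _), id, Real.norm_of_nonneg h4.le, div_mul_eq_mul_div,
    le_div_iff₀ (by positivity)] at h2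
  rw [div_le_iff₀ hε] at h3
  nlinarith [sq_nonneg (A * Real.log p - B), sq_nonneg (Real.log p)]

/-- The energy allowed for momentum `p`. -/
def energyBound (Λ p : ℝ) : ℝ := 2 * Real.pi * Real.log p + Λ

/-- The bound on the energy away from the vortices. -/
def farBound (Λ : ℝ) : ℝ := Λ + 2 * Real.pi * Real.log (8 * (1 + 5 * Real.pi))

theorem degree_eq_one {p E Λ x L k C₁ : ℝ} {n : ℤ} (hp : 0 < p) (hx1 : 1 ≤ x) (hxp : p ≤ 4 * E * x)
    (hE : E = energyBound Λ p) (hE0 : 0 < E) (hC : C₁ = ((8 + 40 * E) * E + 2 * E)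
      + ((8 + 20 * (2 * E + 2 * Real.pi)) * E + (2 * E + 2 * Real.pi))) (hC1 : C₁ < p)
    (hL : L = Real.log x)
    (hk : k = Real.log (1 + 20 * Real.pi))
    (hbig : (4 * E * (1 + 20 * Real.pi)) ^ 2 ≤ p) (hΛ : Λ / 2 < Real.pi * Real.log p)
    (hmom : ∀ d : ℝ, d = 2 * Real.pi * n → |p - d * x| ≤ ((8 + 40 * E) * E + 2 * E)
      + ((8 + 20 * (2 * E + |d|)) * E + (2 * E + |d|)))
    (hlog : 2 ≤ |n| → 4 * Real.pi * (L - k) ≤ E / 2) : n = 1 := by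
  have hpi := Real.pi_pos
  by_contra hn1
  by_cases h2 : 2 ≤ |n|
  · have h3 := hlog h2
    have h4 : Real.log p ≤ Real.log (4 * E * x) := Real.log_le_log hp hxp
    rw [Real.log_mul (by positivity) (by positivity)] at h4
    have h5 : Real.log ((4 * E * (1 + 20 * Real.pi)) ^ 2) ≤ Real.log p :=
      Real.log_le_log (by positivity) hbig
    rw [Real.log_pow, Real.log_mul (by positivity) (by positivity)] at h5
    push_cast at h5
    rw [hE, energyBound] at h3
    rw [← hL] at h4
    rw [← hk] at h5
    nlinarith
  · have h3 : n = 0 ∨ n = -1 := by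
      push Not at h2
      rw [abs_lt] at h2
      omega
    rcases h3 with rfl | rfl
    · have h4 := (abs_le.1 (hmom 0 (by simp))).2
      rw [abs_zero] at h4
      have : 0 ≤ 20 * (2 * Real.pi) * E := by positivity
      nlinarith
    · have h4 := (abs_le.1 (hmom (-(2 * Real.pi)) (by push_cast; ring))).2
      rw [abs_neg, abs_of_pos (by positivity : 0 < 2 * Real.pi)] at h4
      have : 0 ≤ 2 * Real.pi * x := by positivity
      linarith

theorem momentum_error_le {E p q : ℝ} (hE : 0 < E) (hq4 : q ≤ 4)
    (h : 400 * (E + 1) ^ 2 ≤ 1 / 64 * p) :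
    ((8 + 40 * E) * E + 2 * E) + ((8 + 20 * (2 * E + 2 * q)) * E + (2 * E + 2 * q)) ≤ p / 64 := by
  have h1 : q * E ≤ 4 * E := mul_le_mul_of_nonneg_right hq4 hE.le
  nlinarith

theorem half_distance_bounds {p q x C : ℝ} (hx : 0 < x) (hq3 : 3 < q)
    (hq : q < 3.15) (hC : C ≤ p / 64) (h1 : -C ≤ p - 2 * q * x) (h2 : p - 2 * q * x ≤ C) :
    p / 8 ≤ x ∧ x ≤ p / 4 ∧ p / 64 ≤ q * x / 8 - p / 64 := by
  have h3 : 3 * x ≤ q * x := mul_le_mul_of_nonneg_right hq3.le hx.le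
  have h4 : q * x ≤ 3.15 * x := mul_le_mul_of_nonneg_right hq.le hx.le
  norm_num at h4
  refine ⟨by linarith, by linarith, by linarith⟩

/-- Location of the vortices, concentration of the energy and smallness of the speed. -/
theorem eventually_concentrated (Λ : ℝ) (hΛ : 0 < Λ) :
    ∀ᶠ p : ℝ in atTop, ∀ (a b : ℂ → ℝ) (w : ℂ), FiniteEnergy a b (energyBound Λ p) →
      Even1 a → Even1 b → Integrable (mom a b) → 1 / 2 * ∫ z, mom a b z = p →
      HalfZero a b w → 0 ≤ w.re →
      ∫ z in {z : ℂ | p / 2 ≤ ‖z - ⟨0, w.im⟩‖}, en a b z ≤ farBound Λ ∧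
      w.re ≤ p / 4 ∧
      ∀ c, GP c a b → 0 ≤ c → c * p ≤ 256 * energyBound Λ p := by
  have hpi := Real.pi_pos
  filter_upwards [eventually_gt_atTop 1,
    eventually_sq_log_le (20 * (2 * Real.pi)) (20 * (Λ + 1)) (show 0 < 1 / 64 by norm_num),
    eventually_sq_log_le (4 * (1 + 20 * Real.pi) * (2 * Real.pi))
      (4 * (1 + 20 * Real.pi) * Λ) one_pos,
    (Real.tendsto_log_atTop.const_mul_atTop hpi).eventually_gt_atTop (Λ / 2)]
    with p hp1 he1 he2 he3 a b w h ea eb hi hm hz hw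
  have hlog : 0 < Real.log p := Real.log_pos hp1
  set E := energyBound Λ p with hE
  have hE' : E = 2 * Real.pi * Real.log p + Λ := rfl
  have hE0 : 0 < E := by rw [hE']; positivity
  have hp0 : 0 < p := by linarith
  have he1' : 400 * (E + 1) ^ 2 ≤ 1 / 64 * p := by
    refine le_trans (le_of_eq ?_) he1
    rw [hE']; ring
  have he2' : (4 * E * (1 + 20 * Real.pi)) ^ 2 ≤ p := by
    refine le_trans (le_of_eq ?_) (he2.trans_eq (one_mul p))
    rw [hE']; ring
  set C₁ := ((8 + 40 * E) * E + 2 * E)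
      + ((8 + 20 * (2 * E + 2 * Real.pi)) * E + (2 * E + 2 * Real.pi)) with hC₁
  have hC : C₁ ≤ p / 64 := momentum_error_le hE0 Real.pi_lt_four.le he1'
  have hC2 : (8 + 20 * (2 * E + 2 * Real.pi)) * E + (2 * E + 2 * Real.pi) ≤ p / 64 :=
    le_trans (le_add_of_nonneg_left (by positivity)) hC
  have hx : p ≤ 4 * E * w.re := by
    have := hz.momentum_le h ea eb hi hw
    rw [hm] at this
    nlinarith
  have hx1 : 1 < w.re := by
    by_contra! hle
    have : 4 * E * w.re ≤ 4 * E := by nlinarith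
    nlinarith
  have hwd := fun s (hs : 0 < s) (hs2 : s < w.re) =>
    hz.wnd_circle h.sa h.sb hs hs2 one_pos hx1
  obtain ⟨n, hn⟩ := (puncturedLoop_ell h.sa h.sb (hz.circle_pos one_pos hx1)).exists_argVar_eq
  change wnd a b w 1 1 = 2 * Real.pi * n at hn
  rw [hn] at hwd
  have hn1 : n = 1 := by
    refine degree_eq_one hp0 hx1.le hx hE hE0 hC₁ (by linarith) rfl rfl he2' he3 ?_ fun h2 => ?_
    · intro d hd
      have := hz.abs_momentum_sub_le h ea eb hi one_pos hx1 (hn.trans hd.symm)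
      rwa [hm] at this
    · have h3 : (2 : ℝ) ≤ |(n : ℝ)| := by exact_mod_cast h2
      have h4 := hz.log_le_energy h (k := 2) (by norm_num) (by
        rw [abs_mul, abs_of_pos (by positivity : 0 < 2 * Real.pi)]; gcongr) hx1.le hwd
      have h5 := h.integral_ball_le ea eb w
      refine le_trans (le_of_eq ?_) (h4.trans h5)
      rw [show 5 * Real.pi * 2 ^ 2 = 20 * Real.pi by ring]; ring
  rw [hn1] at hwd
  simp only [Int.cast_one, mul_one] at hwd
  have hmm := hz.abs_momentum_sub_le h ea eb hi one_pos hx1 (hwd 1 one_pos hx1)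
  rw [hm, abs_of_pos (by positivity : 0 < 2 * Real.pi)] at hmm
  change _ ≤ C₁ at hmm
  obtain ⟨hm1, hm2⟩ := abs_le.1 hmm
  obtain ⟨hlow, hup, hq⟩ := half_distance_bounds (one_pos.trans hx1) Real.pi_gt_three
    (Real.pi_lt_d2.trans_eq (by norm_num)) hC hm1 hm2
  refine ⟨?_, hup, fun c hgp hc => ?_⟩
  · have h1 := h.integral_far_le ea eb w (r := p / 2) (by linarith) hw
    have h2 := hz.log_le_energy h (k := 1) zero_le_one (d := 2 * Real.pi) (by
      rw [mul_one]; exact le_abs_self _) hx1.le hwd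
    have h3 : Real.log (p / 8) ≤ Real.log w.re := Real.log_le_log (by positivity) hlow
    rw [Real.log_div (by positivity) (by norm_num)] at h3
    rw [farBound, Real.log_mul (by norm_num) (by positivity)]
    rw [one_pow, mul_one, mul_one] at h2
    rw [hE'] at h1
    have h4 : Real.pi * (Real.log p - Real.log 8 - Real.log (1 + 5 * Real.pi))
      ≤ ∫ z in ball w w.re, en a b z := by
      refine le_trans ?_ h2
      gcongr
    linarith
  · have h1 := hgp.speed_mul_le h hz hc hx1.le hwd
    have h2 : c * (p / 64) ≤ c * (Real.pi * w.re / 8 - ((8 + 20 * (2 * E + 2 * Real.pi)) * E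
        + (2 * E + 2 * Real.pi))) := by
      exact mul_le_mul_of_nonneg_left (hq.trans (sub_le_sub_left hC2 _)) hc
    linarith

theorem integrable_of_compactSupport {f : ℂ → ℝ} (hf : Smooth f) (h : HasCompactSupport f) :
    Integrable f := hf.continuous.integrable_of_hasCompactSupport h

theorem abs_coord_mul_le {x y ε p q : ℝ} (h1 : |x * p| ≤ ε) (h2 : |x * q| ≤ ε) (h3 : |y * p| ≤ ε)
    (h4 : |y * q| ≤ ε) {χ η : ℝ} (a1 a2 b1 b2 : ℝ) :
    χ * η ^ 2 / 2
      + ((χ + x * p) * ((a1 ^ 2 + b1 ^ 2 - a2 ^ 2 - b2 ^ 2) / 2 - η ^ 2 / 4)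
        + x * q * (a1 * a2 + b1 * b2))
      + ((χ + y * q) * ((a2 ^ 2 + b2 ^ 2 - a1 ^ 2 - b1 ^ 2) / 2 - η ^ 2 / 4)
        + y * p * (a1 * a2 + b1 * b2))
      ≤ 4 * ε * ((a1 ^ 2 + a2 ^ 2 + b1 ^ 2 + b2 ^ 2) / 2 + η ^ 2 / 4) := by
  have e1 : |(a1 ^ 2 + b1 ^ 2 - a2 ^ 2 - b2 ^ 2) / 2 - η ^ 2 / 4|
      ≤ (a1 ^ 2 + a2 ^ 2 + b1 ^ 2 + b2 ^ 2) / 2 + η ^ 2 / 4 := by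
    rw [abs_le]; constructor <;> nlinarith [sq_nonneg a1, sq_nonneg a2, sq_nonneg b1, sq_nonneg b2,
      sq_nonneg η]
  have e2 : |(a2 ^ 2 + b2 ^ 2 - a1 ^ 2 - b1 ^ 2) / 2 - η ^ 2 / 4|
      ≤ (a1 ^ 2 + a2 ^ 2 + b1 ^ 2 + b2 ^ 2) / 2 + η ^ 2 / 4 := by
    rw [abs_le]; constructor <;> nlinarith [sq_nonneg a1, sq_nonneg a2, sq_nonneg b1, sq_nonneg b2,
      sq_nonneg η]
  have e3 : |a1 * a2 + b1 * b2| ≤ (a1 ^ 2 + a2 ^ 2 + b1 ^ 2 + b2 ^ 2) / 2 + η ^ 2 / 4 := by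
    rw [abs_le]; constructor <;> nlinarith [sq_nonneg (a1 + a2), sq_nonneg (b1 + b2),
      sq_nonneg (a1 - a2), sq_nonneg (b1 - b2), sq_nonneg η]
  have hε := (abs_nonneg _).trans h1
  have f1 := mul_le_mul h1 e1 (abs_nonneg _) hε
  have f2 := mul_le_mul h2 e3 (abs_nonneg _) hε
  have f3 := mul_le_mul h4 e2 (abs_nonneg _) hε
  have f4 := mul_le_mul h3 e3 (abs_nonneg _) hε
  rw [← abs_mul] at f1 f2 f3 f4
  have g1 := (le_abs_self _).trans f1
  have g2 := (le_abs_self _).trans f2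
  have g3 := (le_abs_self _).trans f3
  have g4 := (le_abs_self _).trans f4
  linarith

/-- A local Pohozaev inequality. -/
theorem GP.pohozaev_le {c : ℝ} {a b : ℂ → ℝ} (h : GP c a b) (hc : 0 ≤ c) (x₀ : ℂ) {ρ ε C : ℝ}
    {χ : ℂ → ℝ} (hχ : Smooth χ) (h0 : ∀ z, 0 ≤ χ z) (h1 : ∀ z, χ z ≤ 1)
    (hs : tsupport χ ⊆ closedBall x₀ ρ)
    (hxx : ∀ z, |(z.re - x₀.re) * dx χ z| ≤ ε) (hxy : ∀ z, |(z.re - x₀.re) * dy χ z| ≤ ε)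
    (hyx : ∀ z, |(z.im - x₀.im) * dx χ z| ≤ ε) (hyy : ∀ z, |(z.im - x₀.im) * dy χ z| ≤ ε)
    (hC : ∫ z in closedBall x₀ ρ, en a b z ≤ C) (hρ : 0 ≤ ρ) :
    ∫ z, χ z * eta a b z ^ 2 ≤ 2 * (4 * ε + c * ρ) * C := by
  have ha := h.sa
  have hb := h.sb
  have hcs : HasCompactSupport χ := HasCompactSupport.of_support_subset_isCompact
    (isCompact_closedBall x₀ ρ) ((subset_tsupport χ).trans hs)
  have hε : 0 ≤ ε := (abs_nonneg _).trans (hxx 0)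
  set ψ₁ : ℂ → ℝ := fun z => χ z * (z.re - x₀.re) with hψ₁
  set ψ₂ : ℂ → ℝ := fun z => χ z * (z.im - x₀.im) with hψ₂
  have s1 : Smooth ψ₁ := by fun_prop
  have s2 : Smooth ψ₂ := by fun_prop
  have c1 : HasCompactSupport ψ₁ := hcs.mul_right
  have c2 : HasCompactSupport ψ₂ := hcs.mul_right
  have p1 := h.stress_fst s1 c1
  have p2 := h.stress_snd s2 c2
  have d1 : ∀ z, dx ψ₁ z = χ z + (z.re - x₀.re) * dx χ z := fun z => by
    simp (disch := fun_prop) only [hψ₁, dx_mul, dx_sub, dx_re, dx_const]; ring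
  have d2 : ∀ z, dy ψ₁ z = (z.re - x₀.re) * dy χ z := fun z => by
    simp (disch := fun_prop) only [hψ₁, dy_mul, dy_sub, dy_re, dy_const]; ring
  have d3 : ∀ z, dy ψ₂ z = χ z + (z.im - x₀.im) * dy χ z := fun z => by
    simp (disch := fun_prop) only [hψ₂, dy_mul, dy_sub, dy_im, dy_const]; ring
  have d4 : ∀ z, dx ψ₂ z = (z.im - x₀.im) * dx χ z := fun z => by
    simp (disch := fun_prop) only [hψ₂, dx_mul, dx_sub, dx_im, dx_const]; ring
  set A : ℂ → ℝ := fun z =>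
    (dx a z ^ 2 + dx b z ^ 2 - dy a z ^ 2 - dy b z ^ 2) / 2 - eta a b z ^ 2 / 4 with hA
  set B : ℂ → ℝ := fun z =>
    (dy a z ^ 2 + dy b z ^ 2 - dx a z ^ 2 - dx b z ^ 2) / 2 - eta a b z ^ 2 / 4 with hB
  set S : ℂ → ℝ := fun z => dx a z * dy a z + dx b z * dy b z with hS
  have sA : Smooth A := by fun_prop
  have sB : Smooth B := by fun_prop
  have sS : Smooth S := by fun_prop
  change _ = ∫ z, (dx ψ₁ z * A z + dy ψ₁ z * S z) at p1
  change ∫ z, (dy ψ₂ z * B z + dx ψ₂ z * S z) = 0 at p2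
  have i1 : Integrable fun z => dx ψ₁ z * A z + dy ψ₁ z * S z :=
    (integrable_mul_of_hasCompactSupport s1.dx.continuous c1.dx sA.continuous).add
      (integrable_mul_of_hasCompactSupport s1.dy.continuous c1.dy sS.continuous)
  have i2 : Integrable fun z => dy ψ₂ z * B z + dx ψ₂ z * S z :=
    (integrable_mul_of_hasCompactSupport s2.dy.continuous c2.dy sB.continuous).add
      (integrable_mul_of_hasCompactSupport s2.dx.continuous c2.dx sS.continuous)
  have i3 : Integrable fun z => χ z * eta a b z ^ 2 / 2 :=
    (integrable_mul_of_hasCompactSupport hχ.continuous hcs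
      (g := fun z => eta a b z ^ 2) (by fun_prop)).div_const 2
  have i4 : Integrable fun z => c * (ψ₁ z * jac a b z) :=
    (integrable_mul_of_hasCompactSupport s1.continuous c1 (by fun_prop)).const_mul c
  have hS0 : MeasurableSet (closedBall x₀ ρ) := measurableSet_closedBall
  have i5 : Integrable ((closedBall x₀ ρ).indicator fun z => (4 * ε + c * ρ) * en a b z) := by
    rw [integrable_indicator_iff hS0]
    exact (((h.sa.en h.sb).continuous.const_mul _).continuousOn.integrableOn_compact
      (isCompact_closedBall _ _))
  have i12 : Integrable fun z => χ z * eta a b z ^ 2 / 2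
      + (dx ψ₁ z * A z + dy ψ₁ z * S z) := i3.add i1
  have i123 : Integrable fun z => χ z * eta a b z ^ 2 / 2
      + (dx ψ₁ z * A z + dy ψ₁ z * S z) + (dy ψ₂ z * B z + dx ψ₂ z * S z) := i12.add i2
  have i1234 : Integrable fun z => χ z * eta a b z ^ 2 / 2
      + (dx ψ₁ z * A z + dy ψ₁ z * S z) + (dy ψ₂ z * B z + dx ψ₂ z * S z)
      - c * (ψ₁ z * jac a b z) := i123.sub i4
  have key := integral_mono i1234 i5 fun z => by
    by_cases hz : z ∈ closedBall x₀ ρ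
    · rw [Set.indicator_of_mem hz]
      have k1 := abs_coord_mul_le (hxx z) (hxy z) (hyx z) (hyy z) (χ := χ z) (η := eta a b z)
        (dx a z) (dy a z) (dx b z) (dy b z)
      have k2 : |ψ₁ z * jac a b z| ≤ ρ * en a b z := by
        rw [abs_mul]
        refine mul_le_mul ?_ ((abs_jac_le a b z).trans (by linarith [gsq_le_en a b z]))
          (abs_nonneg _) hρ
        rw [mem_closedBall, dist_eq_norm] at hz
        have := (Complex.abs_re_le_norm (z - x₀)).trans hz
        rw [Complex.sub_re] at this
        rw [hψ₁]
        simp only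
        rw [abs_mul, abs_of_nonneg (h0 z)]
        exact (mul_le_of_le_one_left (abs_nonneg _) (h1 z)).trans this
      have k3 := mul_le_mul_of_nonneg_left (neg_le.1 (neg_le_of_abs_le k2)) hc
      simp only [d1, d2, d3, d4]
      have k4 : en a b z = (dx a z ^ 2 + dy a z ^ 2 + dx b z ^ 2 + dy b z ^ 2) / 2
        + eta a b z ^ 2 / 4 := rfl
      rw [← k4] at k1
      simp only [hA, hB, hS]
      linarith
    · rw [Set.indicator_of_notMem hz]
      have hz' : z ∉ tsupport χ := fun h' => hz (hs h')
      have hz0 : ψ₁ z = 0 := by simp only [hψ₁, image_eq_zero_of_notMem_tsupport hz', zero_mul]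
      simp only [d1, d2, d3, d4, dx_eq_zero_of_notMem hz', dy_eq_zero_of_notMem hz',
        image_eq_zero_of_notMem_tsupport hz', hz0]
      simp
  rw [integral_sub i123 i4, integral_add i12 i2, integral_add i3 i1, ← p1, p2,
    integral_const_mul, integral_indicator hS0, integral_const_mul, integral_div] at key
  have : (4 * ε + c * ρ) * ∫ z in closedBall x₀ ρ, en a b z ≤ (4 * ε + c * ρ) * C := by gcongr
  linarith

/-- A logarithmic cutoff at scale `ρ`. -/
def logCutoff (w : ℂ) (ρ : ℝ) (z : ℂ) : ℝ :=
  profilePrim 2 (Real.log (1 + ellSq w 1 1 z) / Real.log (1 + ρ ^ 2))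

section LogCutoff
variable (w : ℂ) {ρ : ℝ}

theorem ellSq_one_eq (z : ℂ) : ellSq w 1 1 z = ‖z - w‖ ^ 2 := by
  rw [ellSq, Complex.sq_norm, Complex.normSq_apply, Complex.sub_re, Complex.sub_im]; ring

theorem one_add_ellSq_pos (z : ℂ) : 0 < 1 + ellSq w 1 1 z := by rw [ellSq_one_eq]; positivity

theorem smooth_log_one_add_ellSq : Smooth fun z => Real.log (1 + ellSq w 1 1 z) :=
  ContDiff.log (Smooth.add (Smooth.const 1) (Smooth.ellSq w 1 1))
    fun z => (one_add_ellSq_pos w z).ne'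

theorem smooth_logCutoff : Smooth (logCutoff w ρ) :=
  (contDiff_profilePrim 2).comp ((smooth_log_one_add_ellSq w).div_const _)

theorem profilePrim_nonneg (n σ : ℝ) : 0 ≤ profilePrim n σ := by
  rcases le_total σ 1 with h | h
  · exact intervalIntegral.integral_nonneg h fun s _ => profile_nonneg n s
  · rw [profilePrim_eq_zero n h]

theorem profilePrim_le_one (n : ℝ) {σ : ℝ} (h : 0 ≤ σ) : profilePrim n σ ≤ 1 := by
  rcases le_total σ 1 with h1 | h1
  · have := intervalIntegral.integral_mono_on h1
      ((continuous_profile n).intervalIntegrable σ 1)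
      (intervalIntegrable_const (μ := volume) (c := (1 : ℝ)))
      fun s _ => profile_le_one n s
    rw [intervalIntegral.integral_const, smul_eq_mul, mul_one] at this
    unfold profilePrim; linarith
  · rw [profilePrim_eq_zero n h1]; exact zero_le_one

theorem quarter_le_profilePrim {σ : ℝ} (h : σ ≤ 1 / 4) : 1 / 4 ≤ profilePrim 2 σ := by
  have c := continuous_profile 2
  rw [profilePrim, ← intervalIntegral.integral_add_adjacent_intervals (b := 1 / 2)
    (c.intervalIntegrable _ _) (c.intervalIntegrable _ _)]
  have h1 : 0 ≤ ∫ s in (1 / 2 : ℝ)..1, profile 2 s :=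
    intervalIntegral.integral_nonneg (by norm_num) fun s _ => profile_nonneg _ _
  have h2 := intervalIntegral.integral_mono_on (show σ ≤ 1 / 2 by linarith)
    (intervalIntegrable_const (μ := volume) (c := (1 : ℝ))) (c.intervalIntegrable σ (1 / 2))
    fun s hs => (profile_eq_one (n := 2) (by linarith [hs.2])).ge
  rw [intervalIntegral.integral_const, smul_eq_mul, mul_one] at h2
  linarith

theorem log_one_add_ellSq_nonneg (z : ℂ) : 0 ≤ Real.log (1 + ellSq w 1 1 z) :=
  Real.log_nonneg (by rw [ellSq_one_eq]; nlinarith [sq_nonneg ‖z - w‖])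

theorem fderiv_logCutoff (z v : ℂ) : fderiv ℝ (logCutoff w ρ) z v =
    -(profile 2 (Real.log (1 + ellSq w 1 1 z) / Real.log (1 + ρ ^ 2)))
      * (fderiv ℝ (ellSq w 1 1) z v / (1 + ellSq w 1 1 z) / Real.log (1 + ρ ^ 2)) := by
  have h1 : HasFDerivAt (fun z => Real.log (1 + ellSq w 1 1 z)) _ z :=
    (((Smooth.ellSq w 1 1).differentiableAt (z := z)).hasFDerivAt.const_add 1).log
      (one_add_ellSq_pos w z).ne'
  have h2 := (hasDerivAt_profilePrim 2
    (Real.log (1 + ellSq w 1 1 z) / Real.log (1 + ρ ^ 2))).comp_hasFDerivAt z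
      (h1.mul_const (Real.log (1 + ρ ^ 2))⁻¹)
  have : fderiv ℝ (logCutoff w ρ) z = _ := h2.fderiv
  rw [this]
  simp only [neg_smul, neg_apply, smul_apply, smul_eq_mul]
  ring

theorem abs_mul_fderiv_logCutoff_le (hρ : 0 < ρ) (z v : ℂ) {s t : ℝ}
    (ht : fderiv ℝ (ellSq w 1 1) z v = 2 * t) (h : |s * t| ≤ ellSq w 1 1 z) :
    |s * fderiv ℝ (logCutoff w ρ) z v| ≤ 2 / Real.log (1 + ρ ^ 2) := by
  have hL : 0 < Real.log (1 + ρ ^ 2) := Real.log_pos (by nlinarith [sq_pos_of_pos hρ])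
  have hq := one_add_ellSq_pos w z
  rw [fderiv_logCutoff, ht]
  have e : s * (-(profile 2 (Real.log (1 + ellSq w 1 1 z) / Real.log (1 + ρ ^ 2)))
      * (2 * t / (1 + ellSq w 1 1 z) / Real.log (1 + ρ ^ 2)))
      = -(profile 2 (Real.log (1 + ellSq w 1 1 z) / Real.log (1 + ρ ^ 2))) * (2 * (s * t)
        / (1 + ellSq w 1 1 z) / Real.log (1 + ρ ^ 2)) := by ring
  rw [e, abs_mul, abs_neg, abs_of_nonneg (profile_nonneg _ _), abs_div, abs_of_pos hL, abs_div,
    abs_of_pos hq, abs_mul, abs_two]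
  refine (mul_le_of_le_one_left (by positivity) (profile_le_one _ _)).trans ?_
  refine div_le_div_of_nonneg_right ?_ hL.le
  rw [div_le_iff₀ hq]; linarith

theorem tsupport_logCutoff_subset (hρ : 0 < ρ) : tsupport (logCutoff w ρ) ⊆ closedBall w ρ := by
  have hL : 0 < Real.log (1 + ρ ^ 2) := Real.log_pos (by nlinarith [sq_pos_of_pos hρ])
  refine closure_minimal (fun z hz => ?_) isClosed_closedBall
  by_contra hz'
  rw [mem_closedBall, not_le, dist_eq_norm] at hz'
  refine hz (profilePrim_eq_zero _ ?_)
  rw [le_div_iff₀ hL, one_mul, ellSq_one_eq]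
  exact Real.log_le_log (by positivity) (by gcongr)

end LogCutoff

/-- The potential energy is small on balls of fixed size, away from the vortices. -/
theorem GP.integral_eta_sq_le {c : ℝ} {a b : ℂ → ℝ} (h : GP c a b) (hc : 0 ≤ c) (x₀ : ℂ)
    {ρ C : ℝ} (hρ : 0 < ρ) (hL : 4 * Real.log 10 ≤ Real.log (1 + ρ ^ 2))
    (hC : ∫ z in closedBall x₀ ρ, en a b z ≤ C) :
    ∫ z in closedBall x₀ 3, eta a b z ^ 2 ≤ 8 * (8 / Real.log (1 + ρ ^ 2) + c * ρ) * C := by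
  have ha := h.sa
  have hb := h.sb
  have hL0 : 0 < Real.log (1 + ρ ^ 2) := Real.log_pos (by nlinarith [sq_pos_of_pos hρ])
  have hs := smooth_logCutoff x₀ (ρ := ρ)
  have h0 : ∀ z, 0 ≤ logCutoff x₀ ρ z := fun z => profilePrim_nonneg _ _
  have e1 : ∀ z, fderiv ℝ (ellSq x₀ 1 1) z 1 = 2 * (z.re - x₀.re) := fun z => by
    have := dx_ellSq x₀ 1 1 z
    rwa [one_pow, div_one] at this
  have e2 : ∀ z, fderiv ℝ (ellSq x₀ 1 1) z Complex.I = 2 * (z.im - x₀.im) := fun z => by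
    have := dy_ellSq x₀ 1 1 z
    rwa [one_pow, div_one] at this
  have q : ∀ z, ellSq x₀ 1 1 z = (z.re - x₀.re) ^ 2 + (z.im - x₀.im) ^ 2 := fun z => by
    rw [ellSq]; ring
  have q1 : ∀ x y : ℝ, |x * y| ≤ x ^ 2 + y ^ 2 := fun x y => by
    rw [abs_mul]; nlinarith [sq_nonneg (|x| - |y|), sq_abs x, sq_abs y, sq_nonneg x, sq_nonneg y]
  have h2 := h.pohozaev_le hc x₀ hs h0 (fun z => profilePrim_le_one 2
      (div_nonneg (log_one_add_ellSq_nonneg x₀ z) hL0.le)) (tsupport_logCutoff_subset x₀ hρ)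
    (fun z => abs_mul_fderiv_logCutoff_le x₀ hρ z _ (e1 z) (by
      rw [q, abs_mul_self]; nlinarith [sq_nonneg (z.im - x₀.im)]))
    (fun z => abs_mul_fderiv_logCutoff_le x₀ hρ z _ (e2 z) (by rw [q]; exact q1 _ _))
    (fun z => abs_mul_fderiv_logCutoff_le x₀ hρ z _ (e1 z) (by
      rw [q, add_comm]; exact q1 _ _))
    (fun z => abs_mul_fderiv_logCutoff_le x₀ hρ z _ (e2 z) (by
      rw [q, abs_mul_self]; nlinarith [sq_nonneg (z.re - x₀.re)]))
    hC hρ.le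
  have hcs : HasCompactSupport (logCutoff x₀ ρ) := HasCompactSupport.of_support_subset_isCompact
    (isCompact_closedBall x₀ ρ) ((subset_tsupport _).trans (tsupport_logCutoff_subset x₀ hρ))
  have i1 : Integrable fun z => logCutoff x₀ ρ z * eta a b z ^ 2 :=
    integrable_mul_of_hasCompactSupport hs.continuous hcs (g := fun z => eta a b z ^ 2)
      (by fun_prop)
  have i2 : IntegrableOn (fun z => eta a b z ^ 2) (closedBall x₀ 3) :=
    (Continuous.continuousOn (by fun_prop)).integrableOn_compact (isCompact_closedBall _ _)
  have h3 : ∫ z in closedBall x₀ 3, eta a b z ^ 2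
      ≤ ∫ z in closedBall x₀ 3, 4 * (logCutoff x₀ ρ z * eta a b z ^ 2) := by
    refine setIntegral_mono_on i2 (i1.integrableOn.const_mul 4) measurableSet_closedBall
      fun z hz => ?_
    have : 1 / 4 ≤ logCutoff x₀ ρ z := by
      refine quarter_le_profilePrim ?_
      rw [div_le_iff₀ hL0]
      rw [mem_closedBall, dist_eq_norm] at hz
      have : Real.log (1 + ellSq x₀ 1 1 z) ≤ Real.log 10 := by
        refine Real.log_le_log (one_add_ellSq_pos x₀ z) ?_
        rw [ellSq_one_eq]; nlinarith [norm_nonneg (z - x₀)]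
      linarith
    nlinarith [sq_nonneg (eta a b z)]
  have h4 : ∫ z in closedBall x₀ 3, logCutoff x₀ ρ z * eta a b z ^ 2
      ≤ ∫ z, logCutoff x₀ ρ z * eta a b z ^ 2 :=
    setIntegral_le_integral i1 (Eventually.of_forall fun z => mul_nonneg (h0 z) (sq_nonneg _))
  rw [integral_const_mul] at h3
  refine h3.trans ?_
  calc _ ≤ 4 * (2 * (4 * (2 / Real.log (1 + ρ ^ 2)) + c * ρ) * C) := by linarith
    _ = _ := by ring

theorem cur2_sq_le (a b : ℂ → ℝ) (z : ℂ) : cur2 a b z ^ 2 ≤ (1 - eta a b z) * gsq a b z := by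
  unfold cur2 eta gsq
  nlinarith [sq_nonneg (a z * dy a z + b z * dy b z), sq_nonneg (a z * dx a z),
    sq_nonneg (a z * dx b z), sq_nonneg (b z * dx a z), sq_nonneg (b z * dx b z)]

theorem caccioppoli_density {c η G j L1 L2 : ℝ} (χ χ1 χ2 η1 η2 : ℝ) (hη : 0 ≤ 1 - η)
    (hG : 0 ≤ G) (hj : j ^ 2 ≤ (1 - η) * G)
    (hL : L1 + L2 = -2 * G + 2 * (1 - η) * η - 2 * c * j) :
    χ ^ 2 * ((1 - η) * η ^ 2) ≤ ((2 + c ^ 2) * (χ ^ 2 * G) + (χ1 ^ 2 + χ2 ^ 2) * η ^ 2)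
      + ((2 * χ * χ1 * (η * η1) + χ ^ 2 * (η1 * η1 + η * L1))
        + (2 * χ * χ2 * (η * η2) + χ ^ 2 * (η2 * η2 + η * L2))) := by
  have f1 : 0 ≤ (χ * η1 + χ1 * η) ^ 2 := sq_nonneg _
  have f2 : 0 ≤ (χ * η2 + χ2 * η) ^ 2 := sq_nonneg _
  have f3 : 2 * c * η * j ≤ (1 - η) * η ^ 2 + c ^ 2 * G := by
    have h1 := Real.abs_le_sqrt hj
    rw [Real.sqrt_mul hη] at h1
    have g1 := Real.sq_sqrt hη
    have g2 := Real.sq_sqrt hG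
    have g3 : c * η * j ≤ |c * η| * (√(1 - η) * √G) :=
      (le_abs_self _).trans (by rw [abs_mul]; gcongr)
    rw [abs_mul] at g3
    have g4 := sq_nonneg (√(1 - η) * |η| - |c| * √G)
    have g5 : (√(1 - η) * |η| - |c| * √G) ^ 2 = √(1 - η) ^ 2 * |η| ^ 2 + |c| ^ 2 * √G ^ 2
      - 2 * (|c| * |η| * (√(1 - η) * √G)) := by ring
    rw [g5, g1, g2, sq_abs, sq_abs] at g4
    linarith
  have f4 := mul_le_mul_of_nonneg_left f3 (sq_nonneg χ)
  have f5 : 0 ≤ χ ^ 2 * ((1 - η) * G) := by positivity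
  have e4 : L1 = -2 * G + 2 * (1 - η) * η - 2 * c * j - L2 := by linarith
  rw [e4]
  linarith

/-- A Caccioppoli inequality. -/
theorem integral_caccioppoli_le {c : ℝ} {χ η G j : ℂ → ℝ} (hχ : Smooth χ)
    (hcs : HasCompactSupport χ) (hη : Smooth η) (hG : Smooth G) (h1 : ∀ z, 0 ≤ 1 - η z)
    (h2 : ∀ z, 0 ≤ G z) (hj : ∀ z, j z ^ 2 ≤ (1 - η z) * G z)
    (hL : ∀ z, dx (dx η) z + dy (dy η) z
      = -2 * G z + 2 * (1 - η z) * η z - 2 * c * j z) :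
    ∫ z, χ z ^ 2 * ((1 - η z) * η z ^ 2)
      ≤ ∫ z, ((2 + c ^ 2) * (χ z ^ 2 * G z) + (dx χ z ^ 2 + dy χ z ^ 2) * η z ^ 2) := by
  have hχ2 : HasCompactSupport fun z => χ z ^ 2 := by
    simp only [sq]; exact hcs.mul_right
  have s0 : Smooth fun z => χ z ^ 2 := by fun_prop
  have s1 : Smooth fun z => η z * dx η z := by fun_prop
  have s2 : Smooth fun z => η z * dy η z := by fun_prop
  have c1 : HasCompactSupport fun z => χ z ^ 2 * (η z * dx η z) := hχ2.mul_right
  have c2 : HasCompactSupport fun z => χ z ^ 2 * (η z * dy η z) := hχ2.mul_right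
  have z1 := integral_dx_eq_zero (s0.mul s1) c1
  have z2 := integral_dy_eq_zero (s0.mul s2) c2
  have i1 := integrable_of_compactSupport (s0.mul s1).dx c1.dx
  have i2 := integrable_of_compactSupport (s0.mul s2).dy c2.dy
  have i3 : Integrable fun z => χ z ^ 2 * ((1 - η z) * η z ^ 2) :=
    integrable_of_compactSupport (by fun_prop) hχ2.mul_right
  have d1 : HasCompactSupport fun z => dx χ z ^ 2 + dy χ z ^ 2 := by
    simp only [sq]
    exact hcs.dx.mul_right.add hcs.dy.mul_right
  have i5 : Integrable fun z => χ z ^ 2 * G z :=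
    integrable_of_compactSupport (by fun_prop) hχ2.mul_right
  have i6 : Integrable fun z => (dx χ z ^ 2 + dy χ z ^ 2) * η z ^ 2 :=
    integrable_of_compactSupport (by fun_prop) d1.mul_right
  have i4 : Integrable fun z => (2 + c ^ 2) * (χ z ^ 2 * G z)
    + (dx χ z ^ 2 + dy χ z ^ 2) * η z ^ 2 := (i5.const_mul _).add i6
  have i12 : Integrable fun z => dx (fun z => χ z ^ 2 * (η z * dx η z)) z
    + dy (fun z => χ z ^ 2 * (η z * dy η z)) z := i1.add i2
  have i412 : Integrable fun z => ((2 + c ^ 2) * (χ z ^ 2 * G z)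
      + (dx χ z ^ 2 + dy χ z ^ 2) * η z ^ 2) + (dx (fun z => χ z ^ 2 * (η z * dx η z)) z
      + dy (fun z => χ z ^ 2 * (η z * dy η z)) z) := i4.add i12
  have key := integral_mono i3 i412 fun z => by
    have e1 : dx (fun z => χ z ^ 2 * (η z * dx η z)) z
        = 2 * χ z * dx χ z * (η z * dx η z) + χ z ^ 2 * (dx η z * dx η z + η z * dx (dx η) z) := by
      rw [dx_mul s0.differentiableAt s1.differentiableAt, dx_pow hχ.differentiableAt,
        dx_mul hη.differentiableAt hη.dx.differentiableAt]
      simp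
    have e2 : dy (fun z => χ z ^ 2 * (η z * dy η z)) z
        = 2 * χ z * dy χ z * (η z * dy η z) + χ z ^ 2 * (dy η z * dy η z + η z * dy (dy η) z) := by
      rw [dy_mul s0.differentiableAt s2.differentiableAt, dy_pow hχ.differentiableAt,
        dy_mul hη.differentiableAt hη.dy.differentiableAt]
      simp
    have := caccioppoli_density (χ z) (dx χ z) (dy χ z) (dx η z) (dy η z) (h1 z) (h2 z) (hj z)
      (hL z)
    rw [e1, e2]
    exact this
  rw [integral_add i4 i12, integral_add i1 i2, z1, z2, add_zero, add_zero] at key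
  exact key

/-- The mixed second derivative is controlled by the Laplacian. -/
theorem integral_dxdy_sq_le {f : ℂ → ℝ} (hf : Smooth f) (hc : HasCompactSupport f) :
    ∫ z, dx (dy f) z ^ 2 ≤ ∫ z, (dx (dx f) z + dy (dy f) z) ^ 2 := by
  have z1 := integral_dx_eq_zero (f := fun z => dx f z * dy (dy f) z) (by fun_prop) hc.dx.mul_right
  have z2 := integral_dy_eq_zero (f := fun z => dx f z * dx (dy f) z) (by fun_prop) hc.dx.mul_right
  have i1 : Integrable (dx fun z => dx f z * dy (dy f) z) :=
    integrable_of_compactSupport (by fun_prop) (HasCompactSupport.dx hc.dx.mul_right)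
  have i2 : Integrable (dy fun z => dx f z * dx (dy f) z) :=
    integrable_of_compactSupport (by fun_prop) (HasCompactSupport.dy hc.dx.mul_right)
  have i3 : Integrable fun z => dx (dy f) z ^ 2 := by
    simp only [sq]
    exact integrable_of_compactSupport (by fun_prop) hc.dy.dx.mul_right
  have i4 : Integrable fun z => (dx (dx f) z + dy (dy f) z) ^ 2 := by
    simp only [sq]
    exact integrable_of_compactSupport (by fun_prop) (hc.dx.dx.add hc.dy.dy).mul_right
  have i12 : Integrable fun z => dx (fun z => dx f z * dy (dy f) z) z
    - dy (fun z => dx f z * dx (dy f) z) z := i1.sub i2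
  have i412 : Integrable fun z => (dx (dx f) z + dy (dy f) z) ^ 2
    - (dx (fun z => dx f z * dy (dy f) z) z - dy (fun z => dx f z * dx (dy f) z) z) := i4.sub i12
  have key := integral_mono i3 i412 fun z => by
    simp (disch := fun_prop) only [dx_mul, dy_mul]
    have e1 : dx (dy (dy f)) z = dy (dx (dy f)) z := dx_dy_comm (by fun_prop) z
    have e2 : dy (dx f) z = dx (dy f) z := (dx_dy_comm hf z).symm
    rw [e1, e2]
    nlinarith [sq_nonneg (dx (dx f) z), sq_nonneg (dy (dy f) z),
      sq_nonneg (dx (dx f) z + dy (dy f) z)]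
  rw [integral_sub i4 i12, integral_sub i1 i2, z1, z2] at key
  simpa using key

theorem integral_rectangle_le {g : ℂ → ℝ} (h0 : ∀ z, 0 ≤ g z)
    (hi : Integrable g) {x y s t : ℝ} (hxy : x ≤ y) (hst : s ≤ t) :
    ∫ p in x..y, ∫ q in s..t, g ⟨p, q⟩ ≤ ∫ z, g z := by
  have e := Complex.volume_preserving_equiv_real_prod.symm
  have h1 : ∫ z, g z = ∫ p : ℝ × ℝ, g ⟨p.1, p.2⟩ :=
    (e.integral_comp (Complex.measurableEquivRealProd.symm.measurableEmbedding) g).symm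
  have h2 : Integrable fun p : ℝ × ℝ => g ⟨p.1, p.2⟩ :=
    (e.integrable_comp_emb (Complex.measurableEquivRealProd.symm.measurableEmbedding)).2 hi
  rw [h1, intervalIntegral.integral_of_le hxy]
  simp only [intervalIntegral.integral_of_le hst]
  rw [← setIntegral_prod (fun p : ℝ × ℝ => g ⟨p.1, p.2⟩) h2.integrableOn]
  exact setIntegral_le_integral h2 (Eventually.of_forall fun p => h0 _)

theorem abs_sub_le_of_double_integral {F : ℝ → ℝ} {H : ℝ → ℝ → ℝ} {p p' s t K κ : ℝ}
    (hH : Continuous fun x : ℝ × ℝ => H x.1 x.2)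
    (hF : ∀ x, HasDerivAt F (∫ y in s..t, H x y) x) (hp : p ≤ p') (hst : s ≤ t) (hκ : 0 < κ)
    (hK : ∫ x in p..p', ∫ y in s..t, H x y ^ 2 ≤ K) :
    |F p' - F p| ≤ K / (2 * κ) + κ / 2 * ((t - s) * (p' - p)) := by
  have c1 : Continuous fun x => ∫ y in s..t, H x y :=
    intervalIntegral.continuous_parametric_intervalIntegral_of_continuous' hH s t
  have hH2 : Continuous fun x : ℝ × ℝ => H x.1 x.2 ^ 2 := hH.pow 2
  have c2 : Continuous fun x => ∫ y in s..t, H x y ^ 2 :=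
    intervalIntegral.continuous_parametric_intervalIntegral_of_continuous'
      (f := fun x y => H x y ^ 2) hH2 s t
  rw [← intervalIntegral.integral_eq_sub_of_hasDerivAt (fun x _ => hF x)
    (c1.intervalIntegrable _ _)]
  have h1 : ∀ x, |∫ y in s..t, H x y| ≤ (∫ y in s..t, H x y ^ 2) / (2 * κ) + κ / 2 * (t - s) := by
    intro x
    have cx : Continuous (H x) := hH.comp (Continuous.prodMk_right x)
    refine (intervalIntegral.abs_integral_le_integral_abs hst).trans ?_
    have e : (∫ y in s..t, H x y ^ 2) / (2 * κ) + κ / 2 * (t - s)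
        = ∫ y in s..t, (H x y ^ 2 / (2 * κ) + κ / 2) := by
      rw [intervalIntegral.integral_add ((Continuous.intervalIntegrable (by fun_prop)) _ _)
        intervalIntegrable_const, intervalIntegral.integral_div, intervalIntegral.integral_const,
        smul_eq_mul]
      ring
    rw [e]
    refine intervalIntegral.integral_mono_on hst (cx.abs.intervalIntegrable _ _)
      (Continuous.intervalIntegrable (by fun_prop) _ _) fun y _ => ?_
    rw [div_add_div _ _ (by positivity) two_ne_zero, le_div_iff₀ (by positivity)]
    nlinarith [sq_nonneg (|H x y| - κ), sq_abs (H x y)]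
  refine (intervalIntegral.abs_integral_le_integral_abs hp).trans ?_
  refine (intervalIntegral.integral_mono_on hp (c1.abs.intervalIntegrable _ _)
    (Continuous.intervalIntegrable (by fun_prop) _ _) fun x _ => h1 x).trans ?_
  rw [intervalIntegral.integral_add ((Continuous.intervalIntegrable (by fun_prop)) _ _)
        intervalIntegrable_const, intervalIntegral.integral_div, intervalIntegral.integral_const,
        smul_eq_mul]
  have : (∫ x in p..p', ∫ y in s..t, H x y ^ 2) / (2 * κ) ≤ K / (2 * κ) := by gcongr
  linarith

section Oscillation
variable {f : ℂ → ℝ} {x₀ : ℂ} {K κ : ℝ}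

theorem abs_sub_le_re (hf : Smooth f) (hs : tsupport f ⊆ closedBall x₀ 3)
    (hK : ∫ z, dx (dy f) z ^ 2 ≤ K) (hκ : 0 < κ) {p p' q : ℝ} (hp : p ≤ p')
    (hq : |q - x₀.im| ≤ 4) :
    |f ⟨p', q⟩ - f ⟨p, q⟩| ≤ K / (2 * κ) + 4 * κ * (p' - p) := by
  have hc : HasCompactSupport f := HasCompactSupport.of_support_subset_isCompact
    (isCompact_closedBall x₀ 3) ((subset_tsupport f).trans hs)
  have hq' := abs_le.1 hq
  have hz : ∀ s, dx f ⟨s, x₀.im - 4⟩ = 0 := fun s => by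
    refine dx_eq_zero_of_notMem fun h => ?_
    have := hs h
    rw [mem_closedBall, dist_eq_norm] at this
    have h2 := (abs_le.1 ((Complex.abs_im_le_norm _).trans this)).1
    simp at h2; norm_num at h2
  have hd : ∀ s, HasDerivAt (fun s => f ⟨s, q⟩) (∫ t in (x₀.im - 4)..q, dx (dy f) ⟨s, t⟩) s := by
    intro s
    have e : ∫ t in (x₀.im - 4)..q, dx (dy f) ⟨s, t⟩ = dx f ⟨s, q⟩ := by
      have := intervalIntegral.integral_eq_sub_of_hasDerivAt (a := x₀.im - 4) (b := q)
        (f := fun t => dx f ⟨s, t⟩) (f' := fun t => dx (dy f) ⟨s, t⟩) (fun t _ => by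
          have := hasDerivAt_comp_plane hf.dx (hasDerivAt_const t s) (hasDerivAt_id t)
          refine this.congr_deriv ?_
          rw [dx_dy_comm hf]; simp)
        (Continuous.intervalIntegrable (hf.dy.dx.continuous.comp
          (continuous_mk_complex continuous_const continuous_id)) _ _)
      rw [this, hz, sub_zero]
    rw [e]
    have := hasDerivAt_comp_plane hf (hasDerivAt_id s) (hasDerivAt_const s q)
    exact this.congr_deriv (by simp)
  have hg : Continuous (dx (dy f)) := hf.dy.dx.continuous
  have hi : Integrable fun z => dx (dy f) z ^ 2 := by
    simp only [sq]
    exact integrable_of_compactSupport (by fun_prop) hc.dy.dx.mul_right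
  have := abs_sub_le_of_double_integral (F := fun s => f ⟨s, q⟩)
    (H := fun s t => dx (dy f) ⟨s, t⟩)
    (hg.comp (continuous_mk_complex continuous_fst continuous_snd)) hd hp (by linarith) hκ
    ((integral_rectangle_le (fun z => sq_nonneg _) hi hp (by linarith)).trans hK)
  refine this.trans ?_
  have h8 : (q - (x₀.im - 4)) * (p' - p) ≤ 8 * (p' - p) :=
    mul_le_mul_of_nonneg_right (by linarith) (by linarith)
  nlinarith

theorem abs_sub_le_im (hf : Smooth f) (hs : tsupport f ⊆ closedBall x₀ 3)
    (hK : ∫ z, dx (dy f) z ^ 2 ≤ K) (hκ : 0 < κ) {p q q' : ℝ} (hq : q ≤ q')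
    (hp : |p - x₀.re| ≤ 4) :
    |f ⟨p, q'⟩ - f ⟨p, q⟩| ≤ K / (2 * κ) + 4 * κ * (q' - q) := by
  have hc : HasCompactSupport f := HasCompactSupport.of_support_subset_isCompact
    (isCompact_closedBall x₀ 3) ((subset_tsupport f).trans hs)
  have hp' := abs_le.1 hp
  have hz : ∀ t, dy f ⟨x₀.re - 4, t⟩ = 0 := fun t => by
    refine dy_eq_zero_of_notMem fun h => ?_
    have := hs h
    rw [mem_closedBall, dist_eq_norm] at this
    have h2 := (abs_le.1 ((Complex.abs_re_le_norm _).trans this)).1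
    simp at h2; norm_num at h2
  have hd : ∀ t, HasDerivAt (fun t => f ⟨p, t⟩) (∫ s in (x₀.re - 4)..p, dx (dy f) ⟨s, t⟩) t := by
    intro t
    have e : ∫ s in (x₀.re - 4)..p, dx (dy f) ⟨s, t⟩ = dy f ⟨p, t⟩ := by
      have := intervalIntegral.integral_eq_sub_of_hasDerivAt (a := x₀.re - 4) (b := p)
        (f := fun s => dy f ⟨s, t⟩) (f' := fun s => dx (dy f) ⟨s, t⟩) (fun s _ => by
          have := hasDerivAt_comp_plane hf.dy (hasDerivAt_id s) (hasDerivAt_const s t)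
          exact this.congr_deriv (by simp))
        (Continuous.intervalIntegrable (hf.dy.dx.continuous.comp
          (continuous_mk_complex continuous_id continuous_const)) _ _)
      rw [this, hz, sub_zero]
    rw [e]
    have := hasDerivAt_comp_plane hf (hasDerivAt_const t p) (hasDerivAt_id t)
    exact this.congr_deriv (by simp)
  have hg : Continuous (dx (dy f)) := hf.dy.dx.continuous
  have hi : Integrable fun z => dx (dy f) z ^ 2 := by
    simp only [sq]
    exact integrable_of_compactSupport (by fun_prop) hc.dy.dx.mul_right
  have hcc : Continuous fun x : ℝ × ℝ => dx (dy f) ⟨x.1, x.2⟩ :=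
    hg.comp (continuous_mk_complex continuous_fst continuous_snd)
  have hr := integral_rectangle_le (fun z => sq_nonneg _) hi (show x₀.re - 4 ≤ p by linarith) hq
  have hsw : ∫ s in (x₀.re - 4)..p, ∫ t in q..q', dx (dy f) ⟨s, t⟩ ^ 2
      = ∫ t in q..q', ∫ s in (x₀.re - 4)..p, dx (dy f) ⟨s, t⟩ ^ 2 := by
    refine intervalIntegral_intervalIntegral_swap (IntegrableOn.mono_set ?_
      (Set.prod_mono Set.uIoc_subset_uIcc Set.uIoc_subset_uIcc))
    exact (hcc.pow 2).continuousOn.integrableOn_compact (isCompact_uIcc.prod isCompact_uIcc)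
  rw [hsw] at hr
  have := abs_sub_le_of_double_integral (F := fun t => f ⟨p, t⟩)
    (H := fun t s => dx (dy f) ⟨s, t⟩)
    (hg.comp (continuous_mk_complex continuous_snd continuous_fst)) hd hq (by linarith) hκ
    (hr.trans hK)
  refine this.trans ?_
  have h8 : (p - (x₀.re - 4)) * (q' - q) ≤ 8 * (q' - q) :=
    mul_le_mul_of_nonneg_right (by linarith) (by linarith)
  nlinarith

theorem abs_sub_le_norm (hf : Smooth f) (hs : tsupport f ⊆ closedBall x₀ 3)
    (hK : ∫ z, dx (dy f) z ^ 2 ≤ K) (hκ : 0 < κ) {z : ℂ} (hz : z ∈ closedBall x₀ 4) :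
    |f z - f x₀| ≤ K / κ + 8 * κ * ‖z - x₀‖ := by
  rw [mem_closedBall, dist_eq_norm] at hz
  have hre := Complex.abs_re_le_norm (z - x₀)
  have him := Complex.abs_im_le_norm (z - x₀)
  rw [Complex.sub_re] at hre
  rw [Complex.sub_im] at him
  have h1 : |f ⟨z.re, z.im⟩ - f ⟨x₀.re, z.im⟩| ≤ K / (2 * κ) + 4 * κ * ‖z - x₀‖ := by
    rcases le_total x₀.re z.re with h | h
    · refine (abs_sub_le_re hf hs hK hκ h (him.trans hz)).trans ?_
      have := (le_abs_self _).trans hre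
      gcongr
    · rw [abs_sub_comm]
      refine (abs_sub_le_re hf hs hK hκ h (him.trans hz)).trans ?_
      have := (neg_le_abs _).trans hre
      gcongr
      linarith
  have h2 : |f ⟨x₀.re, z.im⟩ - f ⟨x₀.re, x₀.im⟩| ≤ K / (2 * κ) + 4 * κ * ‖z - x₀‖ := by
    have h0 : |x₀.re - x₀.re| ≤ 4 := by simp
    rcases le_total x₀.im z.im with h | h
    · refine (abs_sub_le_im hf hs hK hκ h h0).trans ?_
      have := (le_abs_self _).trans him
      gcongr
    · rw [abs_sub_comm]
      refine (abs_sub_le_im hf hs hK hκ h h0).trans ?_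
      have := (neg_le_abs _).trans him
      gcongr
      linarith
  have h3 := (abs_sub_le _ _ _).trans (add_le_add h1 h2)
  refine h3.trans (le_of_eq ?_)
  field_simp; ring

theorem abs_le_of_integral_dxdy_sq (hf : Smooth f) (hs : tsupport f ⊆ closedBall x₀ 3)
    (hK : ∫ z, dx (dy f) z ^ 2 ≤ K) {z : ℂ} (hz : z ∈ closedBall x₀ 4) :
    |f z| ≤ K / 2 + 32 := by
  rw [mem_closedBall, dist_eq_norm] at hz
  have hre := (abs_le.1 ((Complex.abs_re_le_norm (z - x₀)).trans hz))
  have him := (Complex.abs_im_le_norm (z - x₀)).trans hz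
  rw [Complex.sub_re] at hre
  rw [Complex.sub_im] at him
  have h0 : f ⟨x₀.re - 4, z.im⟩ = 0 := by
    refine image_eq_zero_of_notMem_tsupport fun h => ?_
    have := hs h
    rw [mem_closedBall, dist_eq_norm] at this
    have h2 := (abs_le.1 ((Complex.abs_re_le_norm _).trans this)).1
    simp at h2; norm_num at h2
  have := abs_sub_le_re hf hs hK one_pos (show x₀.re - 4 ≤ z.re by linarith [hre.1]) him
  rw [h0, sub_zero] at this
  linarith [hre.2]

end Oscillation

/-- A radial cutoff on the unit disc. -/
def unitCutoff (z : ℂ) : ℝ := profile 2 (ellSq 0 1 1 z)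

/-- The cutoff adapted to the disc of centre `w` and radius `T`. -/
def cutoff (w : ℂ) (T : ℝ) (z : ℂ) : ℝ := unitCutoff (T⁻¹ • (z - w))

@[fun_prop] theorem smooth_unitCutoff : Smooth unitCutoff :=
  (contDiff_profile 2).comp (Smooth.ellSq 0 1 1)

theorem smooth_comp_homothety {f : ℂ → ℝ} (hf : Smooth f) (w : ℂ) (T : ℝ) :
    Smooth fun z => f (T⁻¹ • (z - w)) := hf.contDiff.comp (by fun_prop)

theorem fderiv_comp_homothety {f : ℂ → ℝ} (hf : Smooth f) (w : ℂ) (T : ℝ) (z v : ℂ) :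
    fderiv ℝ (fun z => f (T⁻¹ • (z - w))) z v = fderiv ℝ f (T⁻¹ • (z - w)) v / T := by
  have h1 : HasFDerivAt (fun z : ℂ => T⁻¹ • (z - w)) (T⁻¹ • ContinuousLinearMap.id ℝ ℂ) z :=
    ((hasFDerivAt_id z).sub_const w).const_smul T⁻¹
  have h2 := (hf.differentiableAt (z := T⁻¹ • (z - w))).hasFDerivAt.comp z h1
  have h3 := h2.fderiv
  rw [show (fun z => f (T⁻¹ • (z - w))) = f ∘ fun z : ℂ => T⁻¹ • (z - w) from rfl, h3]
  simp [div_eq_inv_mul]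

theorem dx_comp_homothety {f : ℂ → ℝ} (hf : Smooth f) (w : ℂ) (T : ℝ) :
    dx (fun z => f (T⁻¹ • (z - w))) = fun z => dx f (T⁻¹ • (z - w)) / T :=
  funext fun z => fderiv_comp_homothety hf w T z 1

theorem dy_comp_homothety {f : ℂ → ℝ} (hf : Smooth f) (w : ℂ) (T : ℝ) :
    dy (fun z => f (T⁻¹ • (z - w))) = fun z => dy f (T⁻¹ • (z - w)) / T :=
  funext fun z => fderiv_comp_homothety hf w T z Complex.I

section Cutoff

@[fun_prop] theorem smooth_cutoff (w : ℂ) (T : ℝ) : Smooth (cutoff w T) :=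
  smooth_comp_homothety smooth_unitCutoff w T

theorem cutoff_nonneg (w : ℂ) (T : ℝ) (z : ℂ) : 0 ≤ cutoff w T z := profile_nonneg _ _

theorem cutoff_le_one (w : ℂ) (T : ℝ) (z : ℂ) : cutoff w T z ≤ 1 := profile_le_one _ _

theorem norm_homothety (w : ℂ) {T : ℝ} (hT : 0 < T) (z : ℂ) : ‖T⁻¹ • (z - w)‖ = ‖z - w‖ / T := by
  rw [norm_smul, norm_inv, Real.norm_of_nonneg hT.le, div_eq_inv_mul]

theorem cutoff_eq_one (w : ℂ) {T : ℝ} (hT : 0 < T) {z : ℂ} (h : 2 * ‖z - w‖ ^ 2 ≤ T ^ 2) :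
    cutoff w T z = 1 := by
  apply profile_eq_one
  rw [ellSq_one_eq, sub_zero, norm_homothety w hT, div_pow]
  have : ‖z - w‖ ^ 2 / T ^ 2 ≤ 1 / 2 := by rw [div_le_iff₀ (by positivity)]; linarith
  linarith

theorem cutoff_eq_zero (w : ℂ) {T : ℝ} (hT : 0 < T) {z : ℂ} (h : T ≤ ‖z - w‖) :
    cutoff w T z = 0 := by
  apply profile_eq_zero
  rw [ellSq_one_eq, sub_zero, norm_homothety w hT]
  exact one_le_pow₀ ((one_le_div hT).2 h)

theorem tsupport_cutoff (w : ℂ) {T : ℝ} (hT : 0 < T) : tsupport (cutoff w T) ⊆ closedBall w T := by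
  refine closure_minimal (fun z hz => ?_) isClosed_closedBall
  by_contra h
  rw [mem_closedBall, dist_eq_norm, not_le] at h
  exact hz (cutoff_eq_zero w hT h.le)

theorem hasCompactSupport_cutoff (w : ℂ) {T : ℝ} (hT : 0 < T) : HasCompactSupport (cutoff w T) :=
  HasCompactSupport.of_support_subset_isCompact (isCompact_closedBall w T)
    ((subset_tsupport _).trans (tsupport_cutoff w hT))

end Cutoff

theorem hasCompactSupport_unitCutoff : HasCompactSupport unitCutoff := by
  have h := hasCompactSupport_cutoff 0 one_pos
  have e : cutoff 0 1 = unitCutoff := by funext z; simp [cutoff]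
  rwa [e] at h

theorem exists_cutoff_bound : ∃ D : ℝ, 0 ≤ D ∧ ∀ w T, 0 < T → ∀ z,
    |dx (cutoff w T) z| ≤ D / T ∧ |dy (cutoff w T) z| ≤ D / T ∧
    |dx (dx (cutoff w T)) z + dy (dy (cutoff w T)) z| ≤ D / T ^ 2 := by
  have hs := smooth_unitCutoff
  have hc := hasCompactSupport_unitCutoff
  obtain ⟨D1, h1⟩ := (hc.dx).exists_bound_of_continuous hs.dx.continuous
  obtain ⟨D2, h2⟩ := (hc.dy).exists_bound_of_continuous hs.dy.continuous
  obtain ⟨D3, h3⟩ := (HasCompactSupport.add hc.dx.dx hc.dy.dy).exists_bound_of_continuous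
    (hs.dx.dx.continuous.add hs.dy.dy.continuous)
  have n1 := (norm_nonneg _).trans (h1 0)
  have n2 := (norm_nonneg _).trans (h2 0)
  have n3 := (norm_nonneg _).trans (h3 0)
  refine ⟨D1 + D2 + D3, by positivity, fun w T hT z => ?_⟩
  have e1 : dx (cutoff w T) = fun z => dx unitCutoff (T⁻¹ • (z - w)) / T :=
    dx_comp_homothety hs w T
  have e2 : dy (cutoff w T) = fun z => dy unitCutoff (T⁻¹ • (z - w)) / T :=
    dy_comp_homothety hs w T
  have e11 : dx (dx (cutoff w T)) z = dx (dx unitCutoff) (T⁻¹ • (z - w)) / T / T := by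
    rw [e1, dx_div_const _ ((smooth_comp_homothety hs.dx w T).differentiableAt),
      dx_comp_homothety hs.dx w T]
  have e22 : dy (dy (cutoff w T)) z = dy (dy unitCutoff) (T⁻¹ • (z - w)) / T / T := by
    rw [e2, dy_div_const _ ((smooth_comp_homothety hs.dy w T).differentiableAt),
      dy_comp_homothety hs.dy w T]
  refine ⟨?_, ?_, ?_⟩
  · rw [e1]; simp only [abs_div, abs_of_pos hT]
    gcongr
    exact (h1 _).trans (by linarith)
  · rw [e2]; simp only [abs_div, abs_of_pos hT]
    gcongr
    exact (h2 _).trans (by linarith)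
  · rw [e11, e22, ← add_div, ← add_div, div_div, abs_div, ← sq, abs_of_pos (pow_pos hT 2)]
    gcongr
    exact (h3 _).trans (by linarith)

theorem laplacian_mul {χ f : ℂ → ℝ} (hχ : Smooth χ) (hf : Smooth f) (z : ℂ) :
    dx (dx fun z => χ z * f z) z + dy (dy fun z => χ z * f z) z =
      χ z * (dx (dx f) z + dy (dy f) z) + 2 * (dx χ z * dx f z + dy χ z * dy f z)
        + (dx (dx χ) z + dy (dy χ) z) * f z := by
  have e1 : dx (fun z => χ z * f z) = fun z => χ z * dx f z + dx χ z * f z := by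
    funext z; simp (disch := fun_prop) only [dx_mul]; try ring
  have e2 : dy (fun z => χ z * f z) = fun z => χ z * dy f z + dy χ z * f z := by
    funext z; simp (disch := fun_prop) only [dy_mul]; try ring
  rw [e1, e2]
  simp (disch := fun_prop) only [dx_add, dy_add, dx_mul, dy_mul]
  ring

theorem sq_laplacian_density {c χ a η q G a1 a2 χ1 χ2 L D : ℝ} (hc : c ^ 2 ≤ 1) (hχ : χ ^ 2 ≤ 1)
    (ha : a ^ 2 ≤ 1 - η) (hq : q ^ 2 ≤ G) (hg : a1 ^ 2 + a2 ^ 2 ≤ G)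
    (h1 : χ1 ^ 2 ≤ D ^ 2) (h2 : χ2 ^ 2 ≤ D ^ 2) (hL : L ^ 2 ≤ D ^ 2) :
    (χ * (c * q - η * a) + 2 * (χ1 * a1 + χ2 * a2) + L * a) ^ 2
      ≤ 4 * (χ ^ 2 * ((1 - η) * η ^ 2))
        + ((4 + 32 * D ^ 2) * G + 4 * D ^ 2 * η ^ 2 + 8 * D ^ 2) := by
  have hη : 0 ≤ 1 - η := (sq_nonneg a).trans ha
  have hG : 0 ≤ G := (sq_nonneg q).trans hq
  have k1 : (χ * (c * q)) ^ 2 ≤ G := by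
    have : χ ^ 2 * c ^ 2 ≤ 1 := mul_le_one₀ hχ (sq_nonneg _) hc
    calc (χ * (c * q)) ^ 2 = (χ ^ 2 * c ^ 2) * q ^ 2 := by ring
      _ ≤ 1 * G := by gcongr
      _ = G := one_mul G
  have k2 : (χ * (η * a)) ^ 2 ≤ χ ^ 2 * ((1 - η) * η ^ 2) := by
    calc (χ * (η * a)) ^ 2 = χ ^ 2 * (a ^ 2 * η ^ 2) := by ring
      _ ≤ _ := by gcongr
  have k3 : (χ1 * a1 + χ2 * a2) ^ 2 ≤ 2 * D ^ 2 * G := by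
    calc (χ1 * a1 + χ2 * a2) ^ 2 ≤ (χ1 ^ 2 + χ2 ^ 2) * (a1 ^ 2 + a2 ^ 2) := by
          nlinarith [sq_nonneg (χ1 * a2 - χ2 * a1)]
      _ ≤ (D ^ 2 + D ^ 2) * G := by gcongr
      _ = _ := by ring
  have k4 : (L * a) ^ 2 ≤ D ^ 2 * (2 + η ^ 2) := by
    calc (L * a) ^ 2 = L ^ 2 * a ^ 2 := by ring
      _ ≤ D ^ 2 * (1 - η) := by gcongr
      _ ≤ _ := by gcongr; nlinarith [sq_nonneg (η + 1)]
  have k5 : ∀ p q r s : ℝ,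
      (p - q + 2 * r + s) ^ 2 ≤ 4 * p ^ 2 + 4 * q ^ 2 + 16 * r ^ 2 + 4 * s ^ 2 := by
    intro p q r s
    nlinarith [sq_nonneg (p + q), sq_nonneg (p - 2 * r), sq_nonneg (p - s), sq_nonneg (q + 2 * r),
      sq_nonneg (q + s), sq_nonneg (2 * r - s)]
  have k6 := k5 (χ * (c * q)) (χ * (η * a)) (χ1 * a1 + χ2 * a2) (L * a)
  have k7 : χ * (c * q - η * a) + 2 * (χ1 * a1 + χ2 * a2) + L * a
      = χ * (c * q) - χ * (η * a) + 2 * (χ1 * a1 + χ2 * a2) + L * a := by ring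
  rw [k7]
  nlinarith

theorem integral_dxdy_cutoff_le {c D C : ℝ} {x₀ : ℂ} {χ a η q G j : ℂ → ℝ} (hc : c ^ 2 ≤ 1)
    (hχ : Smooth χ) (hcs : tsupport χ ⊆ closedBall x₀ 3) (hχ1 : ∀ z, χ z ^ 2 ≤ 1)
    (ha : Smooth a) (hη : Smooth η) (hG : Smooth G)
    (hD1 : ∀ z, dx χ z ^ 2 ≤ D ^ 2) (hD2 : ∀ z, dy χ z ^ 2 ≤ D ^ 2)
    (hD3 : ∀ z, (dx (dx χ) z + dy (dy χ) z) ^ 2 ≤ D ^ 2)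
    (hj : ∀ z, j z ^ 2 ≤ (1 - η z) * G z)
    (hL : ∀ z, dx (dx η) z + dy (dy η) z
      = -2 * G z + 2 * (1 - η z) * η z - 2 * c * j z)
    (haη : ∀ z, a z ^ 2 ≤ 1 - η z) (hq : ∀ z, q z ^ 2 ≤ G z)
    (hg : ∀ z, dx a z ^ 2 + dy a z ^ 2 ≤ G z)
    (hΔ : ∀ z, dx (dx a) z + dy (dy a) z = c * q z - η z * a z)
    (hC : ∫ z in closedBall x₀ 3, (G z + η z ^ 2) ≤ C) :
    ∫ z, dx (dy fun z => χ z * a z) z ^ 2 ≤ (16 + 48 * D ^ 2) * C + 72 * Real.pi * D ^ 2 := by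
  set B := closedBall x₀ 3 with hB
  have h1 : ∀ z, 0 ≤ 1 - η z := fun z => (sq_nonneg _).trans (haη z)
  have h2 : ∀ z, 0 ≤ G z := fun z => (sq_nonneg _).trans (hq z)
  have hcc : HasCompactSupport χ := HasCompactSupport.of_support_subset_isCompact
    (isCompact_closedBall x₀ 3) ((subset_tsupport χ).trans hcs)
  have iB : ∀ {g : ℂ → ℝ}, Continuous g → IntegrableOn g B := fun hg =>
    hg.continuousOn.integrableOn_compact (isCompact_closedBall x₀ 3)
  have off : ∀ {z}, z ∉ B → z ∉ tsupport χ := fun hz h => hz (hcs h)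
  have full : ∀ {g : ℂ → ℝ}, (∀ z, z ∉ B → g z = 0) → ∫ z, g z = ∫ z in B, g z := fun h =>
    (setIntegral_eq_integral_of_forall_compl_eq_zero h).symm
  have z0 : ∀ z, z ∉ B → χ z = 0 := fun z hz => image_eq_zero_of_notMem_tsupport (off hz)
  have z1 : ∀ z, z ∉ B → dx χ z = 0 := fun z hz => dx_eq_zero_of_notMem (off hz)
  have z2 : ∀ z, z ∉ B → dy χ z = 0 := fun z hz => dy_eq_zero_of_notMem (off hz)
  have i0 : IntegrableOn (fun z => G z + η z ^ 2) B := iB (by fun_prop)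
  have hC0 : 0 ≤ C := (setIntegral_nonneg measurableSet_closedBall fun z _ =>
    add_nonneg (h2 z) (sq_nonneg _)).trans hC
  have cac := integral_caccioppoli_le hχ hcc hη hG h1 h2 hj hL
  rw [full (fun z hz => by simp [z0 z hz]), full (fun z hz => by simp [z0 z hz, z1 z hz, z2 z hz])]
    at cac
  have cac2 : ∫ z in B, ((2 + c ^ 2) * (χ z ^ 2 * G z) + (dx χ z ^ 2 + dy χ z ^ 2) * η z ^ 2)
      ≤ ∫ z in B, (3 + 2 * D ^ 2) * (G z + η z ^ 2) := by
    refine setIntegral_mono (iB (by fun_prop)) (i0.const_mul _) fun z => ?_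
    have e1 : (2 + c ^ 2) * (χ z ^ 2 * G z) ≤ 3 * G z := by
      have := mul_le_of_le_one_left (h2 z) (hχ1 z)
      have p : 0 ≤ χ z ^ 2 * G z := mul_nonneg (sq_nonneg _) (h2 z)
      nlinarith
    have e2 : (dx χ z ^ 2 + dy χ z ^ 2) * η z ^ 2 ≤ (D ^ 2 + D ^ 2) * η z ^ 2 := by
      exact mul_le_mul_of_nonneg_right (add_le_add (hD1 z) (hD2 z)) (sq_nonneg _)
    have p1 := mul_nonneg (sq_nonneg D) (h2 z)
    nlinarith [sq_nonneg (η z)]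
  rw [integral_const_mul] at cac2
  have m := integral_dxdy_sq_le (hχ.mul ha) hcc.mul_right
  refine m.trans ?_
  have zs : ∀ z, z ∉ B → dx (dx χ) z + dy (dy χ) z = 0 := fun z hz => by
    rw [dx_eq_zero_of_notMem (f := dx χ) fun h => off hz (tsupport_fderiv_apply_subset ℝ (1 : ℂ) h),
      dy_eq_zero_of_notMem (f := dy χ) fun h => off hz (tsupport_fderiv_apply_subset ℝ Complex.I h),
      add_zero]
  rw [full (fun z hz => by rw [laplacian_mul hχ ha, zs z hz, z0 z hz, z1 z hz, z2 z hz]; simp)]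
  have j1 : IntegrableOn (fun z => χ z ^ 2 * ((1 - η z) * η z ^ 2)) B := iB (by fun_prop)
  have j2 : IntegrableOn (fun z => (4 + 32 * D ^ 2) * G z + 4 * D ^ 2 * η z ^ 2 + 8 * D ^ 2) B :=
    iB (by fun_prop)
  have j3 : IntegrableOn (fun z => (4 + 36 * D ^ 2) * (G z + η z ^ 2)) B := i0.const_mul _
  have m2 : ∫ z in B, (dx (dx fun z => χ z * a z) z + dy (dy fun z => χ z * a z) z) ^ 2
      ≤ ∫ z in B, (4 * (χ z ^ 2 * ((1 - η z) * η z ^ 2))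
        + ((4 + 36 * D ^ 2) * (G z + η z ^ 2) + 8 * D ^ 2)) := by
    refine setIntegral_mono (iB (by fun_prop)) ((j1.const_mul 4).add (j3.add (iB (by fun_prop))))
      fun z => ?_
    have := sq_laplacian_density hc (hχ1 z) (haη z) (hq z) (hg z) (hD1 z) (hD2 z) (hD3 z)
    simp only
    rw [laplacian_mul hχ ha, hΔ z]
    refine this.trans ?_
    have p1 := mul_nonneg (sq_nonneg D) (h2 z)
    nlinarith [sq_nonneg (η z), mul_nonneg (sq_nonneg D) (sq_nonneg (η z))]
  have jc : IntegrableOn (fun _ : ℂ => 8 * D ^ 2) B := iB (by fun_prop)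
  have ja : IntegrableOn (fun z => 4 * (χ z ^ 2 * ((1 - η z) * η z ^ 2))) B := j1.const_mul 4
  have jb : IntegrableOn (fun z => (4 + 36 * D ^ 2) * (G z + η z ^ 2) + 8 * D ^ 2) B := j3.add jc
  rw [integral_add ja jb, integral_add j3 jc, integral_const_mul, integral_const_mul,
    setIntegral_const] at m2
  have vol : volume.real B = 9 * Real.pi := by
    rw [Measure.real, hB, Complex.volume_closedBall]
    simp; ring
  rw [vol, smul_eq_mul] at m2
  have f1 : (3 + 2 * D ^ 2) * ∫ z in B, (G z + η z ^ 2) ≤ (3 + 2 * D ^ 2) * C := by gcongr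
  have f2 : (4 + 36 * D ^ 2) * ∫ z in B, (G z + η z ^ 2) ≤ (4 + 36 * D ^ 2) * C := by gcongr
  nlinarith [mul_nonneg (sq_nonneg D) hC0]

theorem GP.exists_dxdy_bound (C : ℝ) : ∃ K : ℝ, 0 < K ∧ ∀ c a b x₀, GP c a b → 0 ≤ c → c ≤ 1 →
    ∫ z in closedBall x₀ 3, en a b z ≤ C →
    ∫ z, dx (dy fun z => cutoff x₀ 3 z * a z) z ^ 2 ≤ K ∧
    ∫ z, dx (dy fun z => cutoff x₀ 3 z * b z) z ^ 2 ≤ K := by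
  obtain ⟨D, hD, hbd⟩ := exists_cutoff_bound
  refine ⟨|(16 + 48 * D ^ 2) * (4 * C) + 72 * Real.pi * D ^ 2| + 1, by positivity,
    fun c a b x₀ h hc0 hc1 hC => ?_⟩
  have ha := h.sa
  have hb := h.sb
  have hχ1 : ∀ z, cutoff x₀ 3 z ^ 2 ≤ 1 := fun z =>
    pow_le_one₀ (cutoff_nonneg x₀ 3 z) (cutoff_le_one x₀ 3 z)
  have sqle : ∀ {x y : ℝ}, |x| ≤ y → y ≤ D → x ^ 2 ≤ D ^ 2 := fun {x y} hx hy => by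
    rw [← sq_abs]; exact pow_le_pow_left₀ (abs_nonneg x) (hx.trans hy) 2
  have hD1 : ∀ z, dx (cutoff x₀ 3) z ^ 2 ≤ D ^ 2 := fun z =>
    sqle (hbd x₀ 3 (by norm_num) z).1 (by linarith)
  have hD2 : ∀ z, dy (cutoff x₀ 3) z ^ 2 ≤ D ^ 2 := fun z =>
    sqle (hbd x₀ 3 (by norm_num) z).2.1 (by linarith)
  have hD3 : ∀ z, (dx (dx (cutoff x₀ 3)) z + dy (dy (cutoff x₀ 3)) z) ^ 2 ≤ D ^ 2 := fun z =>
    sqle (hbd x₀ 3 (by norm_num) z).2.2 (by linarith)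
  have hG : ∫ z in closedBall x₀ 3, (gsq a b z + eta a b z ^ 2) ≤ 4 * C := by
    have i1 : IntegrableOn (en a b) (closedBall x₀ 3) :=
      (ha.en hb).continuous.continuousOn.integrableOn_compact (isCompact_closedBall x₀ 3)
    have i2 : IntegrableOn (fun z => gsq a b z + eta a b z ^ 2) (closedBall x₀ 3) :=
      ((ha.gsq hb).continuous.add ((ha.eta hb).continuous.pow 2)).continuousOn.integrableOn_compact
        (isCompact_closedBall x₀ 3)
    calc _ ≤ ∫ z in closedBall x₀ 3, 4 * en a b z := by
          refine setIntegral_mono i2 (i1.const_mul 4) fun z => ?_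
          have := gsq_nonneg a b z
          simp only [en]; linarith
      _ ≤ 4 * C := by rw [integral_const_mul]; linarith
  have hc2 : c ^ 2 ≤ 1 := pow_le_one₀ hc0 hc1
  constructor
  · refine (integral_dxdy_cutoff_le (q := dy b) hc2 (smooth_cutoff x₀ 3)
      (tsupport_cutoff x₀ (by norm_num)) hχ1 ha (ha.eta hb) (ha.gsq hb) hD1 hD2 hD3
      (cur2_sq_le a b) h.laplacian_eta ?_ ?_ ?_ ?_ hG).trans
      ((le_abs_self _).trans (le_add_of_nonneg_right zero_le_one))
    · intro z; unfold eta; nlinarith [sq_nonneg (b z)]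
    · intro z; unfold gsq; nlinarith [sq_nonneg (dx a z), sq_nonneg (dy a z), sq_nonneg (dx b z)]
    · intro z; unfold gsq; nlinarith [sq_nonneg (dx b z), sq_nonneg (dy b z)]
    · intro z; rw [h.eqa, eta]
  · refine (integral_dxdy_cutoff_le (q := fun z => -dy a z) hc2 (smooth_cutoff x₀ 3)
      (tsupport_cutoff x₀ (by norm_num)) hχ1 hb (ha.eta hb) (ha.gsq hb) hD1 hD2 hD3
      (cur2_sq_le a b) h.laplacian_eta ?_ ?_ ?_ ?_ hG).trans
      ((le_abs_self _).trans (le_add_of_nonneg_right zero_le_one))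
    · intro z; unfold eta; nlinarith [sq_nonneg (a z)]
    · intro z; unfold gsq; nlinarith [sq_nonneg (dx a z), sq_nonneg (dx b z), sq_nonneg (dy b z)]
    · intro z; unfold gsq; nlinarith [sq_nonneg (dx a z), sq_nonneg (dy a z)]
    · intro z; rw [h.eqb, eta]; ring

theorem GP.exists_abs_eta_le (C : ℝ) : ∃ δ : ℝ, 0 < δ ∧ ∀ c a b x₀, GP c a b → 0 ≤ c → c ≤ 1 →
    ∫ z in closedBall x₀ 3, en a b z ≤ C →
    ∫ z in closedBall x₀ 3, eta a b z ^ 2 ≤ δ → |eta a b x₀| ≤ 1 / 10 := by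
  obtain ⟨K, hK, hbd⟩ := GP.exists_dxdy_bound C
  set M := K / 2 + 32 with hM
  have hM0 : 32 < M := by rw [hM]; linarith
  set κ := 160 * M * K with hκ
  have hκ0 : 0 < κ := by positivity
  obtain ⟨s, hs0, hs1, hsκ⟩ : ∃ s : ℝ, 0 < s ∧ s ≤ 1 ∧ 8 * κ * s ≤ 1 / (160 * M) :=
    ⟨min 1 (1 / (160 * M) / (8 * κ)), by positivity, min_le_left _ _, by
      calc _ ≤ 8 * κ * (1 / (160 * M) / (8 * κ)) := by gcongr; exact min_le_right _ _
        _ = _ := by field_simp⟩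
  refine ⟨Real.pi * s ^ 2 / 800, by positivity, fun c a b x₀ h hc0 hc1 hC hδ => ?_⟩
  obtain ⟨ka, kb⟩ := hbd c a b x₀ h hc0 hc1 hC
  have key : ∀ f : ℂ → ℝ, Smooth f → ∫ z, dx (dy fun z => cutoff x₀ 3 z * f z) z ^ 2 ≤ K →
      ∀ z ∈ closedBall x₀ s, |f z ^ 2 - f x₀ ^ 2| ≤ 1 / 40 := by
    intro f hf hfK z hz
    have hzs : ‖z - x₀‖ ≤ s := by rwa [mem_closedBall, dist_eq_norm] at hz
    have sub : tsupport (fun z => cutoff x₀ 3 z * f z) ⊆ closedBall x₀ 3 :=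
      (closure_mono (Function.support_mul_subset_left (cutoff x₀ 3) f)).trans
        (tsupport_cutoff x₀ (by norm_num))
    have hsm : Smooth fun z => cutoff x₀ 3 z * f z := (smooth_cutoff x₀ 3).mul hf
    have z4 : z ∈ closedBall x₀ 4 := closedBall_subset_closedBall (by linarith) hz
    have x4 : x₀ ∈ closedBall x₀ 4 := mem_closedBall_self (by norm_num)
    have b1 := abs_sub_le_norm hsm sub hfK hκ0 z4
    have b2 := abs_le_of_integral_dxdy_sq hsm sub hfK z4
    have b3 := abs_le_of_integral_dxdy_sq hsm sub hfK x4
    have o1 : cutoff x₀ 3 z = 1 :=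
      cutoff_eq_one x₀ (by norm_num) (by nlinarith [norm_nonneg (z - x₀)])
    have o2 : cutoff x₀ 3 x₀ = 1 := cutoff_eq_one x₀ (by norm_num) (by simp)
    simp only [o1, o2, one_mul] at b1 b2 b3
    have e1 : K / κ = 1 / (160 * M) := by rw [hκ]; field_simp
    have e2 : 8 * κ * ‖z - x₀‖ ≤ 1 / (160 * M) := hsκ.trans' (by gcongr)
    have e3 : |f z - f x₀| ≤ 1 / (80 * M) := b1.trans (by
      rw [e1]; refine (add_le_add_right e2 _).trans (le_of_eq ?_); field_simp; norm_num)
    have e4 : |f z + f x₀| ≤ 2 * M := (abs_add_le _ _).trans (by linarith)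
    calc |f z ^ 2 - f x₀ ^ 2| = |f z + f x₀| * |f z - f x₀| := by rw [sq_sub_sq, abs_mul]
      _ ≤ 2 * M * (1 / (80 * M)) := by gcongr
      _ = 1 / 40 := by field_simp; norm_num
  by_contra hlt
  rw [not_le] at hlt
  have low : ∀ z ∈ closedBall x₀ s, 1 / 400 ≤ eta a b z ^ 2 := by
    intro z hz
    have h1 := key a h.sa ka z hz
    have h2 := key b h.sb kb z hz
    have h3 : |eta a b x₀ - eta a b z| ≤ 1 / 20 := by
      have e : eta a b x₀ - eta a b z = (a z ^ 2 - a x₀ ^ 2) + (b z ^ 2 - b x₀ ^ 2) := by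
        unfold eta; ring
      rw [e]; exact (abs_add_le _ _).trans (by linarith)
    have h4 : 1 / 20 ≤ |eta a b z| := by
      have := abs_sub_abs_le_abs_sub (eta a b x₀) (eta a b z)
      linarith
    rw [← sq_abs]; nlinarith
  have ic : Continuous fun z => eta a b z ^ 2 := (h.sa.eta h.sb).continuous.pow 2
  have i3 : IntegrableOn (fun z => eta a b z ^ 2) (closedBall x₀ 3) :=
    ic.continuousOn.integrableOn_compact (isCompact_closedBall x₀ 3)
  have i1 : ∫ z in closedBall x₀ s, eta a b z ^ 2 ≤ ∫ z in closedBall x₀ 3, eta a b z ^ 2 :=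
    setIntegral_mono_set i3 (.of_forall fun z => sq_nonneg _)
      (closedBall_subset_closedBall (by linarith)).eventuallyLE
  have i2 : ∫ z in closedBall x₀ s, (1 / 400 : ℝ) ≤ ∫ z in closedBall x₀ s, eta a b z ^ 2 :=
    setIntegral_mono_on (continuousOn_const.integrableOn_compact (isCompact_closedBall x₀ s))
      (ic.continuousOn.integrableOn_compact (isCompact_closedBall x₀ s))
      measurableSet_closedBall low
  have vol : volume.real (closedBall x₀ s) = s ^ 2 * Real.pi := by
    rw [Measure.real, Complex.volume_closedBall]
    simp [hs0.le]
  rw [setIntegral_const, vol, smul_eq_mul] at i2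
  have : 0 < s ^ 2 * Real.pi := by positivity
  linarith

theorem farBound_pos {Λ : ℝ} (hΛ : 0 < Λ) : 0 < farBound Λ := by
  have : 0 ≤ Real.log (8 * (1 + 5 * Real.pi)) :=
    Real.log_nonneg (by linarith [Real.pi_pos])
  unfold farBound; positivity

theorem eventually_abs_eta_le (Λ : ℝ) (hΛ : 0 < Λ) : ∀ᶠ p in atTop, ∀ c a b m, GP c a b → 0 ≤ c →
    c * p ≤ 256 * energyBound Λ p → Integrable (en a b) →
    ∫ z in {z : ℂ | p / 2 ≤ ‖z - m‖}, en a b z ≤ farBound Λ →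
    c ≤ 1 / 10 ∧ ∀ x, 3 * p / 4 ≤ ‖x - m‖ → |eta a b x| ≤ 1 / 10 := by
  obtain ⟨δ, hδ, hη⟩ := GP.exists_abs_eta_le (farBound Λ)
  have hC := farBound_pos hΛ
  set C := farBound Λ with hCdef
  obtain ⟨ε, hε, hε1, hε2⟩ : ∃ ε : ℝ, 0 < ε ∧ 256 * ε ≤ 1 / 10 ∧ 8 * (256 * ε) * C ≤ δ / 2 :=
    ⟨min (1 / 2560) (δ / (4096 * C)), by positivity,
      by linarith [min_le_left (1 / 2560 : ℝ) (δ / (4096 * C))], by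
      calc _ ≤ 8 * (256 * (δ / (4096 * C))) * C := by gcongr; exact min_le_right _ _
        _ = δ / 2 := by field_simp; norm_num⟩
  have hlog : Tendsto (fun p : ℝ => Real.log (1 + p)) atTop atTop :=
    Real.tendsto_log_atTop.comp (tendsto_atTop_add_const_left _ 1 tendsto_id)
  filter_upwards [eventually_sq_log_le (2 * Real.pi) Λ (pow_pos hε 2), eventually_ge_atTop 10000,
    hlog.eventually_ge_atTop (128 * C / δ)] with p hp1 hp2 hp3 c a b m h hc0 hcp hi hfar
  have hp0 : 0 < p := by linarith
  set s := Real.sqrt p with hs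
  have hss : s * s = p := Real.mul_self_sqrt hp0.le
  have hs100 : 100 ≤ s := Real.le_sqrt_of_sq_le (by linarith)
  have hE : energyBound Λ p ≤ ε * s := by
    refine abs_le_of_sq_le_sq' ?_ (by positivity) |>.2
    rw [mul_pow, sq s, hss]; exact hp1
  have hcs : c * s ≤ 256 * ε := by
    have : c * s * s ≤ 256 * ε * s := by rw [mul_assoc, hss]; linarith
    exact le_of_mul_le_mul_right this (by linarith)
  have hc1 : c ≤ 1 / 10 := by nlinarith
  refine ⟨hc1, fun x hx => ?_⟩
  have sub : closedBall x s ⊆ {z : ℂ | p / 2 ≤ ‖z - m‖} := by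
    intro z hz
    rw [mem_closedBall, dist_comm, dist_eq_norm] at hz
    have : ‖x - m‖ ≤ ‖x - z‖ + ‖z - m‖ := norm_sub_le_norm_sub_add_norm_sub x z m
    have : s ≤ p / 4 := by nlinarith
    simp only [Set.mem_ofPred_eq]
    linarith
  have mono : ∀ r, r ≤ s → ∫ z in closedBall x r, en a b z ≤ C := fun r hr =>
    (setIntegral_mono_set hi.integrableOn (.of_forall fun z => en_nonneg a b z)
      ((closedBall_subset_closedBall hr).trans sub).eventuallyLE).trans hfar
  have hlog10 : 4 * Real.log 10 ≤ Real.log (1 + s ^ 2) := by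
    rw [sq, hss, show (4 : ℝ) * Real.log 10 = Real.log (10 ^ 4) by simp]
    exact Real.log_le_log (by norm_num) (by linarith)
  have hbd := h.integral_eta_sq_le hc0 x (by linarith : 0 < s) hlog10 (mono s le_rfl)
  refine hη c a b x h hc0 (by linarith) (mono 3 (by linarith)) (hbd.trans ?_)
  rw [sq, hss]
  have hl0 : 0 < Real.log (1 + p) := Real.log_pos (by linarith)
  have h1 : 8 * (8 / Real.log (1 + p)) * C ≤ δ / 2 := by
    rw [div_le_iff₀ hδ] at hp3
    rw [show 8 * (8 / Real.log (1 + p)) * C = 64 * C / Real.log (1 + p) by ring, div_le_iff₀ hl0]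
    linarith
  have h2 : 8 * (c * s) * C ≤ 8 * (256 * ε) * C := by gcongr
  linarith

/-- The annulus with radii `T / 2` and `T`. -/
def annulus (w : ℂ) (T : ℝ) : Set ℂ := {z | T / 2 ≤ ‖z - w‖ ∧ ‖z - w‖ < T}

theorem measurableSet_annulus (w : ℂ) (T : ℝ) : MeasurableSet (annulus w T) :=
  (measurableSet_le (f := fun _ : ℂ => T / 2) (g := fun z => ‖z - w‖) measurable_const
    (by fun_prop)).inter
    (measurableSet_lt (f := fun z : ℂ => ‖z - w‖) (g := fun _ => T) (by fun_prop) measurable_const)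

theorem integrableOn_annulus (w : ℂ) (T : ℝ) {f : ℂ → ℝ} (hf : Continuous f) :
    IntegrableOn f (annulus w T) :=
  (hf.continuousOn.integrableOn_compact (isCompact_closedBall w T)).mono_set fun z hz => by
    rw [mem_closedBall, dist_eq_norm]; exact hz.2.le

/-- The radial slope of the cutoff function. -/
def cutoffSlope (T s : ℝ) : ℝ := deriv (profile 2) ((s / T) ^ 2) * (2 / T ^ 2)

theorem ellSq_eq_sq (w : ℂ) (T : ℝ) (z : ℂ) : ellSq w T T z = (‖z - w‖ / T) ^ 2 := by
  rw [div_pow, Complex.sq_norm, Complex.normSq_apply, Complex.sub_re, Complex.sub_im, ellSq]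
  ring

theorem cutoff_eq_profile (w : ℂ) {T : ℝ} (hT : 0 < T) :
    cutoff w T = fun z => profile 2 (ellSq w T T z) := by
  funext z
  rw [cutoff, unitCutoff, ellSq_one_eq, sub_zero, norm_homothety w hT, ellSq_eq_sq]

theorem dx_cutoff (w : ℂ) {T : ℝ} (hT : 0 < T) (z : ℂ) :
    dx (cutoff w T) z = cutoffSlope T ‖z - w‖ * (z.re - w.re) := by
  rw [cutoff_eq_profile w hT, dx_comp ((contDiff_profile 2).differentiable (by simp) _)
    (Smooth.ellSq w T T).differentiableAt, dx_ellSq, ellSq_eq_sq, cutoffSlope]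
  ring

theorem dy_cutoff (w : ℂ) {T : ℝ} (hT : 0 < T) (z : ℂ) :
    dy (cutoff w T) z = cutoffSlope T ‖z - w‖ * (z.im - w.im) := by
  rw [cutoff_eq_profile w hT, dy_comp ((contDiff_profile 2).differentiable (by simp) _)
    (Smooth.ellSq w T T).differentiableAt, dy_ellSq, ellSq_eq_sq, cutoffSlope]
  ring

theorem cutoffSlope_eq_zero {T s : ℝ} (hT : 0 < T) (hs : 0 ≤ s) (h : ¬ (T / 2 ≤ s ∧ s < T)) :
    cutoffSlope T s = 0 := by
  have hd : deriv (profile 2) ((s / T) ^ 2) = 0 := by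
    rw [not_and_or, not_le, not_lt] at h
    rcases h with h | h
    · have h1 : profile 2 ((s / T) ^ 2) = 1 := profile_eq_one (by
        have : s / T ≤ 1 / 2 := by rw [div_le_iff₀ hT]; linarith
        have : 0 ≤ s / T := by positivity
        nlinarith)
      exact IsLocalMax.deriv_eq_zero (.of_forall fun σ => by rw [h1]; exact profile_le_one 2 σ)
    · have h1 : profile 2 ((s / T) ^ 2) = 0 :=
        profile_eq_zero 2 (one_le_pow₀ ((one_le_div hT).2 h))
      exact IsLocalMin.deriv_eq_zero (.of_forall fun σ => by rw [h1]; exact profile_nonneg 2 σ)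
  rw [cutoffSlope, hd, zero_mul]

theorem norm_ell_sub (w : ℂ) {t : ℝ} (ht : 0 ≤ t) (θ : ℝ) : ‖ell w t t θ - w‖ = t := by
  rw [← pow_left_inj₀ (norm_nonneg _) ht two_ne_zero, Complex.sq_norm, Complex.normSq_apply]
  simp only [Complex.sub_re, Complex.sub_im, ell_re, ell_im, add_sub_cancel_left]
  nlinarith [Real.sin_sq_add_cos_sq θ]

theorem abs_cutoffSlope_le {D : ℝ} (hD : ∀ w T, 0 < T → ∀ z, |dx (cutoff w T) z| ≤ D / T)
    {T t : ℝ} (hT : 0 < T) (ht : 0 < t) (htT : t ≤ T) : |cutoffSlope T t| * t ^ 2 ≤ D := by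
  have h := hD 0 T hT (ell 0 t t 0)
  rw [dx_cutoff 0 hT, norm_ell_sub 0 ht.le] at h
  simp only [ell_re, Real.cos_zero, mul_one, add_sub_cancel_left, abs_mul, abs_of_pos ht] at h
  rw [le_div_iff₀ hT] at h
  calc |cutoffSlope T t| * t ^ 2 = |cutoffSlope T t| * t * t := by ring
    _ ≤ |cutoffSlope T t| * t * T := by gcongr
    _ ≤ D := h

theorem abs_integral_stream_le {Ψ K1 K2 V1 V2 : ℂ → ℝ} (hΨ : Smooth Ψ) (h1 : Continuous K1)
    (h2 : Continuous K2) (g1 : Continuous V1) (g2 : Continuous V2)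
    (hx : ∀ z, dx Ψ z = -V2 z) (hy : ∀ z, dy Ψ z = V1 z)
    (w : ℂ) {t : ℝ} (ht : 0 ≤ t)
    (h0 : ∫ θ in (-Real.pi)..Real.pi,
      (-(Real.sin θ) * K1 (ell w t t θ) + Real.cos θ * K2 (ell w t t θ)) = 0) :
    |∫ θ in (-Real.pi)..Real.pi, Ψ (ell w t t θ) *
      (-(Real.sin θ) * K1 (ell w t t θ) + Real.cos θ * K2 (ell w t t θ))| ≤
      Real.pi * t * ringInt (fun z => V1 z ^ 2 + V2 z ^ 2 + (K1 z ^ 2 + K2 z ^ 2)) w t t := by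
  have hpi : -Real.pi ≤ Real.pi := by linarith [Real.pi_pos]
  have ce : Continuous fun θ => ell w t t θ := by fun_prop
  set q : ℝ → ℝ := fun θ => -(Real.sin θ) * K1 (ell w t t θ) + Real.cos θ * K2 (ell w t t θ) with hq
  set v : ℝ → ℝ := fun θ => Real.cos θ * V1 (ell w t t θ) + Real.sin θ * V2 (ell w t t θ) with hv
  have cq : Continuous q := by fun_prop
  have cv : Continuous v := by fun_prop
  have cΨ : Continuous fun θ => Ψ (ell w t t θ) := hΨ.continuous.comp ce
  have hder : ∀ θ, HasDerivAt (fun θ => Ψ (ell w t t θ)) (t * v θ) θ := fun θ => by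
    refine (hasDerivAt_ell_angle hΨ w t t θ).congr_deriv ?_
    rw [tang, hx, hy, hv]; ring
  have ii : ∀ g : ℝ → ℝ, Continuous g → IntervalIntegrable g volume (-Real.pi) Real.pi :=
    fun g hg => hg.intervalIntegrable _ _
  set P := ∫ θ in (-Real.pi)..Real.pi, |v θ| with hP
  set Q := ∫ θ in (-Real.pi)..Real.pi, |q θ| with hQ
  have osc : ∀ θ ∈ Set.Icc (-Real.pi) Real.pi,
      |Ψ (ell w t t θ) - Ψ (ell w t t (-Real.pi))| ≤ t * P := by
    intro θ hθ
    rw [← intervalIntegral.integral_eq_sub_of_hasDerivAt (fun x _ => hder x)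
      ((cv.const_mul t).intervalIntegrable _ _), intervalIntegral.integral_const_mul, abs_mul,
      abs_of_nonneg ht]
    gcongr
    refine (intervalIntegral.abs_integral_le_integral_abs hθ.1).trans ?_
    exact intervalIntegral.integral_mono_interval le_rfl hθ.1 hθ.2
      (.of_forall fun _ => abs_nonneg _) (cv.abs.intervalIntegrable _ _)
  have e : ∫ θ in (-Real.pi)..Real.pi, Ψ (ell w t t θ) * q θ
      = ∫ θ in (-Real.pi)..Real.pi, (Ψ (ell w t t θ) - Ψ (ell w t t (-Real.pi))) * q θ := by
    simp only [sub_mul]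
    rw [intervalIntegral.integral_sub (ii (fun θ => Ψ (ell w t t θ) * q θ) (cΨ.mul cq))
      (ii (fun θ => Ψ (ell w t t (-Real.pi)) * q θ) (cq.const_mul _)),
      intervalIntegral.integral_const_mul, h0,
      mul_zero, sub_zero]
  have b1 : |∫ θ in (-Real.pi)..Real.pi, Ψ (ell w t t θ) * q θ| ≤ t * P * Q := by
    rw [e, hQ, ← intervalIntegral.integral_const_mul]
    refine (intervalIntegral.abs_integral_le_integral_abs hpi).trans ?_
    refine intervalIntegral.integral_mono_on hpi
      (((cΨ.sub continuous_const).mul cq).abs.intervalIntegrable _ _)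
      ((cq.abs.const_mul _).intervalIntegrable _ _) fun θ hθ => ?_
    rw [abs_mul]
    exact mul_le_mul_of_nonneg_right (osc θ hθ) (abs_nonneg _)
  have cs : ∀ g : ℝ → ℝ, Continuous g → (∫ θ in (-Real.pi)..Real.pi, |g θ|) ^ 2
      ≤ 2 * Real.pi * ∫ θ in (-Real.pi)..Real.pi, g θ ^ 2 := by
    intro g hg
    set N := ∫ θ in (-Real.pi)..Real.pi, |g θ| with hN
    have hp : 0 < 2 * Real.pi := by positivity
    have h : 0 ≤ ∫ θ in (-Real.pi)..Real.pi, (|g θ| - N / (2 * Real.pi)) ^ 2 :=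
      intervalIntegral.integral_nonneg hpi fun _ _ => sq_nonneg _
    have ex : ∀ θ, (|g θ| - N / (2 * Real.pi)) ^ 2
        = g θ ^ 2 - 2 * (N / (2 * Real.pi)) * |g θ| + (N / (2 * Real.pi)) ^ 2 := fun θ => by
      rw [← sq_abs (g θ)]; ring
    simp only [ex] at h
    rw [intervalIntegral.integral_add
      (ii (fun θ => g θ ^ 2 - 2 * (N / (2 * Real.pi)) * |g θ|) (by fun_prop))
      (ii (fun _ => (N / (2 * Real.pi)) ^ 2) continuous_const),
      intervalIntegral.integral_sub (ii (fun θ => g θ ^ 2) (hg.pow 2))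
      (ii (fun θ => 2 * (N / (2 * Real.pi)) * |g θ|) (by fun_prop)),
      intervalIntegral.integral_const_mul,
      intervalIntegral.integral_const, ← hN, smul_eq_mul] at h
    have e2 : (Real.pi - -Real.pi) * (N / (2 * Real.pi)) ^ 2 = N ^ 2 / (2 * Real.pi) := by
      field_simp; ring
    have e3 : 2 * (N / (2 * Real.pi)) * N = 2 * (N ^ 2 / (2 * Real.pi)) := by ring
    rw [e2, e3] at h
    have := (div_le_iff₀ hp).1 (by linarith :
      N ^ 2 / (2 * Real.pi) ≤ ∫ θ in (-Real.pi)..Real.pi, g θ ^ 2)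
    linarith
  have s1 := cs v cv
  have s2 := cs q cq
  have s3 : (∫ θ in (-Real.pi)..Real.pi, v θ ^ 2) + ∫ θ in (-Real.pi)..Real.pi, q θ ^ 2
      ≤ ringInt (fun z => V1 z ^ 2 + V2 z ^ 2 + (K1 z ^ 2 + K2 z ^ 2)) w t t := by
    rw [← intervalIntegral.integral_add (ii (fun θ => v θ ^ 2) (cv.pow 2))
      (ii (fun θ => q θ ^ 2) (cq.pow 2))]
    refine intervalIntegral.integral_mono_on hpi
      (((cv.pow 2).add (cq.pow 2)).intervalIntegrable _ _)
      (Continuous.intervalIntegrable (by fun_prop) _ _) fun θ _ => ?_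
    have sc := Real.sin_sq_add_cos_sq θ
    have rot : ∀ s c x y : ℝ, s ^ 2 + c ^ 2 = 1 → (c * x + s * y) ^ 2 ≤ x ^ 2 + y ^ 2 := by
      intro s c x y h
      nlinarith [sq_nonneg (s * x - c * y)]
    have r1 := rot _ _ (V1 (ell w t t θ)) (V2 (ell w t t θ)) sc
    have r2 := rot (-(Real.sin θ)) (Real.cos θ) (K2 (ell w t t θ)) (K1 (ell w t t θ))
      (by rw [neg_sq]; exact sc)
    simp only [hv, hq]
    linarith
  refine b1.trans ?_
  calc t * P * Q ≤ t * ((P ^ 2 + Q ^ 2) / 2) := by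
        rw [mul_assoc]; gcongr; nlinarith [sq_nonneg (P - Q)]
    _ ≤ t * (Real.pi * ringInt (fun z => V1 z ^ 2 + V2 z ^ 2 + (K1 z ^ 2 + K2 z ^ 2)) w t t) := by
        gcongr; nlinarith [Real.pi_pos]
    _ = _ := by ring

theorem ringInt_indicator (w : ℂ) (T : ℝ) (f : ℂ → ℝ) {t : ℝ} (ht : 0 ≤ t) :
    ringInt ((annulus w T).indicator f) w t t
      = if T / 2 ≤ t ∧ t < T then ringInt f w t t else 0 := by
  have hm : ∀ θ, ell w t t θ ∈ annulus w T ↔ T / 2 ≤ t ∧ t < T := fun θ => by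
    rw [annulus, Set.mem_ofPred_eq, norm_ell_sub w ht]
  unfold ringInt
  split_ifs with h
  · exact intervalIntegral.integral_congr fun θ _ => Set.indicator_of_mem ((hm θ).2 h) f
  · rw [← intervalIntegral.integral_zero (a := -Real.pi) (b := Real.pi)]
    exact intervalIntegral.integral_congr fun θ _ =>
      Set.indicator_of_notMem (fun h' => h ((hm θ).1 h')) f

theorem abs_integral_stream_cutoff_le {D : ℝ}
    (hD : ∀ w T, 0 < T → ∀ z, |dx (cutoff w T) z| ≤ D / T)
    {Ψ K1 K2 V1 V2 : ℂ → ℝ} (hΨ : Smooth Ψ) (h1 : Continuous K1)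
    (h2 : Continuous K2) (g1 : Continuous V1) (g2 : Continuous V2)
    (hx : ∀ z, dx Ψ z = -V2 z) (hy : ∀ z, dy Ψ z = V1 z) (w : ℂ)
    (h0 : ∀ t, ∫ θ in (-Real.pi)..Real.pi,
      (-(Real.sin θ) * K1 (ell w t t θ) + Real.cos θ * K2 (ell w t t θ)) = 0)
    {T : ℝ} (hT : 0 < T) :
    |∫ z, Ψ z * (dy (cutoff w T) z * K1 z - dx (cutoff w T) z * K2 z)| ≤
      Real.pi * D * ∫ z in annulus w T, (V1 z ^ 2 + V2 z ^ 2 + (K1 z ^ 2 + K2 z ^ 2)) := by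
  have hs := smooth_cutoff w T
  have hc := hasCompactSupport_cutoff w hT
  set S : ℂ → ℝ := fun z => V1 z ^ 2 + V2 z ^ 2 + (K1 z ^ 2 + K2 z ^ 2) with hS
  have cS : Continuous S := by fun_prop
  have nS : ∀ z, 0 ≤ S z := fun z => by positivity
  set F : ℂ → ℝ := fun z => Ψ z * (dy (cutoff w T) z * K1 z - dx (cutoff w T) z * K2 z) with hF
  have cF : Continuous F := hΨ.continuous.mul
    ((hs.dy.continuous.mul h1).sub (hs.dx.continuous.mul h2))
  have iF : Integrable F := cF.integrable_of_hasCompactSupport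
    ((hc.dy.mul_right.sub hc.dx.mul_right).mul_left)
  have mA := measurableSet_annulus w T
  have iS : Integrable ((annulus w T).indicator S) :=
    (integrable_indicator_iff mA).2 (integrableOn_annulus w T cS)
  have mS : Measurable ((annulus w T).indicator S) := cS.measurable.indicator mA
  have e1 := integral_ringInt w one_pos one_pos cF.measurable iF
  have e2 := integral_ringInt w one_pos one_pos mS iS
  have i2 := integrableOn_ringInt w one_pos one_pos mS iS
  simp only [one_mul] at e1 e2 i2
  rw [integral_indicator mA] at e2
  rw [← e1, ← e2, ← integral_const_mul]
  rw [← Real.norm_eq_abs]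
  refine norm_integral_le_of_norm_le (i2.const_mul _) ?_
  filter_upwards [ae_restrict_mem measurableSet_Ioi] with t ht
  have ht : 0 < t := ht
  have eq : ringInt F w t t = -(cutoffSlope T t * t) * ∫ θ in (-Real.pi)..Real.pi,
      Ψ (ell w t t θ) * (-(Real.sin θ) * K1 (ell w t t θ) + Real.cos θ * K2 (ell w t t θ)) := by
    rw [ringInt, ← intervalIntegral.integral_const_mul]
    refine intervalIntegral.integral_congr fun θ _ => ?_
    simp only [hF, dx_cutoff w hT, dy_cutoff w hT, norm_ell_sub w ht.le, ell_re, ell_im]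
    ring
  rw [eq, ringInt_indicator w T S ht.le]
  split_ifs with hA
  · have k1 := abs_integral_stream_le hΨ h1 h2 g1 g2 hx hy w ht.le (h0 t)
    have k2 := abs_cutoffSlope_le hD hT ht hA.2.le
    have k3 : 0 ≤ ringInt S w t t := ringInt_nonneg nS w t t
    rw [Real.norm_eq_abs, abs_mul, abs_mul, abs_neg, abs_mul, abs_of_pos ht]
    calc _ ≤ t * (|cutoffSlope T t| * t * (Real.pi * t * ringInt S w t t)) := by gcongr
      _ = Real.pi * (|cutoffSlope T t| * t ^ 2) * (t * ringInt S w t t) := by ring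
      _ ≤ _ := by gcongr
  · rw [cutoffSlope_eq_zero hT ht.le hA]; simp

/-- A closed form on the plane has a primitive. -/
theorem exists_primitive {P Q : ℂ → ℝ} (hP : Smooth P) (hQ : Smooth Q)
    (h : ∀ z, dy P z = dx Q z) :
    ∃ Ψ : ℂ → ℝ, Smooth Ψ ∧ (∀ z, dx Ψ z = P z) ∧ ∀ z, dy Ψ z = Q z := by
  set ω : ℂ → ℂ →L[ℝ] ℝ := fun z => P z • Complex.reCLM + Q z • Complex.imCLM with hω
  have dω : ∀ z x y, fderiv ℝ ω z x y = fderiv ℝ P z x * y.re + fderiv ℝ Q z x * y.im := by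
    intro z x y
    have e := ((hP.differentiableAt (z := z)).hasFDerivAt.smul_const Complex.reCLM).add
      ((hQ.differentiableAt (z := z)).hasFDerivAt.smul_const Complex.imCLM)
    have e2 : fderiv ℝ ω z = _ := e.fderiv
    rw [e2]; simp
  have sω : ContDiff ℝ (⊤ : ℕ∞) ω :=
    (hP.contDiff.smul contDiff_const).add (hQ.contDiff.smul contDiff_const)
  obtain ⟨Ψ, hΨ⟩ := convex_univ.exists_forall_hasFDerivAt_of_fderiv_symmetric isOpen_univ
    (sω.differentiable (by simp)).differentiableOn fun z _ x y => by
      rw [dω, dω]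
      simp only [fderiv_apply_eq, h z]; ring
  have e : fderiv ℝ Ψ = ω := funext fun z => (hΨ z trivial).fderiv
  refine ⟨Ψ, ?_, fun z => ?_, fun z => ?_⟩
  · exact contDiff_infty_iff_fderiv.2
      ⟨fun z => (hΨ z trivial).differentiableAt, by rw [e]; exact sω⟩
  · simp [dx, e, hω]
  · simp [dy, e, hω]

/-- A smooth function equal to the inverse away from the origin. -/
def softInv (q : ℝ) : ℝ := q / (q ^ 2 + (1 - Real.smoothTransition (10 * q - 8)))

theorem contDiff_softInv : ContDiff ℝ (⊤ : ℕ∞) softInv := by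
  refine ContDiff.div contDiff_id ((contDiff_id.pow 2).add (contDiff_const.sub
    (Real.smoothTransition.contDiff.comp ((contDiff_const.mul contDiff_id).sub contDiff_const))))
    fun q => ?_
  change q ^ 2 + (1 - Real.smoothTransition (10 * q - 8)) ≠ 0
  have h1 := Real.smoothTransition.le_one (10 * q - 8)
  rcases eq_or_ne q 0 with rfl | hq
  · rw [Real.smoothTransition.zero_of_nonpos (by norm_num)]; norm_num
  · have : 0 < q ^ 2 := by positivity
    linarith

theorem softInv_eq {q : ℝ} (h : 9 / 10 ≤ q) : softInv q = 1 / q := by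
  rw [softInv, Real.smoothTransition.one_of_one_le (by linarith)]
  field_simp
  ring

/-- First component of the normalised current. -/
def ncur1 (a b : ℂ → ℝ) (z : ℂ) : ℝ := softInv (1 - eta a b z) * cur1 a b z

/-- Second component of the normalised current. -/
def ncur2 (a b : ℂ → ℝ) (z : ℂ) : ℝ := softInv (1 - eta a b z) * cur2 a b z

section NormalisedCurrent
variable {a b : ℂ → ℝ}

theorem smooth_softInv (ha : Smooth a) (hb : Smooth b) :
    Smooth fun z => softInv (1 - eta a b z) :=
  contDiff_softInv.comp (Smooth.sub (Smooth.const 1) (ha.eta hb)).contDiff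

@[fun_prop] theorem Smooth.ncur1 (ha : Smooth a) (hb : Smooth b) : Smooth (ncur1 a b) :=
  (smooth_softInv ha hb).mul (ha.cur1 hb)

@[fun_prop] theorem Smooth.ncur2 (ha : Smooth a) (hb : Smooth b) : Smooth (ncur2 a b) :=
  (smooth_softInv ha hb).mul (ha.cur2 hb)

theorem dx_congr {f g : ℂ → ℝ} {z : ℂ} (h : f =ᶠ[nhds z] g) : dx f z = dx g z := by
  rw [dx, dx, h.fderiv_eq]

theorem dy_congr {f g : ℂ → ℝ} {z : ℂ} (h : f =ᶠ[nhds z] g) : dy f z = dy g z := by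
  rw [dy, dy, h.fderiv_eq]

theorem dx_eta (ha : Smooth a) (hb : Smooth b) (z : ℂ) :
    dx (eta a b) z = -2 * (a z * dx a z + b z * dx b z) := by
  unfold eta
  simp (disch := fun_prop) only [dx_sub, dx_pow, dx_const]
  push_cast; ring

theorem dy_eta (ha : Smooth a) (hb : Smooth b) (z : ℂ) :
    dy (eta a b) z = -2 * (a z * dy a z + b z * dy b z) := by
  unfold eta
  simp (disch := fun_prop) only [dy_sub, dy_pow, dy_const]
  push_cast; ring

theorem curl_ncur (ha : Smooth a) (hb : Smooth b) {z : ℂ}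
    (h : ∀ᶠ y in nhds z, |eta a b y| ≤ 1 / 10) : dx (ncur2 a b) z - dy (ncur1 a b) z = 0 := by
  have hρ : ∀ y, |eta a b y| ≤ 1 / 10 → 9 / 10 ≤ 1 - eta a b y := fun y hy => by
    linarith [(abs_le.1 hy).2]
  have e1 : (fun y => (1 - eta a b y) * ncur1 a b y) =ᶠ[nhds z] cur1 a b := by
    filter_upwards [h] with y hy
    have := hρ y hy
    rw [ncur1, softInv_eq this]; field_simp
  have e2 : (fun y => (1 - eta a b y) * ncur2 a b y) =ᶠ[nhds z] cur2 a b := by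
    filter_upwards [h] with y hy
    have := hρ y hy
    rw [ncur2, softInv_eq this]; field_simp
  have d1 := dy_congr e1
  have d2 := dx_congr e2
  have hz := hρ z h.self_of_nhds
  have v1 := e1.eq_of_nhds
  have v2 := e2.eq_of_nhds
  have hη := ha.eta hb
  have n1 := ha.ncur1 hb
  have n2 := ha.ncur2 hb
  rw [dy_mul (by fun_prop) (by fun_prop), dy_sub (by fun_prop) (by fun_prop), dy_const] at d1
  rw [dx_mul (by fun_prop) (by fun_prop), dx_sub (by fun_prop) (by fun_prop), dx_const] at d2
  have c := curl_cur ha hb z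
  have alg : dx (eta a b) z * cur2 a b z - dy (eta a b) z * cur1 a b z
      = 2 * (1 - eta a b z) * jac a b z := by
    rw [dx_eta ha hb, dy_eta ha hb]; unfold cur1 cur2 eta jac; ring
  have key : (1 - eta a b z) * ((1 - eta a b z) * (dx (ncur2 a b) z - dy (ncur1 a b) z)) = 0 := by
    rw [← v1, ← v2] at alg
    have : (1 - eta a b z) * (dx (ncur2 a b) z - dy (ncur1 a b) z)
      = -2 * jac a b z + (dx (eta a b) z * ncur2 a b z - dy (eta a b) z * ncur1 a b z) := by
      linarith
    rw [this]; linarith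
  have hne : (1 - eta a b z) ≠ 0 := by linarith
  simpa [hne] using key

theorem integral_angular_ncur (ha : Smooth a) (hb : Smooth b) (ea : Even1 a) (eb : Even1 b)
    {w : ℂ} (hw : w.re = 0) (t : ℝ) :
    ∫ θ in (-Real.pi)..Real.pi, (-(Real.sin θ) * ncur1 a b (ell w t t θ)
      + Real.cos θ * ncur2 a b (ell w t t θ)) = 0 := by
  set q : ℝ → ℝ := fun θ => -(Real.sin θ) * ncur1 a b (ell w t t θ)
      + Real.cos θ * ncur2 a b (ell w t t θ) with hq
  have m : ∀ θ, ell w t t (Real.pi - θ) = mirror (ell w t t θ) := fun θ => by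
    apply Complex.ext <;> simp [hw]
  have odd1 : ∀ z, ncur1 a b (mirror z) = -ncur1 a b z := fun z => by
    simp only [ncur1, cur1, eta, ea z, eb z, ea.dx ha, eb.dx hb]; ring
  have even2 : ∀ z, ncur2 a b (mirror z) = ncur2 a b z := fun z => by
    simp only [ncur2, cur2, eta, ea z, eb z, ea.dy ha, eb.dy hb]
  have h1 : ∀ θ, q (Real.pi - θ) = -q θ := fun θ => by
    simp only [hq, m, odd1, even2, Real.sin_pi_sub, Real.cos_pi_sub]; ring
  have per : Function.Periodic q (2 * Real.pi) := fun θ => by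
    simp only [hq, ell, Real.sin_add_two_pi, Real.cos_add_two_pi]
  have e1 : ∫ θ in (-Real.pi)..Real.pi, q (Real.pi - θ) = ∫ θ in (-Real.pi)..Real.pi, q θ := by
    rw [intervalIntegral.integral_comp_sub_left]
    have := per.intervalIntegral_add_eq 0 (-Real.pi)
    rw [show -Real.pi + 2 * Real.pi = Real.pi by ring, zero_add] at this
    rw [sub_self, show Real.pi - -Real.pi = 2 * Real.pi by ring, this]
  simp only [h1, intervalIntegral.integral_neg] at e1
  linarith

end NormalisedCurrent

theorem integral_stream_eq {χ Ψ K1 K2 : ℂ → ℝ} (hχ : Smooth χ) (hcs : HasCompactSupport χ)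
    (hΨ : Smooth Ψ) (h1 : Smooth K1) (h2 : Smooth K2)
    (h0 : ∀ z, χ z * (dx K2 z - dy K1 z) = 0) :
    ∫ z, χ z * (dy Ψ z * K1 z - dx Ψ z * K2 z)
      = -∫ z, Ψ z * (dy χ z * K1 z - dx χ z * K2 z) := by
  have i1 : Integrable fun z => χ z * (dy Ψ z * K1 z - dx Ψ z * K2 z) :=
    integrable_mul_of_hasCompactSupport hχ.continuous hcs
      (g := fun z => dy Ψ z * K1 z - dx Ψ z * K2 z)
      ((hΨ.dy.mul h1).sub (hΨ.dx.mul h2)).continuous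
  have i2 : Integrable fun z => Ψ z * (dy χ z * K1 z - dx χ z * K2 z) := by
    have e1 := integrable_mul_of_hasCompactSupport hχ.dy.continuous hcs.dy
      (hΨ.mul h1).continuous
    have e2 := integrable_mul_of_hasCompactSupport hχ.dx.continuous hcs.dx
      (hΨ.mul h2).continuous
    refine (e1.sub e2).congr (.of_forall fun z => ?_)
    simp only [Pi.sub_apply]; ring
  have s1 : Smooth fun z => χ z * (Ψ z * K1 z) := hχ.mul (hΨ.mul h1)
  have s2 : Smooth fun z => χ z * (Ψ z * K2 z) := hχ.mul (hΨ.mul h2)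
  have c1 : HasCompactSupport fun z => χ z * (Ψ z * K1 z) := hcs.mul_right
  have c2 : HasCompactSupport fun z => χ z * (Ψ z * K2 z) := hcs.mul_right
  have e : ∀ z, dy (fun z => χ z * (Ψ z * K1 z)) z - dx (fun z => χ z * (Ψ z * K2 z)) z
      = χ z * (dy Ψ z * K1 z - dx Ψ z * K2 z) + Ψ z * (dy χ z * K1 z - dx χ z * K2 z) := by
    intro z
    have h := h0 z
    simp (disch := fun_prop) only [dx_mul, dy_mul]
    linear_combination -Ψ z * h
  have z1 := integral_dy_eq_zero s1 c1
  have z2 := integral_dx_eq_zero s2 c2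
  have t : ∫ z, (dy (fun z => χ z * (Ψ z * K1 z)) z - dx (fun z => χ z * (Ψ z * K2 z)) z) = 0 := by
    rw [integral_sub (integrable_of_compactSupport s1.dy c1.dy)
      (integrable_of_compactSupport s2.dx c2.dx), z1, z2, sub_zero]
  simp only [e] at t
  rw [integral_add i1 i2] at t
  linarith

theorem integral_mul_laplacian_eq {χ f : ℂ → ℝ} (hχ : Smooth χ) (hcs : HasCompactSupport χ)
    (hf : Smooth f) :
    ∫ z, χ z * (dx f z ^ 2 + dy f z ^ 2 + f z * (dx (dx f) z + dy (dy f) z))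
      = -∫ z, f z * (dx χ z * dx f z + dy χ z * dy f z) := by
  have i1 : Integrable fun z => χ z * (dx f z ^ 2 + dy f z ^ 2
      + f z * (dx (dx f) z + dy (dy f) z)) :=
    integrable_mul_of_hasCompactSupport hχ.continuous hcs
      (g := fun z => dx f z ^ 2 + dy f z ^ 2 + f z * (dx (dx f) z + dy (dy f) z))
      (by fun_prop)
  have i2 : Integrable fun z => f z * (dx χ z * dx f z + dy χ z * dy f z) := by
    have e1 := integrable_mul_of_hasCompactSupport hχ.dx.continuous hcs.dx
      (hf.mul hf.dx).continuous
    have e2 := integrable_mul_of_hasCompactSupport hχ.dy.continuous hcs.dy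
      (hf.mul hf.dy).continuous
    refine (e1.add e2).congr (.of_forall fun z => ?_)
    simp only [Pi.add_apply]; ring
  have s1 : Smooth fun z => χ z * (f z * dx f z) := hχ.mul (hf.mul hf.dx)
  have s2 : Smooth fun z => χ z * (f z * dy f z) := hχ.mul (hf.mul hf.dy)
  have c1 : HasCompactSupport fun z => χ z * (f z * dx f z) := hcs.mul_right
  have c2 : HasCompactSupport fun z => χ z * (f z * dy f z) := hcs.mul_right
  have e : ∀ z, dx (fun z => χ z * (f z * dx f z)) z + dy (fun z => χ z * (f z * dy f z)) z
      = χ z * (dx f z ^ 2 + dy f z ^ 2 + f z * (dx (dx f) z + dy (dy f) z))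
        + f z * (dx χ z * dx f z + dy χ z * dy f z) := by
    intro z
    simp (disch := fun_prop) only [dx_mul, dy_mul]
    ring
  have t : ∫ z, (dx (fun z => χ z * (f z * dx f z)) z + dy (fun z => χ z * (f z * dy f z)) z)
      = 0 := by
    rw [integral_add (integrable_of_compactSupport s1.dx c1.dx)
      (integrable_of_compactSupport s2.dy c2.dy), integral_dx_eq_zero s1 c1,
      integral_dy_eq_zero s2 c2, add_zero]
  simp only [e] at t
  rw [integral_add i1 i2] at t
  linarith

section Decay
variable {a b : ℂ → ℝ} {c : ℝ}

theorem polar_identity (ha : Smooth a) (hb : Smooth b) (z : ℂ) :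
    (1 - eta a b z) * gsq a b z
      = (dx (eta a b) z ^ 2 + dy (eta a b) z ^ 2) / 4 + cur1 a b z ^ 2 + cur2 a b z ^ 2 := by
  rw [dx_eta ha hb, dy_eta ha hb]
  unfold eta gsq cur1 cur2
  ring

theorem density_le {r η G N j1 j2 c : ℝ} (hη : |η| ≤ 1 / 10) (hr : r = 1 - η) (hc : 0 ≤ c)
    (hc' : c ≤ 1 / 10) (hG : r * G = N / 4 + j1 ^ 2 + j2 ^ 2) (hN : 0 ≤ N) :
    G + η ^ 2 / 2 ≤ 2 * (j1 * (1 / r * j1) + (j2 - c / 2 * η) * (1 / r * j2))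
        + (N + η * (-2 * G + 2 * r * η - 2 * c * j2)) := by
  obtain ⟨h1, h2⟩ := abs_le.1 hη
  have r1 : 9 / 10 ≤ r := by linarith
  have r2 : r ≤ 11 / 10 := by linarith
  have r0 : 0 < r := by linarith
  have e : j1 * (1 / r * j1) + (j2 - c / 2 * η) * (1 / r * j2)
      = (j1 ^ 2 + j2 ^ 2) / r - (1 / r) * (c / 2 * (η * j2)) := by
    field_simp
    ring
  have J : (j1 ^ 2 + j2 ^ 2) / r = G - N / (4 * r) := by
    field_simp; linarith
  have q : |η * j2| ≤ (η ^ 2 + j2 ^ 2) / 2 := by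
    rw [abs_le]; constructor <;> nlinarith [sq_nonneg (η + j2), sq_nonneg (η - j2)]
  have ir : 1 / r ≤ 10 / 9 := by rw [div_le_iff₀ r0]; linarith
  have ir0 : 0 < 1 / r := by positivity
  have G0 : 0 ≤ G := by
    by_contra hneg; push Not at hneg
    nlinarith [sq_nonneg j1, sq_nonneg j2]
  have q2 : |c / 2 * (η * j2)| ≤ (η ^ 2 + j2 ^ 2) / 40 := by
    rw [abs_mul, abs_of_nonneg (by linarith : 0 ≤ c / 2)]
    nlinarith [abs_nonneg (η * j2)]
  have q3 : |1 / r * (c / 2 * (η * j2))| ≤ (η ^ 2 + j2 ^ 2) / 36 := by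
    rw [abs_mul, abs_of_pos ir0]
    nlinarith [abs_nonneg (c / 2 * (η * j2))]
  have j2G : j2 ^ 2 ≤ 11 / 10 * G := by nlinarith [sq_nonneg j1]
  have NG : N / (4 * r) ≤ N / 3 := by
    apply div_le_div_of_nonneg_left hN (by norm_num); linarith
  rw [e, J]
  have q3' := (abs_le.1 q3).2
  have q2' := (abs_le.1 q2).2
  have hηG : η * G ≤ G / 10 := by nlinarith
  have hrη : 9 / 10 * η ^ 2 ≤ r * η ^ 2 := by nlinarith [sq_nonneg η]
  nlinarith

theorem stream_density_le {r η G j1 j2 c N : ℝ} (hη : |η| ≤ 1 / 10) (hr : r = 1 - η) (hc : 0 ≤ c)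
    (hc' : c ≤ 1 / 10) (hG : r * G = N / 4 + j1 ^ 2 + j2 ^ 2) (hN : 0 ≤ N) :
    j1 ^ 2 + (j2 - c / 2 * η) ^ 2 + ((1 / r * j1) ^ 2 + (1 / r * j2) ^ 2)
      ≤ 8 * (G / 2 + η ^ 2 / 4) := by
  obtain ⟨h1, h2⟩ := abs_le.1 hη
  have r1 : 9 / 10 ≤ r := by linarith
  have r2 : r ≤ 11 / 10 := by linarith
  have r0 : 0 < r := by linarith
  have ir : 1 / r ≤ 10 / 9 := by rw [div_le_iff₀ r0]; linarith
  have ir0 : 0 < 1 / r := by positivity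
  have G0 : 0 ≤ G := by
    by_contra hneg; push Not at hneg
    nlinarith [sq_nonneg j1, sq_nonneg j2]
  have JG : j1 ^ 2 + j2 ^ 2 ≤ 11 / 10 * G := by nlinarith
  have i2 : (1 / r) ^ 2 ≤ 5 / 4 := by nlinarith
  have e : (1 / r * j1) ^ 2 + (1 / r * j2) ^ 2 ≤ 5 / 4 * (j1 ^ 2 + j2 ^ 2) := by
    nlinarith [sq_nonneg j1, sq_nonneg j2]
  have c2 : (c / 2 * η) ^ 2 ≤ η ^ 2 / 400 := by
    have : (c / 2) ^ 2 ≤ 1 / 400 := by nlinarith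
    rw [mul_pow]; nlinarith [sq_nonneg η]
  nlinarith [sq_nonneg (j2 + c / 2 * η), sq_nonneg j1, sq_nonneg η]

theorem abs_cross_le {D η x y p q N G r : ℝ} (hη : |η| ≤ 1 / 10) (hr : r = 1 - η) (hD : 0 ≤ D)
    (hp : |p| ≤ D) (hq : |q| ≤ D) (hN : x ^ 2 + y ^ 2 = N) {J : ℝ} (hJ : 0 ≤ J)
    (hG : r * G = N / 4 + J) : |η * (p * x + q * y)| ≤ 8 * D * (G / 2 + η ^ 2 / 4) := by
  obtain ⟨h1, h2⟩ := abs_le.1 hη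
  have NG : N ≤ 22 / 5 * G := by
    have G0 : 0 ≤ G := by
      by_contra hneg; push Not at hneg
      nlinarith [sq_nonneg x, sq_nonneg y]
    nlinarith
  have a1 : |η * x| ≤ (η ^ 2 + x ^ 2) / 2 := by
    rw [abs_le]; constructor <;> nlinarith [sq_nonneg (η + x), sq_nonneg (η - x)]
  have a2 : |η * y| ≤ (η ^ 2 + y ^ 2) / 2 := by
    rw [abs_le]; constructor <;> nlinarith [sq_nonneg (η + y), sq_nonneg (η - y)]
  calc |η * (p * x + q * y)| = |p * (η * x) + q * (η * y)| := by ring_nf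
    _ ≤ |p| * |η * x| + |q| * |η * y| := by
        rw [← abs_mul, ← abs_mul]; exact abs_add_le _ _
    _ ≤ D * ((η ^ 2 + x ^ 2) / 2) + D * ((η ^ 2 + y ^ 2) / 2) := by gcongr
    _ = D * (η ^ 2 + N / 2) := by rw [← hN]; ring
    _ ≤ D * (8 * (G / 2 + η ^ 2 / 4)) := by
        apply mul_le_mul_of_nonneg_left _ hD; nlinarith [sq_nonneg η]
    _ = _ := by ring

end Decay

section Shell
variable {a b : ℂ → ℝ} {c : ℝ}

theorem abs_integral_cross_cutoff_le {D : ℝ} (hD0 : 0 ≤ D)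
    (hD : ∀ w T, 0 < T → ∀ z, |dx (cutoff w T) z| ≤ D / T)
    (hD' : ∀ w T, 0 < T → ∀ z, |dy (cutoff w T) z| ≤ D / T)
    (ha : Smooth a) (hb : Smooth b) {w : ℂ} {T : ℝ} (hT : 1 ≤ T)
    (hη : ∀ z, T / 2 ≤ ‖z - w‖ → |eta a b z| ≤ 1 / 10) :
    |∫ z, eta a b z * (dx (cutoff w T) z * dx (eta a b) z + dy (cutoff w T) z * dy (eta a b) z)|
      ≤ 8 * D * ∫ z in annulus w T, en a b z := by
  have hT0 : 0 < T := by linarith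
  have hDT : D / T ≤ D := div_le_self hD0 hT
  rw [← setIntegral_eq_integral_of_forall_compl_eq_zero (s := annulus w T) fun z hz => by
    rw [dx_cutoff w hT0, dy_cutoff w hT0, cutoffSlope_eq_zero hT0 (norm_nonneg _) hz]; ring,
    ← integral_const_mul, ← Real.norm_eq_abs]
  refine norm_integral_le_of_norm_le
    (integrableOn_annulus w T (continuous_const.mul (ha.en hb).continuous)) ?_
  refine ae_restrict_of_forall_mem (measurableSet_annulus w T) fun z hz => ?_
  exact abs_cross_le (hη z hz.1) rfl hD0 ((hD w T hT0 z).trans hDT) ((hD' w T hT0 z).trans hDT) rfl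
    (J := cur1 a b z ^ 2 + cur2 a b z ^ 2) (by positivity)
    (by rw [polar_identity ha hb]; ring)

theorem integral_annulus_stream_density_le (ha : Smooth a) (hb : Smooth b) (hc : 0 ≤ c)
    (hc' : c ≤ 1 / 10) {w : ℂ} {T : ℝ} (hη : ∀ z, T / 2 ≤ ‖z - w‖ → |eta a b z| ≤ 1 / 10) :
    ∫ z in annulus w T, (cur1 a b z ^ 2 + (cur2 a b z - c / 2 * eta a b z) ^ 2
      + (ncur1 a b z ^ 2 + ncur2 a b z ^ 2)) ≤ 8 * ∫ z in annulus w T, en a b z := by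
  have h1 := (ha.cur1 hb).continuous
  have h2 := (ha.cur2 hb).continuous
  have h3 := (ha.ncur1 hb).continuous
  have h4 := (ha.ncur2 hb).continuous
  have h5 := (ha.eta hb).continuous
  rw [← integral_const_mul]
  refine setIntegral_mono_on (integrableOn_annulus w T
    (((h1.pow 2).add ((h2.sub (continuous_const.mul h5)).pow 2)).add ((h3.pow 2).add (h4.pow 2))))
    (integrableOn_annulus w T (continuous_const.mul (ha.en hb).continuous))
    (measurableSet_annulus w T) fun z hz => ?_
  have h := hη z hz.1
  rw [ncur1, ncur2, softInv_eq (by linarith [(abs_le.1 h).2])]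
  exact stream_density_le h rfl hc hc' (polar_identity ha hb z) (by positivity)

theorem GP.exists_integral_shell_le : ∃ K : ℝ, 0 < K ∧ ∀ c a b w T N, GP c a b → 0 ≤ c →
    c ≤ 1 / 10 → Even1 a → Even1 b → w.re = 0 → 1 ≤ T → 2 * T ≤ N →
    (∀ z, T / 2 ≤ ‖z - w‖ → |eta a b z| ≤ 1 / 10) →
    ∫ z, (cutoff w N z - cutoff w T z) * en a b z
      ≤ K * ((∫ z in annulus w T, en a b z) + ∫ z in annulus w N, en a b z) := by
  obtain ⟨D, hD0, hD⟩ := exists_cutoff_bound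
  have hDx : ∀ w T, 0 < T → ∀ z, |dx (cutoff w T) z| ≤ D / T := fun w T hT z => (hD w T hT z).1
  have hDy : ∀ w T, 0 < T → ∀ z, |dy (cutoff w T) z| ≤ D / T := fun w T hT z => (hD w T hT z).2.1
  refine ⟨8 * Real.pi * D + 4 * D + 1, by positivity,
    fun c a b w T N h hc hc' ea eb hw hT hN hη => ?_⟩
  have ha := h.sa
  have hb := h.sb
  have hT0 : 0 < T := by linarith
  have hN0 : 0 < N := by linarith
  have hηN : ∀ z, N / 2 ≤ ‖z - w‖ → |eta a b z| ≤ 1 / 10 := fun z hz => hη z (by linarith)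
  have se := ha.eta hb
  have s1 := ha.cur1 hb
  have s2 := ha.cur2 hb
  have n1 := ha.ncur1 hb
  have n2 := ha.ncur2 hb
  have sN := smooth_cutoff w N
  have sT := smooth_cutoff w T
  have cN := hasCompactSupport_cutoff w hN0
  have cT := hasCompactSupport_cutoff w hT0
  set χ : ℂ → ℝ := fun z => cutoff w N z - cutoff w T z with hχ
  have sχ : Smooth χ := sN.sub sT
  have cχ : HasCompactSupport χ := cN.sub cT
  have χ0 : ∀ z, ‖z - w‖ ≤ T / 2 → χ z = 0 := fun z hz => by
    have := norm_nonneg (z - w)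
    rw [hχ]; dsimp only
    rw [cutoff_eq_one w hN0 (by nlinarith), cutoff_eq_one w hT0 (by nlinarith), sub_self]
  have χnn : ∀ z, 0 ≤ χ z := fun z => by
    have := norm_nonneg (z - w)
    rcases le_total T ‖z - w‖ with h1 | h1
    · simp only [hχ]; rw [cutoff_eq_zero w hT0 h1, sub_zero]; exact cutoff_nonneg _ _ _
    · simp only [hχ]; rw [cutoff_eq_one w hN0 (by nlinarith), sub_nonneg]; exact cutoff_le_one _ _ _
  have dχ : ∀ z, dx χ z = dx (cutoff w N) z - dx (cutoff w T) z := fun z => by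
    rw [hχ]; exact dx_sub sN.differentiableAt sT.differentiableAt
  have dχ' : ∀ z, dy χ z = dy (cutoff w N) z - dy (cutoff w T) z := fun z => by
    rw [hχ]; exact dy_sub sN.differentiableAt sT.differentiableAt
  -- the stream function
  set V2 : ℂ → ℝ := fun z => cur2 a b z - c / 2 * eta a b z with hV2
  have sV2 : Smooth V2 := s2.sub ((Smooth.const (c / 2)).mul se)
  have dV2 : ∀ z, dy V2 z = dy (cur2 a b) z - c / 2 * dy (eta a b) z := fun z => by
    rw [hV2, dy_sub s2.differentiableAt ((Smooth.const (c / 2)).mul se).differentiableAt,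
      dy_mul (by fun_prop) se.differentiableAt, dy_const]
    ring
  obtain ⟨Ψ, sΨ, hΨx, hΨy⟩ := exists_primitive (P := fun z => -V2 z) (Q := cur1 a b) sV2.neg s1
    fun z => by rw [dy_neg, dV2]; linarith [h.div_cur z]
  have curl0 : ∀ z, χ z * (dx (ncur2 a b) z - dy (ncur1 a b) z) = 0 := fun z => by
    rcases le_or_gt ‖z - w‖ (T / 2) with h1 | h1
    · rw [χ0 z h1, zero_mul]
    · have ev : ∀ᶠ y in nhds z, T / 2 < ‖y - w‖ :=
        (isOpen_lt (f := fun _ : ℂ => T / 2) (g := fun y => ‖y - w‖) continuous_const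
          (by fun_prop)).mem_nhds h1
      rw [curl_ncur ha hb (ev.mono fun y hy => hη y hy.le), mul_zero]
  have stream := integral_stream_eq sχ cχ sΨ n1 n2 curl0
  have iS : ∀ R, 0 < R → Integrable fun z =>
      Ψ z * (dy (cutoff w R) z * ncur1 a b z - dx (cutoff w R) z * ncur2 a b z) := fun R hR => by
    have sR := smooth_cutoff w R
    have cR := hasCompactSupport_cutoff w hR
    have e1 := integrable_mul_of_hasCompactSupport sR.dy.continuous cR.dy (sΨ.mul n1).continuous
    have e2 := integrable_mul_of_hasCompactSupport sR.dx.continuous cR.dx (sΨ.mul n2).continuous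
    refine (e1.sub e2).congr (.of_forall fun z => ?_)
    simp only [Pi.sub_apply]; ring
  have bS : ∀ R, 0 < R → (∀ z, R / 2 ≤ ‖z - w‖ → |eta a b z| ≤ 1 / 10) →
      |∫ z, Ψ z * (dy (cutoff w R) z * ncur1 a b z - dx (cutoff w R) z * ncur2 a b z)|
        ≤ Real.pi * D * (8 * ∫ z in annulus w R, en a b z) := fun R hR hηR =>
    (abs_integral_stream_cutoff_le hDx sΨ n1.continuous n2.continuous s1.continuous sV2.continuous
      hΨx hΨy w (integral_angular_ncur ha hb ea eb hw) hR).trans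
      (mul_le_mul_of_nonneg_left (integral_annulus_stream_density_le ha hb hc hc' hηR)
        (by positivity))
  have splitS : ∫ z, Ψ z * (dy χ z * ncur1 a b z - dx χ z * ncur2 a b z)
      = (∫ z, Ψ z * (dy (cutoff w N) z * ncur1 a b z - dx (cutoff w N) z * ncur2 a b z))
        - ∫ z, Ψ z * (dy (cutoff w T) z * ncur1 a b z - dx (cutoff w T) z * ncur2 a b z) := by
    rw [← integral_sub (iS N hN0) (iS T hT0)]
    congr 1; funext z; rw [dχ, dχ']; ring
  -- the modulus
  have modulus := integral_mul_laplacian_eq sχ cχ se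
  have iM : ∀ R, 0 < R → Integrable fun z => eta a b z *
      (dx (cutoff w R) z * dx (eta a b) z + dy (cutoff w R) z * dy (eta a b) z) := fun R hR => by
    have sR := smooth_cutoff w R
    have cR := hasCompactSupport_cutoff w hR
    have e1 := integrable_mul_of_hasCompactSupport sR.dx.continuous cR.dx
      (se.mul se.dx).continuous
    have e2 := integrable_mul_of_hasCompactSupport sR.dy.continuous cR.dy
      (se.mul se.dy).continuous
    refine (e1.add e2).congr (.of_forall fun z => ?_)
    simp only [Pi.add_apply]; ring
  have splitM : ∫ z, eta a b z * (dx χ z * dx (eta a b) z + dy χ z * dy (eta a b) z)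
      = (∫ z, eta a b z *
          (dx (cutoff w N) z * dx (eta a b) z + dy (cutoff w N) z * dy (eta a b) z))
        - ∫ z, eta a b z *
          (dx (cutoff w T) z * dx (eta a b) z + dy (cutoff w T) z * dy (eta a b) z) := by
    rw [← integral_sub (iM N hN0) (iM T hT0)]
    congr 1; funext z; rw [dχ, dχ']; ring
  have m1 := abs_le.1 (abs_integral_cross_cutoff_le hD0 hDx hDy ha hb hT hη)
  have m2 := abs_le.1 (abs_integral_cross_cutoff_le hD0 hDx hDy ha hb (by linarith) hηN)
  have t1 := abs_le.1 (bS T hT0 hη)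
  have t2 := abs_le.1 (bS N hN0 hηN)
  -- pointwise comparison
  set A : ℂ → ℝ := fun z => dy Ψ z * ncur1 a b z - dx Ψ z * ncur2 a b z with hA
  set B : ℂ → ℝ := fun z => dx (eta a b) z ^ 2 + dy (eta a b) z ^ 2
    + eta a b z * (dx (dx (eta a b)) z + dy (dy (eta a b)) z) with hB
  have cA : Continuous A := ((sΨ.dy.mul n1).sub (sΨ.dx.mul n2)).continuous
  have cB : Continuous B := by
    have : ∀ f : ℂ → ℝ, Smooth f → Continuous fun z => dx f z ^ 2 + dy f z ^ 2
      + f z * (dx (dx f) z + dy (dy f) z) := fun f hf => by fun_prop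
    exact this _ se
  have iA := integrable_mul_of_hasCompactSupport sχ.continuous cχ cA
  have iB := integrable_mul_of_hasCompactSupport sχ.continuous cχ cB
  have iE := integrable_mul_of_hasCompactSupport sχ.continuous cχ (ha.en hb).continuous
  have main : 2 * ∫ z, χ z * en a b z ≤ 2 * (∫ z, χ z * A z) + ∫ z, χ z * B z := by
    rw [← integral_const_mul, ← integral_const_mul, ← integral_add (iA.const_mul 2) iB]
    refine integral_mono (iE.const_mul 2) ((iA.const_mul 2).add iB) fun z => ?_
    rcases le_or_gt ‖z - w‖ (T / 2) with h1 | h1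
    · simp [χ0 z h1]
    · have hz := hη z h1.le
      have d := density_le hz rfl hc hc' (polar_identity ha hb z) (by positivity)
      have eA : A z = cur1 a b z * (1 / (1 - eta a b z) * cur1 a b z)
          + (cur2 a b z - c / 2 * eta a b z) * (1 / (1 - eta a b z) * cur2 a b z) := by
        simp only [hA, hΨx, hΨy, hV2]
        rw [ncur1, ncur2, softInv_eq (by linarith [(abs_le.1 hz).2])]; ring
      have eB : B z = dx (eta a b) z ^ 2 + dy (eta a b) z ^ 2 + eta a b z * (-2 * gsq a b z
          + 2 * (1 - eta a b z) * eta a b z - 2 * c * cur2 a b z) := by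
        simp only [hB, h.laplacian_eta]
      have : 2 * en a b z ≤ 2 * A z + B z := by
        rw [eA, eB, en]; linarith
      calc 2 * (χ z * en a b z) = χ z * (2 * en a b z) := by ring
        _ ≤ χ z * (2 * A z + B z) := mul_le_mul_of_nonneg_left this (χnn z)
        _ = _ := by ring
  have A0 : 0 ≤ ∫ z in annulus w T, en a b z := integral_nonneg fun z => en_nonneg a b z
  have B0 : 0 ≤ ∫ z in annulus w N, en a b z := integral_nonneg fun z => en_nonneg a b z
  rw [stream, modulus, splitS, splitM] at main
  linarith [main, m1.1, m1.2, m2.1, m2.2, t1.1, t1.2, t2.1, t2.2]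

end Shell

/-- The complement of the open disc of radius `s` centred at `w`. -/
def farSet (w : ℂ) (s : ℝ) : Set ℂ := {z | s ≤ ‖z - w‖}

theorem measurableSet_farSet (w : ℂ) (s : ℝ) : MeasurableSet (farSet w s) :=
  measurableSet_le (f := fun _ : ℂ => s) (g := fun z => ‖z - w‖) measurable_const (by fun_prop)

theorem farSet_anti (w : ℂ) {s t : ℝ} (h : s ≤ t) : farSet w t ⊆ farSet w s :=
  fun _ hz => h.trans hz

theorem tendsto_integral_farSet {f : ℂ → ℝ} (hf : Integrable f) (w : ℂ) :
    Tendsto (fun s : ℝ => ∫ z in farSet w s, f z) atTop (nhds 0) := by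
  have h := tendsto_setIntegral_of_antitone (μ := volume) (f := f) (s := farSet w)
    (measurableSet_farSet w) (fun _ _ => farSet_anti w) ⟨0, hf.integrableOn⟩
  have e : ⋂ s, farSet w s = ∅ := by
    ext z
    simp only [Set.mem_iInter, Set.mem_empty_iff_false, iff_false, not_forall]
    exact ⟨‖z - w‖ + 1, fun h => by have : ‖z - w‖ + 1 ≤ ‖z - w‖ := h; linarith⟩
  rwa [e, setIntegral_empty] at h

theorem integral_annulus_eq {f : ℂ → ℝ} (hf : Integrable f) (w : ℂ) {T : ℝ} (hT : 0 ≤ T) :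
    ∫ z in annulus w T, f z = (∫ z in farSet w (T / 2), f z) - ∫ z in farSet w T, f z := by
  have e : annulus w T = farSet w (T / 2) \ farSet w T := by
    ext z; simp [annulus, farSet]
  rw [e, setIntegral_sdiff (measurableSet_farSet w T) hf.integrableOn
    (farSet_anti w (by linarith))]

theorem le_integral_shell {f : ℂ → ℝ} (hf : Continuous f) (hi : Integrable f) (h0 : ∀ z, 0 ≤ f z)
    (w : ℂ) {T N : ℝ} (hT : 0 < T) (hN : 2 * T ≤ N) :
    (∫ z in farSet w T, f z) - ∫ z in farSet w (N / 2), f z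
      ≤ ∫ z, (cutoff w N z - cutoff w T z) * f z := by
  have hN0 : 0 < N := by linarith
  rw [← setIntegral_sdiff (measurableSet_farSet w _) hi.integrableOn
    (farSet_anti w (by linarith)), ← integral_indicator
    ((measurableSet_farSet w _).diff (measurableSet_farSet w _))]
  refine integral_mono (hi.indicator ((measurableSet_farSet w _).diff (measurableSet_farSet w _)))
    (integrable_mul_of_hasCompactSupport ((smooth_cutoff w N).sub (smooth_cutoff w T)).continuous
      ((hasCompactSupport_cutoff w hN0).sub (hasCompactSupport_cutoff w hT)) hf) fun z => ?_
  have hn := norm_nonneg (z - w)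
  dsimp only
  by_cases hz : z ∈ farSet w T \ farSet w (N / 2)
  · have h1 : T ≤ ‖z - w‖ := hz.1
    have h2 : ‖z - w‖ < N / 2 := not_le.1 hz.2
    rw [Set.indicator_of_mem hz, cutoff_eq_zero w hT h1, cutoff_eq_one w hN0 (by nlinarith)]
    simp
  · rw [Set.indicator_of_notMem hz]
    refine mul_nonneg ?_ (h0 z)
    rcases le_total T ‖z - w‖ with h1 | h1
    · rw [cutoff_eq_zero w hT h1, sub_zero]; exact cutoff_nonneg _ _ _
    · rw [cutoff_eq_one w hN0 (by nlinarith), sub_nonneg]; exact cutoff_le_one _ _ _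

theorem GP.exists_tail_le : ∃ K : ℝ, 0 < K ∧ ∀ c a b w T, GP c a b → 0 ≤ c →
    c ≤ 1 / 10 → Even1 a → Even1 b → w.re = 0 → 1 ≤ T → Integrable (en a b) →
    (∀ z, T / 2 ≤ ‖z - w‖ → |eta a b z| ≤ 1 / 10) →
    ∫ z in farSet w T, en a b z
      ≤ K * ((∫ z in farSet w (T / 2), en a b z) - ∫ z in farSet w T, en a b z) := by
  obtain ⟨K, hK, H⟩ := GP.exists_integral_shell_le
  refine ⟨K, hK, fun c a b w T h hc hc' ea eb hw hT hi hη => ?_⟩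
  have lim : Tendsto (fun N : ℝ => (∫ z in farSet w (N / 2), en a b z)
      + K * (((∫ z in farSet w (T / 2), en a b z) - ∫ z in farSet w T, en a b z)
        + ∫ z in farSet w (N / 2), en a b z)) atTop
      (nhds (0 + K * (((∫ z in farSet w (T / 2), en a b z)
        - ∫ z in farSet w T, en a b z) + 0))) := by
    have l := (tendsto_integral_farSet hi w).comp (tendsto_id.atTop_div_const two_pos)
    exact l.add ((tendsto_const_nhds.add l).const_mul K)
  rw [zero_add, add_zero] at lim
  refine ge_of_tendsto lim ((eventually_ge_atTop (2 * T)).mono fun N hN => ?_)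
  have h1 := H c a b w T N h hc hc' ea eb hw hT hN hη
  have h2 := le_integral_shell (h.sa.en h.sb).continuous hi (en_nonneg a b) w (by linarith) hN
  rw [integral_annulus_eq hi w (by linarith), integral_annulus_eq hi w (by linarith : 0 ≤ N)] at h1
  have h3 : 0 ≤ ∫ z in farSet w N, en a b z := integral_nonneg fun z => en_nonneg a b z
  have h4 : 0 ≤ K * ∫ z in farSet w N, en a b z := by positivity
  linarith

theorem GP.exists_tail_decay : ∃ K σ : ℝ, 0 < K ∧ 0 < σ ∧ ∀ c a b w p, GP c a b → 0 ≤ c →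
    c ≤ 1 / 10 → Even1 a → Even1 b → w.re = 0 → 1 ≤ p → Integrable (en a b) →
    (∀ z, p ≤ ‖z - w‖ → |eta a b z| ≤ 1 / 10) → ∀ R, 1 ≤ R →
    ∫ z in farSet w (R * p), en a b z ≤ K / R ^ σ * ∫ z in farSet w p, en a b z := by
  obtain ⟨K, hK, H⟩ := GP.exists_tail_le
  set θ : ℝ := (1 + K) / K with hθ
  have hθ1 : 1 < θ := by rw [hθ, one_lt_div hK]; linarith
  have hθ0 : 0 < θ := by linarith
  have h2 : (2 : ℝ) ^ Real.logb 2 θ = θ := Real.rpow_logb two_pos (by norm_num) hθ0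
  have hσ : 0 < Real.logb 2 θ := Real.logb_pos (by norm_num) hθ1
  refine ⟨θ, Real.logb 2 θ, hθ0, hσ, fun c a b w p h hc hc' ea eb hw hp hi hη R hR => ?_⟩
  have iter : ∀ k : ℕ, θ ^ k * ∫ z in farSet w (2 ^ k * p), en a b z
      ≤ ∫ z in farSet w p, en a b z := by
    intro k
    induction k with
    | zero => simp
    | succ k ih =>
      have k1 : (1 : ℝ) ≤ 2 ^ k := one_le_pow₀ (by norm_num)
      have kp : p ≤ 2 ^ k * p := by nlinarith
      have e : 2 ^ (k + 1) * p / 2 = 2 ^ k * p := by rw [pow_succ]; ring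
      have s := H c a b w (2 ^ (k + 1) * p) h hc hc' ea eb hw (by rw [pow_succ]; nlinarith) hi
        (by rw [e]; exact fun z hz => hη z (kp.trans hz))
      rw [e] at s
      refine le_trans ?_ ih
      rw [pow_succ, mul_assoc]
      refine mul_le_mul_of_nonneg_left ?_ (by positivity)
      rw [hθ, div_mul_eq_mul_div, div_le_iff₀ hK]
      linarith
  obtain ⟨k, hk1, hk2⟩ := exists_nat_pow_near hR (one_lt_two : (1 : ℝ) < 2)
  have mono : ∫ z in farSet w (R * p), en a b z ≤ ∫ z in farSet w (2 ^ k * p), en a b z :=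
    setIntegral_mono_set hi.integrableOn (.of_forall (en_nonneg a b))
      (farSet_anti w (by gcongr)).eventuallyLE
  have hRσ : R ^ Real.logb 2 θ ≤ θ ^ (k + 1) := by
    calc R ^ Real.logb 2 θ ≤ ((2 : ℝ) ^ (k + 1)) ^ Real.logb 2 θ := by gcongr
      _ = θ ^ (k + 1) := by rw [← Real.rpow_pow_comm two_pos.le, h2]
  have hR0 : 0 < R ^ Real.logb 2 θ := by positivity
  rw [div_mul_eq_mul_div, le_div_iff₀ hR0]
  calc (∫ z in farSet w (R * p), en a b z) * R ^ Real.logb 2 θ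
      ≤ (∫ z in farSet w (2 ^ k * p), en a b z) * θ ^ (k + 1) :=
        mul_le_mul mono hRσ hR0.le (integral_nonneg fun z => en_nonneg a b z)
    _ = θ * (θ ^ k * ∫ z in farSet w (2 ^ k * p), en a b z) := by ring
    _ ≤ θ * ∫ z in farSet w p, en a b z := mul_le_mul_of_nonneg_left (iter k) hθ0.le

theorem exists_half_zero {u : ℂ → ℂ} (hev : evenX1 u) {zp zm m : ℂ} (hne : zp ≠ zm)
    (hz : ∀ z : ℂ, u z = 0 ↔ (z = zp ∨ z = zm)) (hm : m = (zp + zm) / 2) :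
    ∃ w : ℂ, 0 ≤ w.re ∧ m = ⟨0, w.im⟩ ∧ ∀ z, 0 < z.re → z ≠ w → u z ≠ 0 := by
  have key : ∀ z, u z = 0 → -(starRingEnd ℂ) z = zp ∨ -(starRingEnd ℂ) z = zm := fun z h =>
    (hz _).1 ((hev z).trans h)
  have hmre : m.re = (zp.re + zm.re) / 2 := by rw [hm]; simp
  have hmim : m.im = (zp.im + zm.im) / 2 := by rw [hm]; simp
  have inv : ∀ z : ℂ, -(starRingEnd ℂ) (-(starRingEnd ℂ) z) = z := fun z => by simp
  rcases key zp ((hz _).2 (.inl rfl)) with h | h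
  · have hp : zp.re = 0 := by
      have := congrArg Complex.re h
      simp only [Complex.neg_re, Complex.conj_re] at this; linarith
    have hq : zm.re = 0 := by
      rcases key zm ((hz _).2 (.inr rfl)) with h' | h'
      · exact absurd (by rw [← inv zm, h', h]) hne
      · have := congrArg Complex.re h'
        simp only [Complex.neg_re, Complex.conj_re] at this; linarith
    refine ⟨m, by rw [hmre, hp, hq]; norm_num, Complex.ext (by simp [hmre, hp, hq]) rfl,
      fun z h1 _ h2 => ?_⟩
    rcases (hz z).1 h2 with rfl | rfl <;> linarith
  · have e1 := congrArg Complex.re h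
    have e2 := congrArg Complex.im h
    simp only [Complex.neg_re, Complex.conj_re, Complex.neg_im, Complex.conj_im, neg_neg] at e1 e2
    rcases le_total 0 zp.re with h0 | h0
    · refine ⟨zp, h0, Complex.ext (by simp only [hmre]; linarith) (by simp only [hmim]; linarith),
        fun z h1 h2 h3 => ?_⟩
      rcases (hz z).1 h3 with rfl | rfl
      · exact h2 rfl
      · linarith
    · refine ⟨zm, by linarith, Complex.ext (by simp only [hmre]; linarith)
        (by simp only [hmim]; linarith), fun z h1 h2 h3 => ?_⟩
      rcases (hz z).1 h3 with rfl | rfl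
      · linarith
      · exact h2 rfl

section Components
variable {u : ℂ → ℂ}

theorem smooth_re (hu : ContDiff ℝ (⊤ : ℕ∞) u) : Smooth fun z => (u z).re :=
  Complex.reCLM.contDiff.comp hu

theorem smooth_im (hu : ContDiff ℝ (⊤ : ℕ∞) u) : Smooth fun z => (u z).im :=
  Complex.imCLM.contDiff.comp hu

theorem fderiv_re_apply (hu : Differentiable ℝ u) (z v : ℂ) :
    fderiv ℝ (fun z => (u z).re) z v = (fderiv ℝ u z v).re := by
  have h := (Complex.reCLM.hasFDerivAt.comp z (hu z).hasFDerivAt).fderiv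
  have e : fderiv ℝ (fun z => (u z).re) z = Complex.reCLM.comp (fderiv ℝ u z) := h
  rw [e]; rfl

theorem fderiv_im_apply (hu : Differentiable ℝ u) (z v : ℂ) :
    fderiv ℝ (fun z => (u z).im) z v = (fderiv ℝ u z v).im := by
  have h := (Complex.imCLM.hasFDerivAt.comp z (hu z).hasFDerivAt).fderiv
  have e : fderiv ℝ (fun z => (u z).im) z = Complex.imCLM.comp (fderiv ℝ u z) := h
  rw [e]; rfl

theorem differentiable_fderiv_apply (hu : ContDiff ℝ (⊤ : ℕ∞) u) (v : ℂ) :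
    Differentiable ℝ fun z => fderiv ℝ u z v :=
  ((contDiff_infty_iff_fderiv.1 hu).2.clm_apply contDiff_const).differentiable (by simp)

theorem sq_norm_eq (z : ℂ) : ‖z‖ ^ 2 = z.re ^ 2 + z.im ^ 2 := by
  rw [Complex.sq_norm, Complex.normSq_apply]; ring

theorem energyDensity_eq (hu : ContDiff ℝ (⊤ : ℕ∞) u) (z : ℂ) :
    energyDensity u z = en (fun z => (u z).re) (fun z => (u z).im) z := by
  have hd : Differentiable ℝ u := hu.differentiable (by simp)
  unfold energyDensity gradSq pd1 pd2 en gsq eta dx dy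
  simp only [fderiv_re_apply hd, fderiv_im_apply hd, sq_norm_eq]
  ring

theorem momDensity_eq (hu : ContDiff ℝ (⊤ : ℕ∞) u) :
    momDensity u = mom (fun z => (u z).re) (fun z => (u z).im) := by
  have hd : Differentiable ℝ u := hu.differentiable (by simp)
  funext z
  unfold momDensity pd2 mom dy
  simp only [fderiv_re_apply hd, fderiv_im_apply hd, Complex.mul_re, Complex.mul_im,
    Complex.sub_re, Complex.sub_im, Complex.conj_re, Complex.conj_im, Complex.I_re, Complex.I_im,
    Complex.one_re, Complex.one_im]
  ring

theorem TW.gp {c : ℝ} (h : TW c u) (hu : ContDiff ℝ (⊤ : ℕ∞) u) :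
    GP c (fun z => (u z).re) (fun z => (u z).im) := by
  have hd : Differentiable ℝ u := hu.differentiable (by simp)
  have r : ∀ v, (fun z => fderiv ℝ (fun z => (u z).re) z v) = fun z => (fderiv ℝ u z v).re :=
    fun v => funext fun z => fderiv_re_apply hd z v
  have i : ∀ v, (fun z => fderiv ℝ (fun z => (u z).im) z v) = fun z => (fderiv ℝ u z v).im :=
    fun v => funext fun z => fderiv_im_apply hd z v
  have r2 : ∀ v v' z, fderiv ℝ (fun z => fderiv ℝ (fun z => (u z).re) z v) z v'
      = (fderiv ℝ (fun z => fderiv ℝ u z v) z v').re := fun v v' z => by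
    rw [r, fderiv_re_apply (differentiable_fderiv_apply hu v)]
  have i2 : ∀ v v' z, fderiv ℝ (fun z => fderiv ℝ (fun z => (u z).im) z v) z v'
      = (fderiv ℝ (fun z => fderiv ℝ u z v) z v').im := fun v v' z => by
    rw [i, fderiv_im_apply (differentiable_fderiv_apply hu v)]
  refine ⟨smooth_re hu, smooth_im hu, fun z => ?_, fun z => ?_⟩
  · have e := congrArg Complex.re (h z)
    change fderiv ℝ (fun z => fderiv ℝ (fun z => (u z).re) z 1) z 1
      + fderiv ℝ (fun z => fderiv ℝ (fun z => (u z).re) z Complex.I) z Complex.I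
      = c * fderiv ℝ (fun z => (u z).im) z Complex.I - _
    rw [r2, r2, fderiv_im_apply hd]
    have s := sq_norm_eq (u z)
    simp only [lap, Complex.sub_re, Complex.neg_re, Complex.mul_re, Complex.mul_im, Complex.add_re,
      Complex.I_re, Complex.I_im, Complex.ofReal_re, Complex.ofReal_im, Complex.zero_re, s] at e
    unfold pd2 at e
    change _ - ((fderiv ℝ (fun z => fderiv ℝ u z 1) z 1).re + _) - _ = _ at e
    linarith
  · have e := congrArg Complex.im (h z)
    change fderiv ℝ (fun z => fderiv ℝ (fun z => (u z).im) z 1) z 1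
      + fderiv ℝ (fun z => fderiv ℝ (fun z => (u z).im) z Complex.I) z Complex.I
      = -c * fderiv ℝ (fun z => (u z).re) z Complex.I - _
    rw [i2, i2, fderiv_re_apply hd]
    have s := sq_norm_eq (u z)
    simp only [lap, Complex.sub_im, Complex.neg_im, Complex.mul_re, Complex.mul_im, Complex.add_im,
      Complex.I_re, Complex.I_im, Complex.ofReal_re, Complex.ofReal_im, Complex.zero_im, s] at e
    unfold pd2 at e
    change _ - ((fderiv ℝ (fun z => fderiv ℝ u z 1) z 1).im + _) - _ = _ at e
    linarith

theorem memE.integrable_en (h : memE u) :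
    Integrable (en (fun z => (u z).re) (fun z => (u z).im)) := by
  have hs := (smooth_re h.1).en (smooth_im h.1)
  refine ⟨hs.continuous.aestronglyMeasurable, ?_⟩
  rw [hasFiniteIntegral_iff_ofReal (.of_forall (en_nonneg _ _))]
  have := h.2
  rw [energy] at this
  simpa only [energyDensity_eq h.1] using this

theorem memE.integral_en (h : memE u) :
    ∫ z, en (fun z => (u z).re) (fun z => (u z).im) z = Efun u := by
  rw [integral_eq_lintegral_of_nonneg_ae (.of_forall (en_nonneg _ _))
    ((smooth_re h.1).en (smooth_im h.1)).continuous.aestronglyMeasurable, Efun, energy]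
  simp only [energyDensity_eq h.1]

end Components

/-- energy tail estimate away from the midpoint of the vortices. -/
theorem energy_tail (Λ₀ : ℝ) (hΛ₀ : 0 < Λ₀) :
    ∃ σ₀ C p₀ : ℝ, 0 < σ₀ ∧ 0 < C ∧ 0 < p₀ ∧
      ∀ (u : ℂ → ℂ) (p c : ℝ), QuasiMin Λ₀ u p c → p₀ ≤ p →
        ∀ (zp zm m : ℂ), zp ≠ zm → (∀ z : ℂ, u z = 0 ↔ (z = zp ∨ z = zm)) →
          m = (zp + zm) / 2 →
          ∀ R : ℝ, 1 ≤ R →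
            (∫ z in {z : ℂ | R * p ≤ ‖z - m‖},
              (gradSq u z + (1 / 2) * (1 - ‖u z‖ ^ 2) ^ 2)) ≤ C / R ^ σ₀ := by
  obtain ⟨K, σ, hK, hσ, decay⟩ := GP.exists_tail_decay
  obtain ⟨p₀, hp₀⟩ := eventually_atTop.1
    ((eventually_concentrated Λ₀ hΛ₀).and (eventually_abs_eta_le Λ₀ hΛ₀))
  have hF := farBound_pos hΛ₀
  refine ⟨σ, 2 * (K * farBound Λ₀), max p₀ 1, hσ, by positivity, by positivity, ?_⟩
  rintro u p c ⟨hE, hev, hc, hTW, hmi, hP, hEn⟩ hp zp zm m hne hz hm R hR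
  obtain ⟨w, hw, hmw, hzero⟩ := exists_half_zero hev hne hz hm
  obtain ⟨H1, H2⟩ := hp₀ p (le_trans (le_max_left _ _) hp)
  have hp1 : 1 ≤ p := le_trans (le_max_right _ _) hp
  have gp := hTW.gp hE.1
  set a : ℂ → ℝ := fun z => (u z).re with ha
  set b : ℂ → ℝ := fun z => (u z).im with hb
  have hi : Integrable (en a b) := hE.integrable_en
  have ea : Even1 a := fun z => congrArg Complex.re (hev z)
  have eb : Even1 b := fun z => congrArg Complex.im (hev z)
  have hmom : momDensity u = mom a b := momDensity_eq hE.1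
  have half : HalfZero a b w := fun z h1 h2 => by
    have h3 := hzero z h1 h2
    have : 0 < ‖u z‖ ^ 2 := by positivity
    rwa [sq_norm_eq] at this
  have hPm : 1 / 2 * ∫ z, mom a b z = p := by rw [← hmom]; exact hP
  rw [momInt, hmom] at hmi
  obtain ⟨f1, -, f3⟩ := H1 a b w ⟨gp.sa, gp.sb, hi, hE.integral_en.trans_le hEn⟩ ea eb hmi hPm
    half hw
  rw [← hmw] at f1
  obtain ⟨g1, g2⟩ := H2 c a b m gp hc.le (f3 c gp hc.le) hi f1
  have t := decay c a b m p gp hc.le g1 ea eb (by rw [hmw]) hp1 hi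
    (fun z hz => g2 z (by linarith)) R hR
  have e : ∀ z, gradSq u z + 1 / 2 * (1 - ‖u z‖ ^ 2) ^ 2 = 2 * en a b z := fun z => by
    rw [← energyDensity_eq hE.1, energyDensity]; ring
  simp only [e]
  rw [integral_const_mul]
  have far : ∫ z in farSet m p, en a b z ≤ farBound Λ₀ :=
    (setIntegral_mono_set hi.integrableOn (.of_forall (en_nonneg a b))
      (farSet_anti m (by linarith : p / 2 ≤ p)).eventuallyLE).trans f1
  have hRσ : 0 ≤ K / R ^ σ := by positivity
  calc 2 * ∫ z in farSet m (R * p), en a b z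
      ≤ 2 * (K / R ^ σ * farBound Λ₀) := by
        have := mul_le_mul_of_nonneg_left far hRσ
        linarith
    _ = _ := by ring
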